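/- Let ω be a random point measure on X with an isometry invariant, insertion-tolerant law, and let G be the graph with vertex set supp(ω) and an edge between x, x' ∈ supp(ω) whenever B(x,1) ∩ B(x',1) ≠ ∅. If G has infinitely many infinite connected components almost surely, then almost surely every infinite connected component of G is transient, i.e., simple random walk on it is transient. -/

import Mathlib

open MeasureTheory Metric Set Bornology Function
open scoped ENNReal NNReal unitInterval

noncomputable section

namespace BooleanModel

/-- The space of simple, locally finite point configurations on a metric space `X`
(realizations of simple counting measures on `X`). -/
def Config (X : Type*) [MetricSpace X] : Type _ :=
  {s : Set X // ∀ K : Set X, IsBounded K → (s ∩ K).Finite}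

namespace Config

variable {X : Type*} [MetricSpace X]

/-- The σ-algebra on `Config X` generated by the evaluation (counting) maps `ω ↦ ω(B)`. -/
instance instMeasurableSpace [MeasurableSpace X] : MeasurableSpace (Config X) :=
  MeasurableSpace.generateFrom
    {A | ∃ (B : Set X) (n : ℕ∞), MeasurableSet B ∧ A = {s : Config X | (s.1 ∩ B).encard = n}}

/-- The number of points of the configuration `s` lying in `B`. -/
def count (B : Set X) (s : Config X) : ℕ∞ := (s.1 ∩ B).encard

/-- Adding a point to a configuration (`ω + δ_y`). -/
def insertPt (y : X) (s : Config X) : Config X :=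
  ⟨insert y s.1, by
    intro K hK
    refine ((s.2 K hK).insert y).subset ?_
    rintro z ⟨hz1, hz2⟩
    rcases Set.mem_insert_iff.1 hz1 with rfl | h
    · exact Set.mem_insert _ _
    · exact Set.mem_insert_of_mem _ ⟨h, hz2⟩⟩

/-- The restriction `ω|_{B^c}` of a configuration to the complement of `B`. -/
def restrict (B : Set X) (s : Config X) : Config X :=
  ⟨s.1 ∩ Bᶜ, fun K hK => (s.2 K hK).subset fun z hz => ⟨hz.1.1, hz.2⟩⟩

/-- Push-forward of a configuration under an isometry of `X`. -/
def mapIso (γ : X ≃ᵢ X) (s : Config X) : Config X :=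
  ⟨⇑γ '' s.1, by
    intro K hK
    have h1 : ⇑γ ⁻¹' K = ⇑γ.symm '' K := by
      ext z
      constructor
      · intro hz; exact ⟨γ z, hz, γ.symm_apply_apply z⟩
      · rintro ⟨w, hw, rfl⟩; simpa using hw
    have h2 : ⇑γ '' s.1 ∩ K = ⇑γ '' (s.1 ∩ ⇑γ ⁻¹' K) := (Set.image_inter_preimage _ _ _).symm
    rw [h2]
    refine (s.2 _ ?_).image _
    rw [h1]
    exact γ.symm.isometry.lipschitz.isBounded_image hK⟩

end Config

section BasicDefs

variable {X : Type*} [MetricSpace X]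

/-- The occupied set of the Boolean model with unit radii driven by `s`. -/
def occupied (s : Config X) : Set X := ⋃ x ∈ s.1, closedBall x 1

/-- The vacant set of the Boolean model with unit radii driven by `s`. -/
def vacant (s : Config X) : Set X := (occupied s)ᶜ

/-- The collection of connected components of a set `S ⊆ X`. -/
def comps (S : Set X) : Set (Set X) := {C | ∃ x ∈ S, C = connectedComponentIn S x}

/-- The collection of unbounded connected components of `S`. -/
def ucomps (S : Set X) : Set (Set X) := {C | C ∈ comps S ∧ ¬IsBounded C}

/-- The number of connected components of `S`. -/
def numComps (S : Set X) : ℕ∞ := (comps S).encard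

/-- `N_S`: the number of unbounded connected components of `S`. -/
def numUcomps (S : Set X) : ℕ∞ := (ucomps S).encard

/-- A metric space is point-symmetric (the metric counterpart of being a Riemannian
symmetric space) if every point `x` admits a geodesic-reversing isometry fixing `x`,
i.e. an isometric point reflection around `x`. -/
def PointSymmetric (X : Type*) [MetricSpace X] : Prop :=
  ∀ x : X, ∃ invol : X ≃ᵢ X, invol x = x ∧ ∀ y : X, dist y (invol y) = 2 * dist x y

/-- The local connected component `C_S(y,r)`. -/
def localComp (S : Set X) (y : X) (r : ℝ) : Set X :=
  connectedComponentIn (S ∩ closedBall y r) y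

end BasicDefs

section MeasureDefs

variable {X : Type*} [MetricSpace X] [MeasurableSpace X]

/-- A measure on `Config X` is isometry invariant if it is preserved by the push-forward
action of every isometry of `X`. -/
def IsoInvariant (P : Measure (Config X)) : Prop :=
  ∀ γ : X ≃ᵢ X, Measure.map (Config.mapIso γ) P = P

/-- Every isometry-invariant event has probability `0` or `1`. -/
def ErgodicIso (P : Measure (Config X)) : Prop :=
  ∀ E : Set (Config X), MeasurableSet E →
    (∀ γ : X ≃ᵢ X, Config.mapIso γ ⁻¹' E = E) → P E = 0 ∨ P E = 1

/-- `P` is insertion-tolerant: for every Borel `B` with `0 < μ B < ∞`, the law of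
`ω + δ_Y` with `Y` uniform in `B` independent of `ω` is absolutely continuous w.r.t. `P`. -/
def InsertionTolerant (μ : Measure X) (P : Measure (Config X)) : Prop :=
  ∀ B : Set X, MeasurableSet B → 0 < μ B → μ B < ⊤ →
    Measure.map (fun p : Config X × X => Config.insertPt p.2 p.1)
      (P.prod ((μ B)⁻¹ • μ.restrict B)) ≪ P

/-- `P` is deletion-tolerant: for every Borel `B` with `0 < μ B < ∞`, the law of
`ω|_{B^c}` is absolutely continuous w.r.t. `P`. -/
def DeletionTolerant (μ : Measure X) (P : Measure (Config X)) : Prop :=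
  ∀ B : Set X, MeasurableSet B → 0 < μ B → μ B < ⊤ →
    Measure.map (Config.restrict B) P ≪ P

/-- `P` is the law of the Poisson point measure on `X` with intensity `ν`:
counts in disjoint Borel sets are independent with the correct Poisson distributions. -/
def IsPoisson (ν : Measure X) (P : Measure (Config X)) : Prop :=
  IsProbabilityMeasure P ∧
  (∀ B : Set X, MeasurableSet B → ν B < ⊤ → ∀ k : ℕ,
      P {s : Config X | Config.count B s = k} =
        ENNReal.ofReal (Real.exp (-(ν B).toReal) * (ν B).toReal ^ k / (Nat.factorial k))) ∧
  (∀ B : Set X, MeasurableSet B → ν B = ⊤ → P {s : Config X | (s.1 ∩ B).Infinite} = 1) ∧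
  (∀ (n : ℕ) (B : Fin n → Set X) (k : Fin n → ℕ),
      (∀ i, MeasurableSet (B i)) → (Pairwise fun i j => Disjoint (B i) (B j)) →
      P {s : Config X | ∀ i, Config.count (B i) s = k i} =
        ∏ i, P {s : Config X | Config.count (B i) s = k i})

end MeasureDefs

section PathDefs

variable {X : Type*} [MetricSpace X]

/-- The intrinsic distance between `x` and `y` within the set `S`: the infimum of the lengths
of continuous paths from `x` to `y` whose range is contained in `S`. -/
def pathDistIn (S : Set X) (x y : X) : ℝ≥0∞ :=
  ⨅ (γ : Path x y) (_ : Set.range ⇑γ ⊆ S), eVariationOn ⇑γ Set.univ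

/-- Intrinsic distance within `S` between two subsets `A` and `B`. -/
def setDistIn (S A B : Set X) : ℝ≥0∞ :=
  ⨅ (a : X) (_ : a ∈ A) (b : X) (_ : b ∈ B), pathDistIn S a b

/-- `y` is an `r`-trifurcation (marked by a point of `Y`) for the set `S`. -/
def IsTrifurcation (S : Set X) (Y : Set X) (r : ℝ) (y : X) : Prop :=
  y ∈ Y ∧ closedBall y 1 ⊆ S ∧ (∀ y' ∈ Y, y' ≠ y → 2 * r < dist y y') ∧
    3 ≤ numUcomps (connectedComponentIn S y \ localComp S y r)

end PathDefs

end BooleanModel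
namespace BooleanModel

section Transience

variable {X : Type*} [MetricSpace X]

/-- The adjacency relation of the graph of the Boolean model driven by `ω`:
two points of the configuration are neighbours iff the closed unit balls around
them intersect. -/
def boolAdj (s : Config X) (x x' : X) : Prop :=
  x ∈ s.1 ∧ x' ∈ s.1 ∧ x ≠ x' ∧ (closedBall x 1 ∩ closedBall x' 1).Nonempty

/-- The connected component (cluster) of `x` in the graph with adjacency relation `adj`. -/
def graphComp (adj : X → X → Prop) (x : X) : Set X :=
  {z | Relation.ReflTransGen adj x z}

/-- A locally finite connected graph is transient (i.e. the simple random walk on it is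
transient) if and only if it carries a unit flow from some vertex to infinity with finite
energy (T. Lyons' criterion).  `Transient adj x` expresses, through this criterion, that
the simple random walk on the connected component of `x` in the graph with adjacency
relation `adj` is transient. -/
def TransientFrom (adj : X → X → Prop) (x : X) : Prop :=
  ∃ θ : X → X → ℝ,
    (∀ a b, θ a b = -θ b a) ∧
    (∀ a b, ¬adj a b → θ a b = 0) ∧
    (∀ a, Summable (θ a)) ∧
    (∀ a, a ≠ x → ∑' b, θ a b = 0) ∧
    (∑' b, θ x b = 1) ∧
    Summable (fun p : X × X => (θ p.1 p.2) ^ 2)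

end Transience

set_option linter.unusedSectionVars false

section Geometry

variable {X : Type*} [MetricSpace X]

/-- Isometric point reflections around `m`. -/
def Refl (m : X) : Set (X ≃ᵢ X) := {s | s m = m ∧ ∀ y, dist y (s y) = 2 * dist m y}

lemma refl_conv {x : X} {s : X ≃ᵢ X} (hs : s ∈ Refl x) (a y : X) :
    2 * dist x a ≤ dist a y + dist a (s y) := by
  have h := hs.2 a
  have h2 := dist_triangle a (s y) (s a)
  rw [s.isometry.dist_eq, dist_comm y a] at h2
  linarith

lemma refl_inv {x : X} {s : X ≃ᵢ X} (hs : s ∈ Refl x) : s⁻¹ ∈ Refl x := by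
  have hx : s⁻¹ x = x := by
    have := congrArg (fun z => s⁻¹ z) hs.1
    rw [← IsometryEquiv.mul_apply] at this
    simpa using this.symm
  refine ⟨hx, fun y => ?_⟩
  have h := hs.2 (s⁻¹ y)
  rw [← IsometryEquiv.mul_apply, mul_inv_cancel, IsometryEquiv.coe_one, id] at h
  rw [dist_comm, h]
  congr 1
  rw [← s.isometry.dist_eq, ← IsometryEquiv.mul_apply, mul_inv_cancel, hs.1]; rfl

lemma refl_conj {x : X} {s : X ≃ᵢ X} (hs : s ∈ Refl x) (g : X ≃ᵢ X) :
    g * s * g⁻¹ ∈ Refl (g x) := by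
  have hg : ∀ z, g⁻¹ (g z) = z := fun z => by
    rw [← IsometryEquiv.mul_apply]; simp
  have hg' : ∀ z, g (g⁻¹ z) = z := fun z => by
    rw [← IsometryEquiv.mul_apply]; simp
  refine ⟨by simp only [IsometryEquiv.mul_apply]; rw [hg, hs.1], fun y => ?_⟩
  simp only [IsometryEquiv.mul_apply]
  have h := hs.2 (g⁻¹ y)
  rw [← g.isometry.dist_eq, hg', ← g.isometry.dist_eq x, hg'] at h
  exact h

lemma dist_pow_le (g : X ≃ᵢ X) (a : X) (k : ℕ) : dist a ((g ^ k) a) ≤ k * dist a (g a) := by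
  induction k with
  | zero => simp
  | succ k ih =>
    have h := dist_triangle a ((g ^ k) a) ((g ^ (k+1)) a)
    rw [pow_succ, IsometryEquiv.mul_apply, (g ^ k).isometry.dist_eq] at h
    rw [pow_succ, IsometryEquiv.mul_apply]
    push_cast
    linarith

/-- Point reflections expand distances between centres by at least `2`. -/
lemma refl_expand {m m' : X} {s s' : X ≃ᵢ X} (hs : s ∈ Refl m) (hs' : s' ∈ Refl m') (a : X) :
    2 * dist m m' ≤ dist (s a) (s' a) := by
  set g : X ≃ᵢ X := s'⁻¹ * s with hg
  set r := dist m m'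
  have hgm : g m = s'⁻¹ m := by rw [hg, IsometryEquiv.mul_apply, hs.1]
  have hpow : ∀ (k : ℕ) (u v : X), dist u ((g ^ k) v) = dist ((g ^ k)⁻¹ u) v := by
    intro k u v
    rw [← (g ^ k).isometry.dist_eq ((g ^ k)⁻¹ u), ← IsometryEquiv.mul_apply, mul_inv_cancel]; rfl
  have h1 : ∀ k : ℕ, 2 * dist m ((g ^ k) m') ≤ dist m ((g ^ k) m) + dist m ((g ^ (k+1)) m) := by
    intro k
    have := refl_conv (refl_inv hs') ((g ^ k)⁻¹ m) m
    rw [pow_succ, IsometryEquiv.mul_apply, hgm, hpow, hpow, hpow, dist_comm _ m']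
    exact this
  have h2 : ∀ k : ℕ, 2 * dist m ((g ^ (k+1)) m) ≤
      dist m ((g ^ k) m') + dist m ((g ^ (k+1)) m') := by
    intro k
    have ht := refl_conj hs s'⁻¹
    have := refl_conv ht ((g ^ k)⁻¹ m) m'
    have e : (s'⁻¹ * s * s'⁻¹⁻¹) m' = g m' := by
      simp only [IsometryEquiv.mul_apply, inv_inv, hs'.1, hg]
    rw [e, ← hgm] at this
    have e2 : ∀ w, (g ^ (k+1)) w = (g ^ k) (g w) := fun w => by
      rw [pow_succ, IsometryEquiv.mul_apply]
    rw [e2, e2, hpow, hpow, hpow, dist_comm _ (g m)]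
    exact this
  have h3 : ∀ k : ℕ, r ≤ dist m ((g ^ k) m') - dist m ((g ^ k) m) ∧ 2 * k * r ≤ dist m ((g ^ k) m) := by
    intro k
    induction k with
    | zero => simp [r]
    | succ k ih =>
      have a1 := h1 k
      have a2 := h2 k
      push_cast
      constructor <;> linarith [ih.1, ih.2]
  have h4 : ∀ k : ℕ, (k : ℝ) * (2 * r - dist a (g a)) ≤ 2 * dist m a := by
    intro k
    have a1 := (h3 k).2
    have a2 := dist_pow_le g a k
    have a3 := dist_triangle4 m a ((g ^ k) a) ((g ^ k) m)
    rw [(g ^ k).isometry.dist_eq, dist_comm a m] at a3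
    linarith
  have h5 : dist a (g a) = dist (s a) (s' a) := by
    rw [hg, ← s'.isometry.dist_eq, ← IsometryEquiv.mul_apply, ← mul_assoc, mul_inv_cancel, one_mul,
      dist_comm]
  rw [← h5]
  by_contra hcon
  push Not at hcon
  obtain ⟨k, hk⟩ := exists_nat_gt (2 * dist m a / (2 * r - dist a (g a)))
  rw [div_lt_iff₀ (by linarith)] at hk
  linarith [h4 k]

lemma dense_orbit [ProperSpace X] [PreconnectedSpace X] (H : Subgroup (X ≃ᵢ X))
    (hH : ∀ m : X, ∃ s ∈ H, s ∈ Refl m) (x0 y : X) {ε : ℝ} (hε : 0 < ε) :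
    ∃ h ∈ H, dist y (h x0) < ε := by
  classical
  set O : Set X := {z | ∃ h ∈ H, h x0 = z} with hO
  have hx0 : x0 ∈ O := ⟨1, H.one_mem, rfl⟩
  have hOne : O.Nonempty := ⟨x0, hx0⟩
  by_contra hcon
  push Not at hcon
  set ρ := infDist y O with hρ
  have hρpos : 0 < ρ := by
    refine lt_of_lt_of_le hε ?_
    refine (le_infDist hOne).2 ?_
    rintro z ⟨h, hh, rfl⟩
    exact hcon h hh
  have hinv : ∀ h ∈ H, ∀ z, infDist (h z) O = infDist z O := by
    intro h hh z
    have : h '' O = O := by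
      ext w
      constructor
      · rintro ⟨_, ⟨k, hk, rfl⟩, rfl⟩
        exact ⟨h * k, H.mul_mem hh hk, rfl⟩
      · rintro ⟨k, hk, rfl⟩
        refine ⟨(h⁻¹ * k) x0, ⟨_, H.mul_mem (H.inv_mem hh) hk, rfl⟩, ?_⟩
        rw [← IsometryEquiv.mul_apply, mul_inv_cancel_left]
    conv_lhs => rw [← this]
    exact infDist_image h.isometry
  have hex : ∀ k : ℕ, ∃ z, infDist z O = ρ / 2 ^ k ∧ dist z x0 < 2 * ρ / 2 ^ k := by
    intro k
    have hp : 0 < ρ / 2 ^ k := by positivity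
    obtain ⟨z, hz⟩ := mem_range_of_exists_le_of_exists_ge (continuous_infDist_pt O)
      (c := ρ / 2 ^ k) ⟨x0, by rw [infDist_zero_of_mem hx0]; exact hp.le⟩
      ⟨y, div_le_self hρpos.le (one_le_pow₀ (by norm_num))⟩
    have : infDist z O < 2 * ρ / 2 ^ k := by
      have e : 2 * ρ / 2 ^ k = 2 * (ρ / 2 ^ k) := by ring
      have hz' : infDist z O = ρ / 2 ^ k := hz
      rw [hz', e]; linarith
    obtain ⟨_, ⟨h, hh, rfl⟩, hd⟩ := (infDist_lt_iff hOne).1 this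
    refine ⟨h⁻¹ z, ?_, ?_⟩
    · rw [hinv _ (H.inv_mem hh)]; exact hz
    · rw [← h.isometry.dist_eq, ← IsometryEquiv.mul_apply, mul_inv_cancel]; exact hd
  choose Y hY1 hY2 using hex
  choose sg hsgH hsg using hH
  set D : X → X := fun z => sg z x0 with hD
  have hD1 : ∀ a b, 2 * dist a b ≤ dist (D a) (D b) := fun a b => refl_expand (hsg a) (hsg b) x0
  have hD2 : ∀ a, dist x0 (D a) = 2 * dist x0 a := fun a => by
    rw [(hsg a).2 x0, dist_comm a]
  have hD1k : ∀ k a b, 2 ^ k * dist a b ≤ dist (D^[k] a) (D^[k] b) := by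
    intro k
    induction k with
    | zero => intro a b; simp
    | succ k ih =>
      intro a b
      rw [iterate_succ_apply, iterate_succ_apply]
      have := ih (D a) (D b)
      have h2 := hD1 a b
      have h3 : (0:ℝ) < 2 ^ k := by positivity
      rw [pow_succ]
      nlinarith
  have hD2k : ∀ k a, dist x0 (D^[k] a) = 2 ^ k * dist x0 a := by
    intro k
    induction k with
    | zero => intro a; simp
    | succ k ih =>
      intro a
      rw [iterate_succ_apply, ih, hD2, pow_succ]; ring
  set Z : ℕ → X := fun k => D^[k] (Y k) with hZ
  have hZb : ∀ k, Z k ∈ closedBall x0 (2 * ρ) := by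
    intro k
    rw [mem_closedBall, dist_comm, hD2k, dist_comm]
    have := hY2 k
    rw [lt_div_iff₀ (by positivity)] at this
    linarith
  obtain ⟨w, -, φ, hφ, hlim⟩ := (isCompact_closedBall x0 (2 * ρ)).tendsto_subseq hZb
  have hc := hlim.cauchySeq
  rw [Metric.cauchySeq_iff] at hc
  obtain ⟨N, hN⟩ := hc ρ hρpos
  have hlt := hN N le_rfl (N+1) (by omega)
  have hkj : φ N < φ (N+1) := hφ (by omega)
  set k := φ N
  set j := φ (N+1)
  obtain ⟨i, hi⟩ : ∃ i, j = k + (i + 1) := ⟨j - k - 1, by omega⟩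
  have e : Z j = D^[k] (D^[i+1] (Y j)) := by
    simp only [hZ]
    rw [← iterate_add_apply, ← hi]
  have h6 := hD1k k (Y k) (D^[i+1] (Y j))
  rw [← e] at h6
  have h7 : D^[i+1] (Y j) ∈ O := by
    rw [iterate_succ_apply']
    exact ⟨_, hsgH _, rfl⟩
  have h8 := infDist_le_dist_of_mem (x := Y k) h7
  rw [hY1, div_le_iff₀ (by positivity)] at h8
  have h9 : dist (Z k) (Z j) < ρ := hlt
  have h10 : 2 ^ k * dist (Y k) (D^[i+1] (Y j)) ≤ dist (Z k) (Z j) := h6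
  linarith

end Geometry

section Haar

open Measure Pointwise in
lemma modular_bdd {G : Type*} [TopologicalSpace G] [Group G] [IsTopologicalGroup G]
    [LocallyCompactSpace G] [SigmaCompactSpace G] {K : Set G} (hK : IsCompact K) :
    ∃ M : ℝ≥0, ∀ g ∈ K, modularCharacterFun g ≤ M := by
  borelize G
  let lam : Measure G := haar
  obtain ⟨U⟩ : Nonempty (TopologicalSpace.PositiveCompacts G) := inferInstance
  have hU0 : lam (closure U) ≠ 0 :=
    ((measure_pos_of_nonempty_interior lam U.interior_nonempty).trans_le
      (measure_mono subset_closure)).ne'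
  have hUc : IsCompact (closure (U : Set G)) := U.isCompact.closure
  have hUt : lam (closure U) ≠ ⊤ := hUc.measure_lt_top.ne
  have hV : lam (closure (U : Set G) * K⁻¹) ≠ ⊤ := (hUc.mul hK.inv).measure_lt_top.ne
  refine ⟨(lam (closure (U : Set G) * K⁻¹) / lam (closure U)).toNNReal, fun g hg => ?_⟩
  have h := map_right_mul_eq_modularCharacterFun_smul lam g
  have h2 := congrArg (fun m : Measure G => m (closure U)) h
  rw [map_apply (measurable_mul_const g) isClosed_closure.measurableSet] at h2
  have h3 : (fun x => x * g) ⁻¹' (closure (U : Set G)) ⊆ closure (U : Set G) * K⁻¹ := by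
    intro x hx
    refine ⟨x * g, hx, g⁻¹, Set.inv_mem_inv.2 hg, by simp⟩
  have h4 := measure_mono (μ := lam) h3
  rw [h2] at h4
  rw [← ENNReal.coe_le_coe, ENNReal.coe_toNNReal (ENNReal.div_lt_top hV hU0).ne,
    ENNReal.le_div_iff_mul_le (Or.inl hU0) (Or.inl hUt)]
  rw [Measure.smul_apply, ENNReal.smul_def, smul_eq_mul] at h4
  exact h4

open Measure in
lemma modular_le_one {G : Type*} [TopologicalSpace G] [Group G] [IsTopologicalGroup G]
    [LocallyCompactSpace G] {g : G} {M : ℝ≥0} (h : ∀ n : ℕ, modularCharacterFun (g ^ n) ≤ M) :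
    modularCharacterFun g ≤ 1 := by
  by_contra hcon
  push Not at hcon
  have : ∀ n : ℕ, modularCharacterFun (g ^ n) = modularCharacterFun g ^ n :=
    fun n => map_pow (modularCharacter (G := G)) g n
  obtain ⟨n, hn⟩ := pow_unbounded_of_one_lt M hcon
  have h2 := h n
  rw [this] at h2
  exact absurd h2 (not_le.2 hn)

open Measure in
lemma modular_inv_mul {G : Type*} [TopologicalSpace G] [Group G] [IsTopologicalGroup G]
    [LocallyCompactSpace G] (g : G) :
    modularCharacterFun g⁻¹ * modularCharacterFun g = 1 := by
  rw [← modularCharacterFun_map_mul]; simp [modularCharacterFun_map_one]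

open Measure in
lemma modular_eq_one {G : Type*} [TopologicalSpace G] [Group G] [IsTopologicalGroup G]
    [LocallyCompactSpace G] {g : G} (h : modularCharacterFun g ≤ 1)
    (h' : modularCharacterFun g⁻¹ ≤ 1) : modularCharacterFun g = 1 := by
  refine le_antisymm h ?_
  calc (1 : ℝ≥0) = modularCharacterFun g⁻¹ * modularCharacterFun g := (modular_inv_mul g).symm
    _ ≤ 1 * modularCharacterFun g := by gcongr
    _ = _ := one_mul _

open Measure in
lemma haar_inv_inv {G : Type*} [TopologicalSpace G] [Group G] [IsTopologicalGroup G]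
    [LocallyCompactSpace G] [SigmaCompactSpace G] [MeasurableSpace G] [BorelSpace G]
    (h : ∀ g : G, modularCharacterFun g = 1) : (haar : Measure G).IsInvInvariant := by
  set μ : Measure G := haar with hμ
  have hri : μ.IsMulRightInvariant := by
    constructor
    intro g
    rw [map_right_mul_eq_modularCharacterFun_smul μ g, h, one_smul]
  constructor
  let c : ℝ≥0∞ := haarScalarFactor μ.inv μ
  have hc : μ.inv = c • μ := isMulLeftInvariant_eq_smul_of_innerRegular μ.inv μ
  have : map Inv.inv (map Inv.inv μ) = c ^ 2 • μ := by
    rw [← inv_def μ, hc, Measure.map_smul, ← inv_def μ, hc, smul_smul, pow_two]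
  have μeq : μ = c ^ 2 • μ := by
    rw [map_map continuous_inv.measurable continuous_inv.measurable] at this
    simpa only [inv_involutive, Involutive.comp_self, Measure.map_id]
  have K : TopologicalSpace.PositiveCompacts G := Classical.arbitrary _
  have : c ^ 2 * μ K = 1 ^ 2 * μ K := by
    conv_rhs => rw [μeq]
    simp
  have : c ^ 2 = 1 ^ 2 :=
    (ENNReal.mul_left_inj (measure_pos_of_nonempty_interior _ K.interior_nonempty).ne'
          K.isCompact.measure_lt_top.ne).1 this
  have : c = 1 := (ENNReal.pow_right_strictMono two_ne_zero).injective this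
  rw [hc, this, one_smul]

variable {X : Type*} [MetricSpace X]

/-- The isometry group, to be equipped with the topology of pointwise convergence. -/
def IG (X : Type*) [MetricSpace X] : Type _ := X ≃ᵢ X

instance : Group (IG X) := inferInstanceAs (Group (X ≃ᵢ X))

/-- evaluation -/
def IG.ev (g : IG X) (x : X) : X := (show X ≃ᵢ X from g) x

lemma IG.ev_mul (g h : IG X) (x : X) : (g * h).ev x = g.ev (h.ev x) := rfl
lemma IG.ev_one (x : X) : (1 : IG X).ev x = x := rfl
lemma IG.dist_ev (g : IG X) (x y : X) : dist (g.ev x) (g.ev y) = dist x y :=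
  IsometryEquiv.dist_eq (show X ≃ᵢ X from g) x y
lemma IG.ev_inv_ev (g : IG X) (x : X) : g⁻¹.ev (g.ev x) = x := by
  rw [← IG.ev_mul, inv_mul_cancel, IG.ev_one]
lemma IG.ev_ev_inv (g : IG X) (x : X) : g.ev (g⁻¹.ev x) = x := by
  rw [← IG.ev_mul, mul_inv_cancel, IG.ev_one]
lemma IG.dist_ev_inv (g : IG X) (x y : X) : dist (g.ev x) y = dist x (g⁻¹.ev y) := by
  rw [← IG.dist_ev g x, IG.ev_ev_inv]
lemma IG.ext {g h : IG X} (H : ∀ x, g.ev x = h.ev x) : g = h := IsometryEquiv.ext H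

/-- the defining embedding -/
def IG.emb (g : IG X) : (X → X) × (X → X) := (g.ev, g⁻¹.ev)

instance : TopologicalSpace (IG X) := TopologicalSpace.induced IG.emb inferInstance

lemma IG.emb_inj : Injective (IG.emb (X := X)) := by
  intro g h hgh
  exact IG.ext fun x => congrFun (congrArg Prod.fst hgh) x

lemma IG.isClosedEmbedding_emb : Topology.IsClosedEmbedding (IG.emb (X := X)) := by
  refine ⟨⟨⟨rfl⟩, IG.emb_inj⟩, ?_⟩
  have : range (IG.emb (X := X)) = {p | ∀ x y, dist (p.1 x) y = dist x (p.2 y)} := by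
    ext p
    constructor
    · rintro ⟨g, rfl⟩ x y
      exact IG.dist_ev_inv g x y
    · intro hp
      have h1 : ∀ x, p.2 (p.1 x) = x := fun x => by
        have := hp x (p.1 x); rw [dist_self] at this
        exact (dist_eq_zero.1 this.symm).symm
      have h2 : ∀ x, p.1 (p.2 x) = x := fun x => by
        have := hp (p.2 x) x; rw [dist_self] at this
        exact dist_eq_zero.1 this
      let g : X ≃ᵢ X := IsometryEquiv.mk' p.1 p.2 h2
        (Isometry.of_dist_eq fun x y => by rw [hp, h1])
      refine ⟨g, ?_⟩
      rfl
  rw [this]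
  simp only [ofPred_forall]
  refine isClosed_iInter fun x => isClosed_iInter fun y => isClosed_eq ?_ ?_
  · exact ((continuous_apply x).comp continuous_fst).dist continuous_const
  · exact continuous_const.dist ((continuous_apply y).comp continuous_snd)

lemma IG.continuous_ev_const (x : X) : Continuous fun g : IG X => g.ev x :=
  (continuous_apply x).comp
    (continuous_fst.comp (continuous_induced_dom : Continuous (IG.emb (X := X))))

lemma IG.continuous_ev_inv_const (x : X) : Continuous fun g : IG X => g⁻¹.ev x :=
  (continuous_apply x).comp
    (continuous_snd.comp (continuous_induced_dom : Continuous (IG.emb (X := X))))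

lemma IG.continuous_of {T : Type*} [TopologicalSpace T] {f : T → IG X}
    (h1 : ∀ x, Continuous fun t => (f t).ev x) (h2 : ∀ x, Continuous fun t => (f t)⁻¹.ev x) :
    Continuous f := by
  rw [continuous_induced_rng]
  exact (continuous_pi h1).prodMk (continuous_pi h2)

lemma IG.continuous_ev : Continuous fun p : IG X × X => p.1.ev p.2 := by
  rw [continuous_iff_continuousAt]
  rintro ⟨g, x⟩
  rw [ContinuousAt, tendsto_iff_dist_tendsto_zero]
  have h : Continuous fun p : IG X × X => dist p.2 x + dist (p.1.ev x) (g.ev x) :=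
    (continuous_snd.dist continuous_const).add
      (((IG.continuous_ev_const x).comp continuous_fst).dist continuous_const)
  have h2 := h.tendsto (g, x)
  simp only [dist_self, add_zero] at h2
  refine squeeze_zero (fun _ => dist_nonneg) (fun p => ?_) h2
  calc _ ≤ dist (p.1.ev p.2) (p.1.ev x) + dist (p.1.ev x) (g.ev x) := dist_triangle _ _ _
    _ = _ := by rw [IG.dist_ev]

instance : IsTopologicalGroup (IG X) where
  continuous_mul := by
    refine IG.continuous_of (fun x => ?_) (fun x => ?_)
    · exact IG.continuous_ev.comp
        (continuous_fst.prodMk ((IG.continuous_ev_const x).comp continuous_snd))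
    · simp only [mul_inv_rev, IG.ev_mul]
      have h1 : Continuous fun p : IG X × IG X => p.2⁻¹ :=
        (IG.continuous_of IG.continuous_ev_inv_const
          (by simpa using IG.continuous_ev_const)).comp continuous_snd
      exact IG.continuous_ev.comp
        (h1.prodMk ((IG.continuous_ev_inv_const x).comp continuous_fst))
  continuous_inv := IG.continuous_of IG.continuous_ev_inv_const
          (by simpa using IG.continuous_ev_const)

instance : T2Space (IG X) := IG.isClosedEmbedding_emb.isEmbedding.t2Space

variable [ProperSpace X]

lemma IG.isCompact_disp (o : X) (R : ℝ) : IsCompact {g : IG X | dist (g.ev o) o ≤ R} := by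
  have hK : IsCompact ((Set.univ.pi fun x : X => closedBall o (dist x o + R)) ×ˢ
      (Set.univ.pi fun x : X => closedBall o (dist x o + R))) :=
    (isCompact_univ_pi fun x => isCompact_closedBall _ _).prod
      (isCompact_univ_pi fun x => isCompact_closedBall _ _)
  have h2 := IG.isClosedEmbedding_emb.isCompact_preimage hK
  refine h2.of_isClosed_subset
    (isClosed_le ((IG.continuous_ev_const o).dist continuous_const) continuous_const) ?_
  intro g hg
  simp only [mem_ofPred_eq] at hg
  refine ⟨fun x _ => ?_, fun x _ => ?_⟩
  · rw [mem_closedBall]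
    calc dist (g.ev x) o ≤ dist (g.ev x) (g.ev o) + dist (g.ev o) o := dist_triangle _ _ _
      _ ≤ _ := by rw [IG.dist_ev]; linarith
  · rw [mem_closedBall]
    calc dist (g⁻¹.ev x) o ≤ dist (g⁻¹.ev x) (g⁻¹.ev o) + dist (g⁻¹.ev o) o := dist_triangle _ _ _
      _ ≤ _ := by rw [IG.dist_ev, IG.dist_ev_inv, inv_inv, dist_comm o]; linarith

lemma IG.isOpen_disp (o : X) (R : ℝ) : IsOpen {g : IG X | dist (g.ev o) o < R} :=
  isOpen_lt ((IG.continuous_ev_const o).dist continuous_const) continuous_const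

instance [Nonempty X] : SigmaCompactSpace (IG X) := by
  obtain ⟨o⟩ := (inferInstance : Nonempty X)
  refine ⟨⟨fun n => {g : IG X | dist (g.ev o) o ≤ n}, fun n => IG.isCompact_disp o n, ?_⟩⟩
  ext g
  simp only [mem_iUnion, mem_ofPred_eq, mem_univ, iff_true]
  exact exists_nat_ge _

instance [Nonempty X] : LocallyCompactSpace (IG X) := by
  obtain ⟨o⟩ := (inferInstance : Nonempty X)
  have : WeaklyLocallyCompactSpace (IG X) := by
    constructor
    intro g
    refine ⟨_, IG.isCompact_disp o (dist (g.ev o) o + 1), ?_⟩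
    refine Filter.mem_of_superset ((IG.isOpen_disp o (dist (g.ev o) o + 1)).mem_nhds ?_) ?_
    · simp
    · intro h hh; exact le_of_lt (by simpa using hh)
  infer_instance

open Measure in
lemma IG.unimodular [Nonempty X] [PreconnectedSpace X] (hsym : PointSymmetric X) (g : IG X) :
    modularCharacterFun g = 1 := by
  obtain ⟨o⟩ := (inferInstance : Nonempty X)
  have hfix1 : ∀ (k : IG X) (x : X), k.ev x = x → modularCharacterFun k ≤ 1 := by
    intro k x hk
    obtain ⟨M, hM⟩ := modular_bdd (IG.isCompact_disp o (2 * dist x o))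
    refine modular_le_one (M := M) fun n => hM _ ?_
    have hn : (k ^ n).ev x = x := by
      induction n with
      | zero => rfl
      | succ n ih => rw [pow_succ, IG.ev_mul, hk, ih]
    have h1 := dist_triangle ((k ^ n).ev o) ((k ^ n).ev x) o
    rw [IG.dist_ev, hn, dist_comm o x] at h1
    simp only [mem_ofPred_eq]; linarith
  have hfix : ∀ (k : IG X) (x : X), k.ev x = x → modularCharacterFun k = 1 := by
    intro k x hk
    refine modular_eq_one (hfix1 k x hk) (hfix1 k⁻¹ x ?_)
    conv_lhs => rw [← hk]
    exact IG.ev_inv_ev k x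
  let H : Subgroup (X ≃ᵢ X) := MonoidHom.ker (modularCharacter (G := IG X))
  have hH : ∀ m : X, ∃ s ∈ H, s ∈ Refl m := by
    intro m
    obtain ⟨s, hs1, hs2⟩ := hsym m
    exact ⟨s, hfix s m hs1, hs1, hs2⟩
  obtain ⟨M, hM⟩ := modular_bdd (IG.isCompact_disp o 1)
  have hb : ∀ k : IG X, modularCharacterFun k ≤ M := by
    intro k
    obtain ⟨h, hh, hd⟩ := dense_orbit H hH o (k.ev o) one_pos
    obtain ⟨h', hd', hh'⟩ : ∃ h' : IG X, dist (k.ev o) (h'.ev o) < 1 ∧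
      modularCharacterFun h' = 1 := ⟨h, hd, hh⟩
    have e : k = h' * (h'⁻¹ * k) := by rw [mul_inv_cancel_left]
    rw [e, modularCharacterFun_map_mul, hh', one_mul]
    refine hM _ ?_
    simp only [mem_ofPred_eq, IG.ev_mul]
    rw [IG.dist_ev_inv, inv_inv]
    exact hd'.le
  exact modular_eq_one (modular_le_one fun n => hb _) (modular_le_one fun n => hb _)

/-- The reference measure: invariant, locally finite, positive on balls, with mass transport. -/
structure RefMeasure [MeasurableSpace X] (o : X) (ν : Measure X) : Prop where
  inv : ∀ g : X ≃ᵢ X, Measure.map g ν = ν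
  fin : ∀ x r, ν (closedBall x r) < ⊤
  pos : ∀ x r, 0 < r → 0 < ν (closedBall x r)
  transport : ∀ f : X → X → ℝ≥0∞, Measurable (uncurry f) →
    (∀ (g : X ≃ᵢ X) a b, f (g a) (g b) = f a b) → ∫⁻ z, f o z ∂ν = ∫⁻ z, f z o ∂ν

open Measure in
lemma exists_refMeasure [MeasurableSpace X] [BorelSpace X] [PreconnectedSpace X]
    (hsym : PointSymmetric X) (o : X) : ∃ ν : Measure X, RefMeasure o ν := by
  have : Nonempty X := ⟨o⟩
  borelize (IG X)
  let lam : Measure (IG X) := haar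
  have hev : Measurable fun g : IG X => g.ev o := (IG.continuous_ev_const o).measurable
  have hinv : (haar : Measure (IG X)).IsInvInvariant := haar_inv_inv (IG.unimodular hsym)
  have hnu : ∀ g : X ≃ᵢ X, Measure.map g (map (fun g : IG X => g.ev o) lam) =
      map (fun g : IG X => g.ev o) lam := by
    intro g
    rw [map_map g.continuous.measurable hev]
    have e : (g ∘ fun h : IG X => h.ev o) =
        (fun h : IG X => h.ev o) ∘ fun h : IG X => (show IG X from g) * h := rfl
    rw [e, ← map_map hev (measurable_const_mul _), map_mul_left_eq_self]
  refine ⟨map (fun g : IG X => g.ev o) lam, hnu, ?_, ?_, ?_⟩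
  · intro x r
    rw [map_apply hev isClosed_closedBall.measurableSet]
    refine lt_of_le_of_lt (measure_mono ?_) (IG.isCompact_disp o (r + dist x o)).measure_lt_top
    intro g hg
    have hg' : dist (g.ev o) x ≤ r := hg
    have := dist_triangle (g.ev o) x o
    simp only [mem_ofPred_eq]; linarith
  · intro x r hr
    obtain ⟨h, -, hd⟩ := dense_orbit (⊤ : Subgroup (X ≃ᵢ X))
      (fun m => by obtain ⟨s, h1, h2⟩ := hsym m; exact ⟨s, trivial, h1, h2⟩) o x hr
    rw [map_apply hev isClosed_closedBall.measurableSet]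
    have ho : IsOpen {g : IG X | dist (g.ev o) x < r} :=
      isOpen_lt ((IG.continuous_ev_const o).dist continuous_const) continuous_const
    refine lt_of_lt_of_le (ho.measure_pos lam ⟨h, ?_⟩) (measure_mono ?_)
    · change dist (h o) x < r
      rw [dist_comm]; exact hd
    · intro g hg; exact le_of_lt (show dist (g.ev o) x < r from hg)
  · intro f hf hfi
    have m1 : Measurable fun z => f o z := hf.comp measurable_prodMk_left
    have m2 : Measurable fun z => f z o := hf.comp measurable_prodMk_right
    rw [lintegral_map m1 hev, lintegral_map m2 hev]
    rw [← lintegral_inv_eq_self]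
    refine lintegral_congr fun g => ?_
    rw [← hfi (show X ≃ᵢ X from g)]
    change f (g.ev o) (g.ev (g⁻¹.ev o)) = _
    rw [IG.ev_ev_inv]

end Haar

section Kernel

lemma meas_congr {A B : Type*} [MeasurableSpace A] [MeasurableSpace B] {f g : A → B}
    (hf : Measurable f) (h : f = g) : Measurable g := h ▸ hf

variable {X : Type*} [MetricSpace X]

lemma Config.countable [ProperSpace X] (ω : Config X) : ω.1.Countable := by
  rcases isEmpty_or_nonempty X with h | ⟨⟨o⟩⟩
  · have : ω.1 = ∅ := eq_empty_of_isEmpty _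
    rw [this]; exact countable_empty
  have : ω.1 = ⋃ n : ℕ, ω.1 ∩ closedBall o n := by
    rw [← inter_iUnion, iUnion_closedBall_nat, inter_univ]
  rw [this]
  exact countable_iUnion fun n => (ω.2 _ isBounded_closedBall).countable

instance [ProperSpace X] (ω : Config X) : Countable ω.1 := ω.countable.to_subtype

variable [MeasurableSpace X] [BorelSpace X]

lemma measurable_count {B : Set X} (hB : MeasurableSet B) :
    Measurable fun ω : Config X => (ω.1 ∩ B).encard := by
  refine measurable_to_countable' fun n => ?_
  exact MeasurableSpace.measurableSet_generateFrom ⟨B, n, hB, rfl⟩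

lemma measurable_config {A : Type*} [MeasurableSpace A] {c : A → Config X}
    (h : ∀ B, MeasurableSet B → Measurable fun a => ((c a).1 ∩ B).encard) : Measurable c := by
  refine measurable_generateFrom ?_
  rintro _ ⟨B, n, hB, rfl⟩
  exact h B hB (measurableSet_singleton n)

/-- The counting measure of a configuration. -/
def cm (ω : Config X) : Measure X := Measure.sum fun x : ω.1 => Measure.dirac (x : X)

lemma cm_apply (ω : Config X) {B : Set X} (hB : MeasurableSet B) :
    cm ω B = ((ω.1 ∩ B).encard : ℝ≥0∞) := by
  classical
  rw [cm, Measure.sum_apply _ hB]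
  simp only [Measure.dirac_apply' _ hB]
  have h1 : ∑' x : ω.1, B.indicator (1 : X → ℝ≥0∞) (x : X) =
      ∑' x : X, (ω.1 ∩ B).indicator (1 : X → ℝ≥0∞) x := by
    rw [tsum_subtype ω.1 (fun x => B.indicator (1 : X → ℝ≥0∞) x), indicator_indicator]
  rw [h1, ← tsum_subtype (ω.1 ∩ B) (1 : X → ℝ≥0∞)]
  simp only [Pi.one_apply]
  rw [ENNReal.tsum_set_one]

lemma lintegral_cm [ProperSpace X] (ω : Config X) (f : X → ℝ≥0∞) :
    ∫⁻ x, f x ∂(cm ω) = ∑' x : ω.1, f x := by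
  rw [cm, lintegral_sum_measure]
  simp

lemma measurable_cm : Measurable (cm : Config X → Measure X) := by
  refine Measure.measurable_of_measurable_coe _ fun B hB => ?_
  simp only [cm_apply _ hB]
  exact (measurable_from_top (f := fun n : ℕ∞ => (n : ℝ≥0∞))).comp (measurable_count hB)

/-- The counting kernel. -/
def ck : ProbabilityTheory.Kernel (Config X) X := ⟨cm, measurable_cm⟩

open ProbabilityTheory in
instance [ProperSpace X] : IsSFiniteKernel (ck : Kernel (Config X) X) := by
  classical
  rcases isEmpty_or_nonempty X with h | ⟨⟨o⟩⟩
  · have : (ck : Kernel (Config X) X) = 0 := by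
      ext ω B
      have : B = ∅ := eq_empty_of_isEmpty _
      simp [this]
    rw [this]; infer_instance
  let An : ℕ → Set X := disjointed fun n => closedBall o n
  have hAm : ∀ n, MeasurableSet (An n) :=
    fun n => MeasurableSet.disjointed (fun n => isClosed_closedBall.measurableSet) n
  have hAu : ⋃ n, An n = univ := by rw [iUnion_disjointed, iUnion_closedBall_nat]
  have hAb : ∀ n, IsBounded (An n) := fun n => isBounded_closedBall.subset (disjointed_subset _ n)
  have hms : ∀ q : ℕ × ℕ, MeasurableSet {ω : Config X | (ω.1 ∩ An q.1).encard = q.2} :=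
    fun q => measurable_count (hAm q.1) (measurableSet_singleton _)
  let ks : ℕ × ℕ → Kernel (Config X) X := fun q =>
    Kernel.piecewise (hms q) (ck.restrict (hAm q.1)) 0
  have hfin : ∀ q, IsFiniteKernel (ks q) := by
    intro q
    refine ⟨⟨q.2, ENNReal.natCast_lt_top q.2, fun ω => ?_⟩⟩
    simp only [ks, Kernel.piecewise_apply]
    split_ifs with hq
    · rw [Kernel.restrict_apply, Measure.restrict_apply_univ]
      change cm ω _ ≤ _
      rw [cm_apply _ (hAm _)]
      have hq' : (ω.1 ∩ An q.1).encard = q.2 := hq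
      rw [hq']; simp
    · simp
  have : (ck : Kernel (Config X) X) = Kernel.sum ks := by
    ext ω B hB
    rw [Kernel.sum_apply' _ _ hB, ENNReal.tsum_prod (f := fun n k => ks (n, k) ω B)]
    have h1 : ∀ n, ∑' k, ks (n, k) ω B = ck ω (B ∩ An n) := by
      intro n
      obtain ⟨k, hk⟩ : ∃ k : ℕ, (ω.1 ∩ An n).encard = k :=
        ⟨_, ((ω.2 _ (hAb n)).cast_ncard_eq).symm⟩
      rw [tsum_eq_single k]
      · simp only [ks, Kernel.piecewise_apply]
        rw [if_pos (show ω ∈ {ω : Config X | (ω.1 ∩ An n).encard = k} from hk),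
          Kernel.restrict_apply, Measure.restrict_apply hB]
      · intro k' hk'
        simp only [ks, Kernel.piecewise_apply]
        rw [if_neg]
        · simp
        · intro h'
          have h'' : (ω.1 ∩ An n).encard = k' := h'
          rw [hk] at h''
          exact hk' (by exact_mod_cast h''.symm)
    simp only [h1]
    rw [← measure_iUnion, ← inter_iUnion, hAu, inter_univ]
    · intro i j hij
      exact ((disjoint_disjointed _ hij).mono inter_subset_right inter_subset_right)
    · intro i; exact hB.inter (hAm i)
  rw [this]
  have : ∀ q, IsSFiniteKernel (ks q) := fun q => inferInstance
  infer_instance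

variable {A : Type*} [MeasurableSpace A] [ProperSpace X]

open ProbabilityTheory in
lemma meas_tsum {c : A → Config X} (hc : Measurable c) {f : A → X → ℝ≥0∞}
    (hf : Measurable fun p : A × X => f p.1 p.2) :
    Measurable fun a => ∑' x : (c a).1, f a x := by
  have h := Measurable.lintegral_kernel_prod_right (κ := ck.comap c hc) hf
  simp only [Kernel.comap_apply] at h
  refine meas_congr (h) ?_
  funext a
  exact lintegral_cm (c a) (f a)

lemma meas_exists {c : A → Config X} (hc : Measurable c) {p : A → X → Prop}
    (hp : Measurable fun q : A × X => p q.1 q.2) :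
    Measurable fun a => ∃ x ∈ (c a).1, p a x := by
  classical
  have h1 : Measurable fun q : A × X => if p q.1 q.2 then (1 : ℝ≥0∞) else 0 :=
    Measurable.ite (measurableSet_setOfPred.2 hp) measurable_const measurable_const
  have h2 := meas_tsum hc (f := fun a x => if p a x then (1 : ℝ≥0∞) else 0) h1
  have h3 : Measurable fun a => (∑' x : (c a).1, if p a x then (1 : ℝ≥0∞) else 0) ≠ 0 :=
    measurableSet_setOfPred.1 ((measurableSet_singleton (0 : ℝ≥0∞)).compl.preimage h2)
  refine meas_congr (h3) ?_
  funext a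
  simp [ENNReal.tsum_eq_zero]

lemma meas_forall {c : A → Config X} (hc : Measurable c) {p : A → X → Prop}
    (hp : Measurable fun q : A × X => p q.1 q.2) :
    Measurable fun a => ∀ x ∈ (c a).1, p a x := by
  refine meas_congr ((meas_exists hc (p := fun a x => ¬ p a x) hp.not).not) ?_
  funext a
  simp

lemma meas_eq {f g : A → X} (hf : Measurable f) (hg : Measurable g) :
    Measurable fun a => f a = g a :=
  measurableSet_setOfPred.1 (measurableSet_eq_fun hf hg)

lemma meas_mem {c : A → Config X} (hc : Measurable c) {f : A → X} (hf : Measurable f) :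
    Measurable fun a => f a ∈ (c a).1 := by
  refine meas_congr (meas_exists hc (p := fun a x => x = f a)
    (meas_eq measurable_snd (hf.comp measurable_fst))) ?_
  funext a
  simp

lemma measurable_mapIso (g : X ≃ᵢ X) : Measurable (Config.mapIso g) := by
  refine measurable_config fun B hB => ?_
  refine meas_congr ((measurable_count (hB.preimage g.continuous.measurable))) ?_
  funext ω
  change _ = (g '' ω.1 ∩ B).encard
  rw [← image_inter_preimage, g.injective.encard_image]

lemma measurable_insertPt : Measurable fun p : Config X × X => Config.insertPt p.2 p.1 := by
  classical
  refine measurable_config fun B hB => ?_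
  have h1 : Measurable fun p : Config X × X => p.2 ∈ p.1.1 ∨ p.2 ∉ B :=
    (meas_mem measurable_fst measurable_snd).or
      (measurableSet_setOfPred.1 (hB.preimage measurable_snd)).not
  have h2 : Measurable fun p : Config X × X => (p.1.1 ∩ B).encard :=
    (measurable_count hB).comp measurable_fst
  have h3 : Measurable fun p : Config X × X => (p.1.1 ∩ B).encard + 1 :=
    (measurable_from_top (f := fun n : ℕ∞ => n + 1)).comp h2
  have h4 : Measurable fun p : Config X × X => if p.2 ∈ p.1.1 ∨ p.2 ∉ B then (p.1.1 ∩ B).encard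
      else (p.1.1 ∩ B).encard + 1 := Measurable.ite (measurableSet_setOfPred.2 h1) h2 h3
  refine meas_congr h4 ?_
  funext ⟨ω, y⟩
  change _ = (insert y ω.1 ∩ B).encard
  by_cases hB' : y ∈ B
  · rw [insert_inter_of_mem hB']
    by_cases hy : y ∈ ω.1
    · rw [if_pos (Or.inl hy), insert_eq_of_mem (show y ∈ ω.1 ∩ B from ⟨hy, hB'⟩)]
    · rw [if_neg (by simp [hy, hB']), encard_insert_of_notMem (fun h => hy h.1)]
  · rw [if_pos (Or.inr hB'), insert_inter_of_notMem hB']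

lemma mtp {o : X} {ν : Measure X} [SFinite ν] (hν : RefMeasure o ν) {P : Measure (Config X)}
    [IsProbabilityMeasure P] (hP : IsoInvariant P) {F : Config X → X → X → ℝ≥0∞}
    (hF : Measurable fun p : Config X × X × X => F p.1 p.2.1 p.2.2)
    (hFi : ∀ (g : X ≃ᵢ X) ω a b, F (Config.mapIso g ω) (g a) (g b) = F ω a b) :
    ∫⁻ ω, ∫⁻ z, F ω o z ∂ν ∂P = ∫⁻ ω, ∫⁻ z, F ω z o ∂ν ∂P := by
  have m1 : Measurable fun p : Config X × X => F p.1 o p.2 :=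
    hF.comp (measurable_fst.prodMk (measurable_const.prodMk measurable_snd))
  have m2 : Measurable fun p : Config X × X => F p.1 p.2 o :=
    hF.comp (measurable_fst.prodMk (measurable_snd.prodMk measurable_const))
  rw [lintegral_lintegral_swap (f := fun ω z => F ω o z) m1.aemeasurable,
    lintegral_lintegral_swap (f := fun ω z => F ω z o) m2.aemeasurable]
  refine hν.transport (fun a b => ∫⁻ ω, F ω a b ∂P) ?_ ?_
  · have : Measurable fun q : (X × X) × Config X => F q.2 q.1.1 q.1.2 :=
      hF.comp (measurable_snd.prodMk (measurable_fst.fst.prodMk measurable_fst.snd))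
    exact this.lintegral_prod_right'
  · intro g a b
    have m3 : Measurable fun ω => F ω (g a) (g b) :=
      hF.comp (measurable_id.prodMk (measurable_const (a := (g a, g b))))
    calc ∫⁻ ω, F ω (g a) (g b) ∂P = ∫⁻ ω, F ω (g a) (g b) ∂(Measure.map (Config.mapIso g) P) := by
          rw [hP g]
      _ = ∫⁻ ω, F (Config.mapIso g ω) (g a) (g b) ∂P := lintegral_map m3 (measurable_mapIso g)
      _ = _ := by simp only [hFi]

lemma RefMeasure.sigmaFinite {o : X} {ν : Measure X} (hν : RefMeasure o ν) : SigmaFinite ν :=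
  ⟨⟨⟨fun n => closedBall o n, fun _ => trivial, fun n => hν.fin o n, iUnion_closedBall_nat o⟩⟩⟩

end Kernel

section Graph

variable {X : Type*} [MetricSpace X]

/-- The unit balls around the points intersect. -/
def Tch (x y : X) : Prop := (closedBall x 1 ∩ closedBall y 1).Nonempty

lemma Tch.symm {x y : X} (h : Tch x y) : Tch y x := by
  rw [Tch, inter_comm]; exact h

lemma Tch.of_dist {x y : X} (h : dist x y ≤ 1) : Tch x y :=
  ⟨x, mem_closedBall_self zero_le_one, h⟩

lemma Tch.refl (x : X) : Tch x x := Tch.of_dist (by simp)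

lemma Tch.dist_le {x y : X} (h : Tch x y) : dist x y ≤ 2 := by
  obtain ⟨z, hz1, hz2⟩ := h
  rw [mem_closedBall] at hz1 hz2
  have := dist_triangle x z y
  rw [dist_comm x z] at this
  linarith

lemma Tch.iso (g : X ≃ᵢ X) {x y : X} : Tch (g x) (g y) ↔ Tch x y := by
  have h : ∀ (g : X ≃ᵢ X) {x y : X}, Tch x y → Tch (g x) (g y) := by
    rintro g x y ⟨z, h1, h2⟩
    refine ⟨g z, ?_, ?_⟩
    · rw [mem_closedBall, g.isometry.dist_eq]; exact h1
    · rw [mem_closedBall, g.isometry.dist_eq]; exact h2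
  refine ⟨fun hh => ?_, h g⟩
  simpa using h g.symm hh

lemma isClosed_tch [ProperSpace X] : IsClosed {p : X × X | Tch p.1 p.2} := by
  refine IsSeqClosed.isClosed ?_
  intro u p hu hp
  choose z hz1 hz2 using hu
  have h1 : Filter.Tendsto (fun n => (u n).1) Filter.atTop (nhds p.1) :=
    (continuous_fst.tendsto p).comp hp
  have h2 : Filter.Tendsto (fun n => (u n).2) Filter.atTop (nhds p.2) :=
    (continuous_snd.tendsto p).comp hp
  have hb : IsBounded (range z) := by
    obtain ⟨R, hR⟩ := (isBounded_range_of_tendsto _ h1).subset_closedBall p.1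
    refine isBounded_closedBall.subset (?_ : range z ⊆ closedBall p.1 (R + 1))
    rintro _ ⟨n, rfl⟩
    have a1 : dist (u n).1 p.1 ≤ R := hR ⟨n, rfl⟩
    have a2 : dist (z n) (u n).1 ≤ 1 := hz1 n
    rw [mem_closedBall]
    linarith [dist_triangle (z n) (u n).1 p.1]
  obtain ⟨w, -, φ, hφ, hw⟩ := tendsto_subseq_of_bounded hb (fun n => mem_range_self n)
  refine ⟨w, ?_, ?_⟩
  · have := hw.dist (h1.comp hφ.tendsto_atTop)
    exact le_of_tendsto' this fun n => hz1 (φ n)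
  · have := hw.dist (h2.comp hφ.tendsto_atTop)
    exact le_of_tendsto' this fun n => hz2 (φ n)

/-- Adjacency (with loops) inside a vertex set. -/
def Rel (S : Set X) (a b : X) : Prop := a ∈ S ∧ b ∈ S ∧ Tch a b

/-- Connectedness inside a vertex set. -/
def Conn (S : Set X) (a b : X) : Prop := a ∈ S ∧ Relation.ReflTransGen (Rel S) a b

variable {S T : Set X} {a b c : X}

lemma Rel.symm (h : Rel S a b) : Rel S b a := ⟨h.2.1, h.1, h.2.2.symm⟩

lemma Conn.refl (h : a ∈ S) : Conn S a a := ⟨h, .refl⟩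

lemma Conn.left (h : Conn S a b) : a ∈ S := h.1

lemma Conn.trans (h : Conn S a b) (h' : Conn S b c) : Conn S a c := ⟨h.1, h.2.trans h'.2⟩

lemma Rel.conn (h : Rel S a b) : Conn S a b := ⟨h.1, .single h⟩

lemma Conn.right (h : Conn S a b) : b ∈ S := by
  obtain ⟨ha, h⟩ := h
  induction h with
  | refl => exact ha
  | tail _ h _ => exact h.2.1

lemma Conn.symm (h : Conn S a b) : Conn S b a := by
  have hb := h.right
  obtain ⟨ha, h⟩ := h
  refine ⟨hb, ?_⟩
  clear hb
  induction h with
  | refl => exact .refl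
  | tail _ h ih => exact Relation.ReflTransGen.head h.symm ih

lemma Conn.mono (hST : S ⊆ T) (h : Conn S a b) : Conn T a b :=
  ⟨hST h.1, Relation.ReflTransGen.mono (fun _ _ h => ⟨hST h.1, hST h.2.1, h.2.2⟩) _ _ h.2⟩

lemma Conn.tail (h : Conn S a b) (h' : Rel S b c) : Conn S a c := h.trans h'.conn

lemma Conn.exit (p : X → Prop) (h : Conn S a b) (ha : p a) :
    Conn {y | y ∈ S ∧ p y} a b ∨ ∃ c d, Conn {y | y ∈ S ∧ p y} a c ∧ Rel S c d ∧ ¬ p d := by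
  obtain ⟨haS, h⟩ := h
  induction h with
  | refl => exact Or.inl (Conn.refl ⟨haS, ha⟩)
  | @tail b c _ hbc ih =>
    rcases ih with ih | ih
    · by_cases hc : p c
      · exact Or.inl (ih.tail ⟨ih.right, ⟨hbc.2.1, hc⟩, hbc.2.2⟩)
      · exact Or.inr ⟨b, c, ih, hbc, hc⟩
    · exact Or.inr ih

lemma Conn.stay (h : Conn S a b) (hT : ∀ y, Conn S a y → y ∈ T) : Conn T a b := by
  rcases h.exit (fun y => y ∈ T) (hT a (Conn.refl h.1)) with h | ⟨c, d, h1, h2, h3⟩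
  · exact h.mono fun y hy => hy.2
  · exact absurd (hT d ((h1.mono fun y hy => hy.1).tail h2)) h3

lemma graphComp_eq (ω : Config X) {x : X} (hx : x ∈ ω.1) :
    graphComp (boolAdj ω) x = {y | Conn ω.1 x y} := by
  ext y
  constructor
  · intro h
    refine ⟨hx, Relation.ReflTransGen.mono ?_ _ _ h⟩
    intro a b h
    exact ⟨h.1, h.2.1, h.2.2.2⟩
  · rintro ⟨-, h⟩
    change Relation.ReflTransGen _ _ _
    induction h with
    | refl => exact .refl
    | @tail b c _ hbc ih =>
      by_cases hb : b = c
      · rw [← hb]; exact ih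
      · exact ih.tail ⟨hbc.1, hbc.2.1, hb, hbc.2.2⟩

/-- Walks of length at most `n` (loops are allowed). -/
def W (S : Set X) : ℕ → X → X → Prop
  | 0, a, b => a = b ∧ a ∈ S
  | n + 1, a, b => ∃ c, W S n a c ∧ Rel S c b

lemma W.right {n : ℕ} (h : W S n a b) : b ∈ S := by
  cases n with
  | zero => exact h.1 ▸ h.2
  | succ n => obtain ⟨c, -, h⟩ := h; exact h.2.1

lemma W.conn {n : ℕ} (h : W S n a b) : Conn S a b := by
  induction n generalizing b with
  | zero => obtain ⟨rfl, h⟩ := h; exact Conn.refl h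
  | succ n ih => obtain ⟨c, h1, h2⟩ := h; exact (ih h1).tail h2

lemma W.succ {n : ℕ} (h : W S n a b) : W S (n+1) a b := ⟨b, h, h.right, h.right, Tch.refl b⟩

lemma W.le {n m : ℕ} (h : W S n a b) (hnm : n ≤ m) : W S m a b := by
  induction hnm with
  | refl => exact h
  | step _ ih => exact ih.succ

lemma W.trans {n m : ℕ} (h : W S n a b) (h' : W S m b c) : W S (n+m) a c := by
  induction m generalizing c with
  | zero => obtain ⟨rfl, -⟩ := h'; exact h
  | succ m ih => obtain ⟨d, h1, h2⟩ := h'; exact ⟨d, ih h1, h2⟩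

lemma Rel.w (h : Rel S a b) : W S 1 a b := ⟨a, ⟨rfl, h.1⟩, h⟩

lemma W.symm {n : ℕ} (h : W S n a b) : W S n b a := by
  induction n generalizing b with
  | zero => exact ⟨h.1.symm, h.1 ▸ h.2⟩
  | succ n ih =>
    obtain ⟨c, h1, h2⟩ := h
    have := h2.symm.w.trans (ih h1)
    rwa [Nat.add_comm] at this

lemma Conn.exists_w (h : Conn S a b) : ∃ n, W S n a b := by
  obtain ⟨ha, h⟩ := h
  induction h with
  | refl => exact ⟨0, rfl, ha⟩
  | tail _ h ih => obtain ⟨n, hn⟩ := ih; exact ⟨n+1, _, hn, h⟩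

lemma conn_iff_w : Conn S a b ↔ ∃ n, W S n a b := ⟨Conn.exists_w, fun ⟨_, h⟩ => h.conn⟩

lemma W.dist_le {n : ℕ} (h : W S n a b) : dist a b ≤ 2 * n := by
  induction n generalizing b with
  | zero => simp [h.1]
  | succ n ih =>
    obtain ⟨c, h1, h2⟩ := h
    have := ih h1
    have := h2.2.2.dist_le
    push_cast
    linarith [dist_triangle a c b]

lemma W.mono (hST : S ⊆ T) {n : ℕ} (h : W S n a b) : W T n a b := by
  induction n generalizing b with
  | zero => exact ⟨h.1, hST h.2⟩
  | succ n ih =>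
    obtain ⟨c, h1, h2⟩ := h
    exact ⟨c, ih h1, hST h2.1, hST h2.2.1, h2.2.2⟩

/-- The component is infinite. -/
def Inf (S : Set X) (x : X) : Prop := {y | Conn S x y}.Infinite

lemma Inf.mem (h : Inf S a) : a ∈ S := by
  obtain ⟨y, hy⟩ := h.nonempty
  exact Conn.left hy

lemma Inf.conn (h : Inf S a) (hab : Conn S a b) : Inf S b :=
  h.mono fun _ hy => hab.symm.trans hy

lemma Inf.mono (h : Inf S a) (hST : S ⊆ T) : Inf T a :=
  Set.Infinite.mono (fun _ hy => Conn.mono hST hy) h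

lemma Inf.stay (h : Inf S a) (hT : ∀ y, Conn S a y → y ∈ T) : Inf T a :=
  Set.Infinite.mono (fun _ hy => Conn.stay hy hT) h

lemma Config.finite (ω : Config X) (hS : S ⊆ ω.1) (hb : IsBounded S) : S.Finite :=
  (ω.2 S hb).subset fun _ h => ⟨hS h, h⟩

lemma Inf.far {ω : Config X} (hS : S ⊆ ω.1) (h : Inf S a) (o : X) (m : ℝ) :
    ∃ y, Conn S a y ∧ m < dist o y := by
  by_contra hcon
  push Not at hcon
  refine h (ω.finite (fun y hy => hS (Conn.right hy)) ?_)
  refine isBounded_closedBall.subset (?_ : _ ⊆ closedBall o m)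
  intro y hy
  rw [mem_closedBall, dist_comm]
  exact hcon y hy

lemma inf_iff {ω : Config X} (hS : S ⊆ ω.1) (o : X) :
    Inf S a ↔ ∀ m : ℕ, ∃ y ∈ ω.1, Conn S a y ∧ (m : ℝ) < dist o y := by
  constructor
  · intro h m
    obtain ⟨y, h1, h2⟩ := h.far hS o m
    exact ⟨y, hS h1.right, h1, h2⟩
  · intro h hfin
    obtain ⟨R, hR⟩ := hfin.isBounded.subset_closedBall o
    obtain ⟨m, hm⟩ := exists_nat_ge R
    obtain ⟨y, -, h1, h2⟩ := h m
    have h3 : y ∈ closedBall o R := hR h1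
    rw [mem_closedBall, dist_comm] at h3
    linarith

/-- Local component. -/
def Loc (ω : Config X) (r : ℝ) (x : X) : Set X := {y | Conn (ω.1 ∩ closedBall x r) x y}

lemma Loc.subset (ω : Config X) (r : ℝ) (x : X) : Loc ω r x ⊆ ω.1 ∩ closedBall x r :=
  fun _ h => Conn.right h

lemma Loc.finite (ω : Config X) (r : ℝ) (x : X) : (Loc ω r x).Finite :=
  (ω.2 _ isBounded_closedBall).subset (Loc.subset ω r x)

/-- The body of the definition of trifurcation points. -/
def TrifB (ω : Config X) (r : ℝ) (x b₁ b₂ b₃ : X) : Prop :=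
    (Conn ω.1 x b₁ ∧ Conn ω.1 x b₂ ∧ Conn ω.1 x b₃) ∧
    (Inf (ω.1 \ Loc ω r x) b₁ ∧ Inf (ω.1 \ Loc ω r x) b₂ ∧ Inf (ω.1 \ Loc ω r x) b₃) ∧
    (¬ Conn (ω.1 \ Loc ω r x) b₁ b₂ ∧ ¬ Conn (ω.1 \ Loc ω r x) b₁ b₃ ∧
      ¬ Conn (ω.1 \ Loc ω r x) b₂ b₃)

/-- Trifurcation points. -/
def Trif (ω : Config X) (r : ℝ) (x : X) : Prop :=
  x ∈ ω.1 ∧ ∃ b₁ ∈ ω.1, ∃ b₂ ∈ ω.1, ∃ b₃ ∈ ω.1, TrifB ω r x b₁ b₂ b₃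

section Equivariance

lemma image_symm_image (g : X ≃ᵢ X) (S : Set X) : g.symm '' (g '' S) = S := by
  rw [image_image]; simp

lemma Rel.image (g : X ≃ᵢ X) (h : Rel S a b) : Rel (g '' S) (g a) (g b) :=
  ⟨mem_image_of_mem _ h.1, mem_image_of_mem _ h.2.1, (Tch.iso g).2 h.2.2⟩

lemma Conn.image (g : X ≃ᵢ X) (h : Conn S a b) : Conn (g '' S) (g a) (g b) := by
  refine ⟨mem_image_of_mem _ h.1, ?_⟩
  exact Relation.ReflTransGen.lift g (fun _ _ h => h.image g) _ _ h.2

lemma conn_image (g : X ≃ᵢ X) : Conn (g '' S) (g a) (g b) ↔ Conn S a b := by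
  refine ⟨fun h => ?_, Conn.image g⟩
  have := h.image g.symm
  rwa [image_symm_image, g.symm_apply_apply, g.symm_apply_apply] at this

lemma W.image (g : X ≃ᵢ X) {n : ℕ} (h : W S n a b) : W (g '' S) n (g a) (g b) := by
  induction n generalizing b with
  | zero => exact ⟨by rw [h.1], mem_image_of_mem _ h.2⟩
  | succ n ih => obtain ⟨c, h1, h2⟩ := h; exact ⟨g c, ih h1, h2.image g⟩

lemma w_image (g : X ≃ᵢ X) {n : ℕ} : W (g '' S) n (g a) (g b) ↔ W S n a b := by
  refine ⟨fun h => ?_, W.image g⟩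
  have := h.image g.symm
  rwa [image_symm_image, g.symm_apply_apply, g.symm_apply_apply] at this

lemma Inf.image (g : X ≃ᵢ X) (h : Inf S a) : Inf (g '' S) (g a) := by
  have := Set.Infinite.image (g.injective.injOn) h
  refine this.mono ?_
  rintro _ ⟨y, hy, rfl⟩
  exact Conn.image g hy

lemma mem_mapIso (g : X ≃ᵢ X) (ω : Config X) (x : X) : g x ∈ (Config.mapIso g ω).1 ↔ x ∈ ω.1 :=
  g.injective.mem_set_image

lemma exists_mapIso (g : X ≃ᵢ X) (ω : Config X) {p : X → Prop} :
    (∃ x ∈ (Config.mapIso g ω).1, p x) ↔ ∃ x ∈ ω.1, p (g x) := by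
  change (∃ x ∈ g '' ω.1, p x) ↔ _
  simp

lemma closedBall_image (g : X ≃ᵢ X) (x : X) (r : ℝ) : closedBall (g x) r = g '' closedBall x r :=
  (g.image_closedBall x r).symm

lemma loc_mapIso (g : X ≃ᵢ X) (ω : Config X) (r : ℝ) (x : X) :
    Loc (Config.mapIso g ω) r (g x) = g '' Loc ω r x := by
  have h : (Config.mapIso g ω).1 ∩ closedBall (g x) r = g '' (ω.1 ∩ closedBall x r) := by
    rw [closedBall_image, image_inter g.injective]; rfl
  ext y
  obtain ⟨z, rfl⟩ := g.surjective y
  rw [g.injective.mem_set_image]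
  change Conn _ _ _ ↔ Conn _ _ _
  rw [h, conn_image]

lemma Trif.image (g : X ≃ᵢ X) {ω : Config X} {r : ℝ} {x : X} (h : Trif ω r x) :
    Trif (Config.mapIso g ω) r (g x) := by
  obtain ⟨hx, b1, h1, b2, h2, b3, h3, ⟨c1, c2, c3⟩, ⟨i1, i2, i3⟩, n1, n2, n3⟩ := h
  have e : (Config.mapIso g ω).1 \ Loc (Config.mapIso g ω) r (g x) =
      g '' (ω.1 \ Loc ω r x) := by
    rw [loc_mapIso, image_sdiff g.injective]; rfl
  refine ⟨(mem_mapIso g ω x).2 hx, g b1, (mem_mapIso g ω _).2 h1, g b2, (mem_mapIso g ω _).2 h2,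
    g b3, (mem_mapIso g ω _).2 h3, ⟨c1.image g, c2.image g, c3.image g⟩, ?_, ?_⟩
  · rw [e]; exact ⟨i1.image g, i2.image g, i3.image g⟩
  · rw [e]; simp only [conn_image]; exact ⟨n1, n2, n3⟩

lemma mapIso_symm (g : X ≃ᵢ X) (ω : Config X) :
    Config.mapIso g.symm (Config.mapIso g ω) = ω :=
  Subtype.ext (image_symm_image g ω.1)

lemma trif_mapIso (g : X ≃ᵢ X) {ω : Config X} {r : ℝ} {x : X} :
    Trif (Config.mapIso g ω) r (g x) ↔ Trif ω r x := by
  refine ⟨fun h => ?_, Trif.image g⟩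
  have := h.image g.symm
  rwa [mapIso_symm, g.symm_apply_apply] at this

end Equivariance

section Meas

variable {A : Type*} [MeasurableSpace A] [ProperSpace X] [MeasurableSpace X] [BorelSpace X]

lemma meas_tch {f g : A → X} (hf : Measurable f) (hg : Measurable g) :
    Measurable fun a => Tch (f a) (g a) :=
  measurableSet_setOfPred.1 (isClosed_tch.measurableSet.preimage (hf.prodMk hg))

lemma meas_w {c : A → Config X} (hc : Measurable c) {S : A → Set X} (hS : ∀ a, S a ⊆ (c a).1)
    (hSm : Measurable fun p : A × X => p.2 ∈ S p.1) (n : ℕ) :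
    Measurable fun p : A × X × X => W (S p.1) n p.2.1 p.2.2 := by
  induction n with
  | zero =>
    exact (meas_eq measurable_snd.fst measurable_snd.snd).and
      (hSm.comp (measurable_fst.prodMk measurable_snd.fst))
  | succ n ih =>
    have h := meas_exists (A := A × X × X) (c := fun p => c p.1) (hc.comp measurable_fst)
      (p := fun p y => W (S p.1) n p.2.1 y ∧ Rel (S p.1) y p.2.2) ?_
    · refine meas_congr h ?_
      funext p
      refine propext ⟨fun ⟨y, _, h⟩ => ⟨y, h⟩, fun ⟨y, h⟩ => ⟨y, hS _ h.2.1, h⟩⟩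
    · refine (ih.comp (measurable_fst.fst.prodMk
        (measurable_fst.snd.fst.prodMk measurable_snd))).and ?_
      refine (hSm.comp (measurable_fst.fst.prodMk measurable_snd)).and ?_
      refine (hSm.comp (measurable_fst.fst.prodMk measurable_fst.snd.snd)).and ?_
      exact meas_tch measurable_snd measurable_fst.snd.snd

lemma meas_w' {c : A → Config X} (hc : Measurable c) {S : A → Set X} (hS : ∀ a, S a ⊆ (c a).1)
    (hSm : Measurable fun p : A × X => p.2 ∈ S p.1) (n : ℕ) {f g : A → X} (hf : Measurable f)
    (hg : Measurable g) : Measurable fun a => W (S a) n (f a) (g a) :=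
  (meas_w hc hS hSm n).comp (measurable_id.prodMk (hf.prodMk hg))

lemma meas_conn {c : A → Config X} (hc : Measurable c) {S : A → Set X} (hS : ∀ a, S a ⊆ (c a).1)
    (hSm : Measurable fun p : A × X => p.2 ∈ S p.1) {f g : A → X} (hf : Measurable f)
    (hg : Measurable g) : Measurable fun a => Conn (S a) (f a) (g a) := by
  simp only [conn_iff_w]
  exact Measurable.exists fun n => meas_w' hc hS hSm n hf hg

lemma meas_inf {c : A → Config X} (hc : Measurable c) {S : A → Set X} (hS : ∀ a, S a ⊆ (c a).1)
    (hSm : Measurable fun p : A × X => p.2 ∈ S p.1) {f : A → X} (hf : Measurable f) :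
    Measurable fun a => Inf (S a) (f a) := by
  have e : (fun a => Inf (S a) (f a)) = fun a => ∀ m : ℕ, ∃ y ∈ (c a).1,
      Conn (S a) (f a) y ∧ (m : ℝ) < dist (f a) y := by
    funext a; exact propext (inf_iff (hS a) (f a))
  rw [e]
  refine Measurable.forall fun m => meas_exists hc
    (p := fun a y => Conn (S a) (f a) y ∧ (m : ℝ) < dist (f a) y) ?_
  refine (meas_conn (c := fun p : A × X => c p.1) (S := fun p => S p.1) (hc.comp measurable_fst)
    (fun p => hS p.1) (hSm.comp (measurable_fst.fst.prodMk measurable_snd))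
    (hf.comp measurable_fst) measurable_snd).and ?_
  exact measurableSet_setOfPred.1 (measurableSet_lt measurable_const
    ((hf.comp measurable_fst).dist measurable_snd))

lemma meas_mem_loc {c : A → Config X} (hc : Measurable c) (r : ℝ) {f g : A → X}
    (hf : Measurable f) (hg : Measurable g) : Measurable fun a => g a ∈ Loc (c a) r (f a) := by
  refine meas_conn hc (S := fun a => (c a).1 ∩ closedBall (f a) r) (fun a => inter_subset_left)
    ?_ hf hg
  refine (meas_mem (hc.comp measurable_fst) measurable_snd).and ?_
  exact measurableSet_setOfPred.1 (measurableSet_le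
    (measurable_snd.dist (hf.comp measurable_fst)) measurable_const)

lemma meas_sdiff_loc {c : A → Config X} (hc : Measurable c) (r : ℝ) {f : A → X}
    (hf : Measurable f) :
    Measurable fun p : A × X => p.2 ∈ (c p.1).1 \ Loc (c p.1) r (f p.1) :=
  (meas_mem (hc.comp measurable_fst) measurable_snd).and
      (meas_mem_loc (hc.comp measurable_fst) r (hf.comp measurable_fst) measurable_snd).not

lemma meas_trifB {c : A → Config X} (hc : Measurable c) (r : ℝ) {f f₁ f₂ f₃ : A → X}
    (hf : Measurable f) (m1 : Measurable f₁) (m2 : Measurable f₂) (m3 : Measurable f₃) :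
    Measurable fun a => TrifB (c a) r (f a) (f₁ a) (f₂ a) (f₃ a) := by
  have cm : Measurable fun p : A × X => p.2 ∈ (c p.1).1 :=
    meas_mem (hc.comp measurable_fst) measurable_snd
  have cs : ∀ a, (c a).1 ⊆ (c a).1 := fun a => subset_rfl
  have cw : ∀ a, (c a).1 \ Loc (c a) r (f a) ⊆ (c a).1 := fun a => sdiff_subset
  have ck := meas_sdiff_loc hc r hf
  have h1 := (meas_conn hc cs cm hf m1).and ((meas_conn hc cs cm hf m2).and
    (meas_conn hc cs cm hf m3))
  have h2 := (meas_inf hc cw ck m1).and ((meas_inf hc cw ck m2).and (meas_inf hc cw ck m3))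
  have h3 := (meas_conn hc cw ck m1 m2).not.and
    ((meas_conn hc cw ck m1 m3).not.and (meas_conn hc cw ck m2 m3).not)
  exact h1.and (h2.and h3)

lemma meas_trif {c : A → Config X} (hc : Measurable c) (r : ℝ) {f : A → X} (hf : Measurable f) :
    Measurable fun a => Trif (c a) r (f a) := by
  refine (meas_mem hc hf).and ?_
  refine meas_exists hc (p := fun a b₁ => ∃ b₂ ∈ (c a).1, ∃ b₃ ∈ (c a).1,
    TrifB (c a) r (f a) b₁ b₂ b₃) ?_
  refine meas_exists (hc.comp measurable_fst) (p := fun a b₂ => ∃ b₃ ∈ (c a.1).1,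
    TrifB (c a.1) r (f a.1) a.2 b₂ b₃) ?_
  refine meas_exists (hc.comp measurable_fst.fst) (p := fun a b₃ =>
    TrifB (c a.1.1) r (f a.1.1) a.1.2 a.2 b₃) ?_
  exact meas_trifB (c := fun p : ((A × X) × X) × X => c p.1.1.1) (hc.comp measurable_fst.fst.fst) r
    (f := fun p => f p.1.1.1) (hf.comp measurable_fst.fst.fst) measurable_fst.fst.snd
    measurable_fst.snd measurable_snd

end Meas

end Graph

section ClaimA

variable {X : Type*} [MetricSpace X] [ProperSpace X] [PreconnectedSpace X]
  [MeasurableSpace X] [BorelSpace X]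

lemma orbit_dense (hsym : PointSymmetric X) (o y : X) {ε : ℝ} (hε : 0 < ε) :
    ∃ g : X ≃ᵢ X, dist y (g o) < ε := by
  obtain ⟨h, -, hd⟩ := dense_orbit (⊤ : Subgroup (X ≃ᵢ X))
    (fun m => by obtain ⟨s, h1, h2⟩ := hsym m; exact ⟨s, trivial, h1, h2⟩) o y hε
  exact ⟨h, hd⟩

lemma RefMeasure.ball_iso {o : X} {ν : Measure X} (hν : RefMeasure o ν) (g : X ≃ᵢ X) (x : X)
    (r : ℝ) : ν (closedBall (g x) r) = ν (closedBall x r) := by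
  conv_lhs => rw [← hν.inv g]
  rw [Measure.map_apply g.continuous.measurable isClosed_closedBall.measurableSet]
  congr 1
  ext z
  simp

lemma RefMeasure.lower (hsym : PointSymmetric X) {o : X} {ν : Measure X} (hν : RefMeasure o ν)
    (x : X) : ν (closedBall o (1/4)) ≤ ν (closedBall x (1/2)) := by
  obtain ⟨g, hg⟩ := orbit_dense hsym o x (ε := 1/4) (by norm_num)
  rw [← hν.ball_iso g]
  refine measure_mono (closedBall_subset_closedBall' ?_)
  rw [dist_comm]; linarith

lemma RefMeasure.upper (hsym : PointSymmetric X) {o : X} {ν : Measure X} (hν : RefMeasure o ν)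
    (x : X) (R : ℝ) : ν (closedBall x R) ≤ ν (closedBall o (R + 1)) := by
  obtain ⟨g, hg⟩ := orbit_dense hsym o x (ε := 1) (by norm_num)
  rw [← hν.ball_iso g o]
  refine measure_mono (closedBall_subset_closedBall' ?_)
  linarith

lemma ae_transfer (hsym : PointSymmetric X) (o : X) {P : Measure (Config X)}
    (hP : IsoInvariant P) {E : Config X → X → Prop}
    (hE : ∀ (g : X ≃ᵢ X) ω a, E (Config.mapIso g ω) a → E ω (g.symm a))
    (h : ∀ᵐ ω ∂P, E ω o) :
    ∀ᵐ ω ∂P, ∀ y : X, ∀ ε > 0, ∃ t, dist t y < ε ∧ E ω t := by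
  have : Nonempty X := ⟨o⟩
  choose g hg using fun (q : ℕ) (n : ℕ) => orbit_dense hsym o (TopologicalSpace.denseSeq X q)
    (ε := 1 / (n + 1 : ℝ)) (by positivity)
  have h1 : ∀ᵐ ω ∂P, ∀ q n, E ω (g q n o) := by
    rw [ae_all_iff]; intro q
    rw [ae_all_iff]; intro n
    have hq : Measure.QuasiMeasurePreserving (Config.mapIso (g q n).symm) P P :=
      ⟨measurable_mapIso _, by rw [hP]⟩
    filter_upwards [hq.ae h] with ω hω
    simpa using hE _ _ _ hω
  filter_upwards [h1] with ω hω y ε hε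
  obtain ⟨n, hn⟩ := exists_nat_one_div_lt (half_pos hε)
  obtain ⟨q, hq⟩ := (TopologicalSpace.denseRange_denseSeq X).exists_dist_lt y (half_pos hε)
  refine ⟨_, ?_, hω q n⟩
  have := hg q n
  rw [dist_comm] at this hq
  linarith [dist_triangle (g q n o) (TopologicalSpace.denseSeq X q) y]

lemma vol_infinite {ν : Measure X} {v : ℝ≥0∞} (hv0 : 0 < v) (hv : ∀ x, v ≤ ν (closedBall x (1/2)))
    {Z : Set X} {p : X → Prop} (o : X) (hp : ∀ m : ℝ, ∃ y, p y ∧ m < dist o y)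
    (hZ : ∀ y, p y → closedBall y (1/2) ⊆ Z) : ν Z = ⊤ := by
  obtain ⟨f, hf, hf'⟩ := exists_seq_of_forall_finset_exists p (fun x y => 1 < dist x y) (by
    intro s hs
    obtain ⟨R, hR⟩ := s.finite_toSet.isBounded.subset_closedBall o
    obtain ⟨y, hy, hy'⟩ := hp (R + 1)
    refine ⟨y, hy, fun x hx => ?_⟩
    have : dist x o ≤ R := hR hx
    linarith [dist_triangle_left o y x])
  rw [eq_top_iff]
  calc (⊤ : ℝ≥0∞) = ∑' _ : ℕ, v := (ENNReal.tsum_const_eq_top_of_ne_zero hv0.ne').symm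
    _ ≤ ∑' n, ν (closedBall (f n) (1/2)) := ENNReal.tsum_le_tsum fun n => hv _
    _ = ν (⋃ n, closedBall (f n) (1/2)) := by
      refine (measure_iUnion ?_ fun n => isClosed_closedBall.measurableSet).symm
      have key : ∀ m n, m < n → Disjoint (closedBall (f m) (1/2)) (closedBall (f n) (1/2)) := by
        intro m n hmn
        refine closedBall_disjoint_closedBall ?_
        linarith [hf' m n hmn]
      intro m n hmn
      rcases lt_or_gt_of_ne hmn with h | h
      · exact key m n h
      · exact (key n m h).symm
    _ ≤ ν Z := measure_mono (iUnion_subset fun n => hZ _ (hf n))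

lemma W.split {S L : Set X} {n : ℕ} {a b : X} (h : W S n a b) :
    W (S \ L) n a b ∨ ∃ l ∈ L, ∃ k m, k + m = n ∧ W S k a l ∧ W S m l b := by
  induction n generalizing b with
  | zero =>
    obtain ⟨rfl, h⟩ := h
    by_cases ha : a ∈ L
    · exact Or.inr ⟨a, ha, 0, 0, rfl, ⟨rfl, h⟩, ⟨rfl, h⟩⟩
    · exact Or.inl ⟨rfl, h, ha⟩
  | succ n ih =>
    obtain ⟨c, h1, h2⟩ := h
    rcases ih h1 with h3 | ⟨l, hl, k, m, hkm, h4, h5⟩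
    · by_cases hb : b ∈ L
      · exact Or.inr ⟨b, hb, n + 1, 0, rfl, ⟨c, h1, h2⟩, ⟨rfl, h2.2.1⟩⟩
      · exact Or.inl ⟨c, h3, h3.right, ⟨h2.2.1, hb⟩, h2.2.2⟩
    · exact Or.inr ⟨l, hl, k, m + 1, by omega, h4, ⟨c, h5, h2⟩⟩

/-- Some point near `z` is joined to a trifurcation by a walk of length `n`. -/
def RT (ω : Config X) (r : ℝ) (n : ℕ) (z : X) : Prop :=
  ∃ x ∈ ω.1, ∃ y ∈ ω.1, dist x z ≤ 1/2 ∧ Trif ω r y ∧ W ω.1 n x y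

/-- Some point near `z` is joined to a trifurcation near `t` by a walk of length `n`. -/
def RTT (ω : Config X) (r : ℝ) (n : ℕ) (z t : X) : Prop :=
  ∃ x ∈ ω.1, ∃ y ∈ ω.1, (dist x z ≤ 1/2 ∧ dist y t ≤ 1/2) ∧ Trif ω r y ∧ W ω.1 n x y

/-- `t` is near a trifurcation which is nearest to `z`. -/
def Near (ω : Config X) (r : ℝ) (z t : X) : Prop :=
  ∃ n, RTT ω r n z t ∧ ∀ m < n, ¬ RT ω r m z

lemma rt_mapIso (g : X ≃ᵢ X) (ω : Config X) (r : ℝ) (n : ℕ) (z : X) :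
    RT (Config.mapIso g ω) r n (g z) ↔ RT ω r n z := by
  unfold RT
  simp only [exists_mapIso, g.isometry.dist_eq, trif_mapIso]
  simp only [Config.mapIso, w_image]

lemma rtt_mapIso (g : X ≃ᵢ X) (ω : Config X) (r : ℝ) (n : ℕ) (z t : X) :
    RTT (Config.mapIso g ω) r n (g z) (g t) ↔ RTT ω r n z t := by
  unfold RTT
  simp only [exists_mapIso, g.isometry.dist_eq, trif_mapIso]
  simp only [Config.mapIso, w_image]

lemma near_mapIso (g : X ≃ᵢ X) (ω : Config X) (r : ℝ) (z t : X) :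
    Near (Config.mapIso g ω) r (g z) (g t) ↔ Near ω r z t := by
  simp only [Near, rt_mapIso, rtt_mapIso]

lemma meas_le_half {A : Type*} [MeasurableSpace A] {f g : A → X} (hf : Measurable f)
    (hg : Measurable g) (s : ℝ) : Measurable fun a => dist (f a) (g a) ≤ s :=
  measurableSet_setOfPred.1 (measurableSet_le (hf.dist hg) measurable_const)

lemma meas_near (r : ℝ) : Measurable fun p : Config X × X × X => Near p.1 r p.2.1 p.2.2 := by
  have cs : ∀ p : (((Config X × X × X) × X) × X), p.1.1.1.1 ⊆ p.1.1.1.1 := fun _ => subset_rfl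
  have hc : Measurable fun p : (((Config X × X × X) × X) × X) => p.1.1.1 := measurable_fst.fst.fst
  have cm : Measurable fun p : (((Config X × X × X) × X) × X) × X => p.2 ∈ p.1.1.1.1.1 :=
    meas_mem (hc.comp measurable_fst) measurable_snd
  have hw : ∀ n, Measurable fun p : (((Config X × X × X) × X) × X) => W p.1.1.1.1 n p.1.2 p.2 :=
    fun n => meas_w' hc cs cm n measurable_fst.snd measurable_snd
  have ht : Measurable fun p : (((Config X × X × X) × X) × X) => Trif p.1.1.1 r p.2 :=
    meas_trif hc r measurable_snd
  have h1 : ∀ n, Measurable fun p : Config X × X × X => RTT p.1 r n p.2.1 p.2.2 := by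
    intro n
    refine meas_exists (A := Config X × X × X) measurable_fst (p := fun a x => ∃ y ∈ a.1.1, (dist x a.2.1 ≤ 1/2 ∧
      dist y a.2.2 ≤ 1/2) ∧ Trif a.1 r y ∧ W a.1.1 n x y) ?_
    refine meas_exists (A := (Config X × X × X) × X) measurable_fst.fst (p := fun a y => (dist a.2 a.1.2.1 ≤ 1/2 ∧
      dist y a.1.2.2 ≤ 1/2) ∧ Trif a.1.1 r y ∧ W a.1.1.1 n a.2 y) ?_
    exact ((meas_le_half measurable_fst.snd measurable_fst.fst.snd.fst _).and
      (meas_le_half measurable_snd measurable_fst.fst.snd.snd _)).and (ht.and (hw n))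
  have h2 : ∀ n, Measurable fun p : Config X × X × X => RT p.1 r n p.2.1 := by
    intro n
    refine meas_exists (A := Config X × X × X) measurable_fst (p := fun a x => ∃ y ∈ a.1.1, dist x a.2.1 ≤ 1/2 ∧
      Trif a.1 r y ∧ W a.1.1 n x y) ?_
    refine meas_exists (A := (Config X × X × X) × X) measurable_fst.fst (p := fun a y => dist a.2 a.1.2.1 ≤ 1/2 ∧
      Trif a.1.1 r y ∧ W a.1.1.1 n a.2 y) ?_
    exact (meas_le_half measurable_fst.snd measurable_fst.fst.snd.fst _).and (ht.and (hw n))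
  exact Measurable.exists fun n => (h1 n).and
    (Measurable.forall fun m => Measurable.forall fun _ => (h2 m).not)

open Classical in
/-- Mass transport to the nearest trifurcations. -/
def FA (ν : Measure X) (r : ℝ) (ω : Config X) (z t : X) : ℝ≥0∞ :=
  if Near ω r z t then (ν {t | Near ω r z t})⁻¹ else 0

lemma measurable_FA (ν : Measure X) [SFinite ν] (r : ℝ) :
    Measurable fun p : Config X × X × X => FA ν r p.1 p.2.1 p.2.2 := by
  refine Measurable.ite (measurableSet_setOfPred.2 (meas_near r)) ?_ measurable_const
  refine Measurable.inv ?_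
  have h : MeasurableSet {q : (Config X × X) × X | Near q.1.1 r q.1.2 q.2} :=
    measurableSet_setOfPred.2 ((meas_near r).comp
      (measurable_fst.fst.prodMk (measurable_fst.snd.prodMk measurable_snd)))
  exact (measurable_measure_prodMk_left (ν := ν) h).comp
    (measurable_fst.prodMk measurable_snd.fst)

lemma FA_mapIso {o : X} {ν : Measure X} (hν : RefMeasure o ν) (r : ℝ) (g : X ≃ᵢ X) (ω : Config X)
    (z t : X) : FA ν r (Config.mapIso g ω) (g z) (g t) = FA ν r ω z t := by
  have h : ν {t | Near (Config.mapIso g ω) r (g z) t} = ν {t | Near ω r z t} := by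
    have hm : MeasurableSet {t | Near (Config.mapIso g ω) r (g z) t} :=
      measurableSet_setOfPred.2 ((meas_near r).comp
        (measurable_const.prodMk (measurable_const.prodMk measurable_id)))
    conv_lhs => rw [← hν.inv g]
    rw [Measure.map_apply g.continuous.measurable hm]
    congr 1
    ext t
    exact near_mapIso g ω r z t
  unfold FA
  rw [h]
  by_cases hN : Near ω r z t
  · rw [if_pos hN, if_pos ((near_mapIso g ω r z t).2 hN)]
  · rw [if_neg hN, if_neg (fun hh => hN ((near_mapIso g ω r z t).1 hh))]

lemma lintegral_FA_le (ν : Measure X) (r : ℝ) (ω : Config X) (z : X) :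
    ∫⁻ t, FA ν r ω z t ∂ν ≤ 1 := by
  have hm : MeasurableSet {t | Near ω r z t} :=
      measurableSet_setOfPred.2 ((meas_near r).comp
        (measurable_const.prodMk (measurable_const.prodMk measurable_id)))
  have : (fun t => FA ν r ω z t) =
      ({t | Near ω r z t}).indicator fun _ => (ν {t | Near ω r z t})⁻¹ := by
    classical
    funext t
    simp only [FA, indicator_apply]
    rfl
  rw [this, lintegral_indicator hm, setLIntegral_const, mul_comm]
  exact ENNReal.mul_inv_le_one _

lemma claimA_det (hsym : PointSymmetric X) {o : X} {ν : Measure X} [SigmaFinite ν]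
    (hν : RefMeasure o ν) {ω : Config X} {r : ℝ}
    (h : ∀ y : X, ∀ ε > 0, ∃ t, dist t y < ε ∧ ∫⁻ z, FA ν r ω z t ∂ν < ⊤)
    {x b : X} (hx : Trif ω r x) (hxb : Conn ω.1 x b) (hb : Inf (ω.1 \ Loc ω r x) b) :
    {y | Conn (ω.1 \ Loc ω r x) b y ∧ Trif ω r y}.Infinite := by
  classical
  intro hfin
  set L := Loc ω r x with hL
  -- uniform bound on the distance to `x` in `L`
  obtain ⟨m0, hm0⟩ : ∃ m0, ∀ l ∈ L, W ω.1 m0 l x := by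
    have h1 : ∀ l ∈ L, ∃ m, W ω.1 m l x := fun l hl =>
      (Conn.mono inter_subset_left hl).symm.exists_w
    choose! f hf using h1
    obtain ⟨M, hM⟩ := ((Loc.finite ω r x).image f).bddAbove
    exact ⟨M, fun l hl => (hf l hl).le (hM (mem_image_of_mem _ hl))⟩
  set Y0 : Set X := {y | Conn (ω.1 \ L) b y ∧ Trif ω r y} ∪ (ω.1 ∩ closedBall x (r + 2 * m0))
    with hY0
  have hY0f : Y0.Finite := hfin.union (ω.2 _ isBounded_closedBall)
  set Z : Set X := {z | (∃ c ∈ ω.1, dist c z ≤ 1/2) ∧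
    ∀ c ∈ ω.1, dist c z ≤ 1/2 → Conn (ω.1 \ L) b c} with hZ
  have hZtop : ν Z = ⊤ := by
    refine vol_infinite (hν.pos o (1/4) (by norm_num)) (hν.lower hsym) (Z := Z)
      (p := fun y => Conn (ω.1 \ L) b y ∧ r + 1 < dist x y) x ?_ ?_
    · intro m
      obtain ⟨y, h1, h2⟩ := hb.far sdiff_subset x (max m (r+1))
      exact ⟨y, ⟨h1, (le_max_right _ _).trans_lt h2⟩, (le_max_left _ _).trans_lt h2⟩
    · rintro y ⟨hy, hyr⟩ z hz
      rw [mem_closedBall, dist_comm] at hz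
      refine ⟨⟨y, hy.right.1, hz⟩, fun c hc hcz => ?_⟩
      have hyc : dist y c ≤ 1 := by
        rw [dist_comm c z] at hcz
        linarith [dist_triangle y z c]
      refine hy.tail ⟨hy.right, ⟨hc, fun hcL => ?_⟩, Tch.of_dist hyc⟩
      have : dist c x ≤ r := (Loc.subset ω r x hcL).2
      rw [dist_comm] at this
      rw [dist_comm] at hyc
      linarith [dist_triangle x c y]
  -- nearest trifurcations lie in `Y0`
  have key : ∀ z ∈ Z, ∀ n, (∀ m < n, ¬ RT ω r m z) → ∀ c ∈ ω.1, dist c z ≤ 1/2 →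
      ∀ y, Trif ω r y → W ω.1 n c y → y ∈ Y0 := by
    intro z hz n hn c hc hcz y hy hw
    rcases hw.split (L := L) with h1 | ⟨l, hl, k, m, rfl, h2, h3⟩
    · exact Or.inl ⟨(hz.2 c hc hcz).trans h1.conn, hy⟩
    · right
      have hmm : m ≤ m0 := by
        by_contra hlt
        push Not at hlt
        exact hn (k + m0) (by omega) ⟨c, hc, x, hx.1, hcz, hx, h2.trans (hm0 l hl)⟩
      refine ⟨hw.right, ?_⟩
      have a1 := h3.dist_le
      have a2 : dist l x ≤ r := (Loc.subset ω r x hl).2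
      have a3 : (m : ℝ) ≤ m0 := by exact_mod_cast hmm
      rw [mem_closedBall]
      rw [dist_comm] at a1
      linarith [dist_triangle y l x]
  obtain ⟨R, hR⟩ := hY0f.isBounded.subset_closedBall x
  set M := ν (closedBall x (R + 1/2)) with hM
  have hMfin : M < ⊤ := hν.fin _ _
  have hNear : ∀ z ∈ Z, ν {t | Near ω r z t} ≤ M := by
    intro z hz
    refine measure_mono ?_
    rintro t ⟨n, ⟨c, hc, y, hy, ⟨hcz, hyt⟩, hT, hw⟩, hmin⟩
    have hy0 : dist y x ≤ R := hR (key z hz n hmin c hc hcz y hT hw)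
    rw [mem_closedBall]
    rw [dist_comm] at hyt
    linarith [dist_triangle t y x]
  choose t ht ht' using fun y => h y (1/2) (by norm_num)
  have hG : ∀ z ∈ Z, M⁻¹ ≤ ∑ y ∈ hY0f.toFinset, FA ν r ω z (t y) := by
    intro z hz
    obtain ⟨c, hc, hcz⟩ := hz.1
    have hcx : Conn ω.1 c x :=
      ((hz.2 c hc hcz).mono sdiff_subset).symm.trans hxb.symm
    have hex : ∃ n, RT ω r n z := by
      obtain ⟨n, hn⟩ := hcx.exists_w
      exact ⟨n, c, hc, x, hx.1, hcz, hx, hn⟩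
    obtain ⟨c', hc', y, hy, hcz', hT, hw⟩ := Nat.find_spec hex
    have hmin : ∀ m < Nat.find hex, ¬ RT ω r m z := fun m hm => Nat.find_min hex hm
    have hyY : y ∈ Y0 := key z hz _ hmin c' hc' hcz' y hT hw
    have hN : Near ω r z (t y) := ⟨_, ⟨c', hc', y, hy, ⟨hcz', by
      rw [dist_comm]; exact (ht y).le⟩, hT, hw⟩, hmin⟩
    calc M⁻¹ ≤ FA ν r ω z (t y) := by
          rw [FA, if_pos hN]; exact ENNReal.inv_le_inv.2 (hNear z hz)
      _ ≤ _ := Finset.single_le_sum (f := fun y => FA ν r ω z (t y)) (fun _ _ => bot_le)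
          (hY0f.mem_toFinset.2 hyY)
  have hmF : ∀ y, Measurable fun z => FA ν r ω z (t y) := fun y =>
    (measurable_FA ν r).comp (measurable_const.prodMk (measurable_id.prodMk measurable_const))
  have hlt : ∫⁻ z, ∑ y ∈ hY0f.toFinset, FA ν r ω z (t y) ∂ν < ⊤ := by
    rw [lintegral_finsetSum _ fun y _ => hmF y]
    exact ENNReal.sum_lt_top.2 fun y _ => ht' y
  have hge := mul_meas_ge_le_lintegral (μ := ν)
    (Finset.measurable_sum hY0f.toFinset fun y _ => hmF y) M⁻¹
  have hZs : Z ⊆ {z | M⁻¹ ≤ ∑ y ∈ hY0f.toFinset, FA ν r ω z (t y)} := hG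
  have htop := hZtop ▸ measure_mono (μ := ν) hZs
  rw [top_le_iff.1 htop, ENNReal.mul_top (ENNReal.inv_ne_zero.2 hMfin.ne)] at hge
  exact absurd hlt (not_lt.2 hge)

lemma claimA (hsym : PointSymmetric X) {o : X} {ν : Measure X} [SigmaFinite ν]
    (hν : RefMeasure o ν) {P : Measure (Config X)} [IsProbabilityMeasure P]
    (hP : IsoInvariant P) (r : ℝ) :
    ∀ᵐ ω ∂P, ∀ x b, Trif ω r x → Conn ω.1 x b → Inf (ω.1 \ Loc ω r x) b →
      {y | Conn (ω.1 \ Loc ω r x) b y ∧ Trif ω r y}.Infinite := by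
  have h1 : ∀ᵐ ω ∂P, ∫⁻ z, FA ν r ω z o ∂ν < ⊤ := by
    have h2 := mtp hν hP (measurable_FA ν r) (FA_mapIso hν r)
    have h3 : ∫⁻ ω, ∫⁻ z, FA ν r ω o z ∂ν ∂P ≤ 1 := by
      calc _ ≤ ∫⁻ ω, 1 ∂P := lintegral_mono fun ω => lintegral_FA_le ν r ω o
        _ = 1 := by simp
    rw [h2] at h3
    refine ae_lt_top ?_ (h3.trans_lt ENNReal.one_lt_top).ne
    have := (measurable_FA ν r).comp
      (measurable_fst.prodMk (measurable_snd.prodMk (measurable_const (a := o))))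
    exact this.lintegral_prod_right' (ν := ν) (f := fun p : Config X × X => FA ν r p.1 p.2 o)
  have h4 := ae_transfer hsym o hP (E := fun ω t => ∫⁻ z, FA ν r ω z t ∂ν < ⊤) ?_ h1
  · filter_upwards [h4] with ω hω x b hx hxb hb
    exact claimA_det hsym hν hω hx hxb hb
  · intro g ω a h
    have e : ∫⁻ z, FA ν r ω z (g.symm a) ∂ν = ∫⁻ z, FA ν r (Config.mapIso g ω) z a ∂ν := by
      have hm : Measurable fun z => FA ν r (Config.mapIso g ω) z a :=
        (measurable_FA ν r).comp
          (measurable_const.prodMk (measurable_id.prodMk measurable_const))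
      have := lintegral_map (μ := ν) hm g.continuous.measurable
      rw [hν.inv g] at this
      rw [this]
      refine lintegral_congr fun z => ?_
      rw [← FA_mapIso hν r g, g.apply_symm_apply]
    rw [e]; exact h

end ClaimA

section ClaimC

variable {X : Type*} [MetricSpace X]

lemma Loc.conn {ω : Config X} {r : ℝ} {x l : X} {K : Set X} (hl : l ∈ Loc ω r x)
    (hK : ∀ y ∈ Loc ω r x, y ∉ K) : Conn (ω.1 \ K) x l :=
  Conn.stay hl fun y hy => ⟨(Conn.right hy).1, hK y hy⟩

/-- A component outside of the local component is connected to the centre, avoiding `K`. -/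
lemma adj_loc {ω : Config X} {r : ℝ} {x d : X} {K : Set X} (hx : x ∈ ω.1) (hr : 0 ≤ r)
    (hxd : Conn ω.1 x d)
    (hd : d ∈ ω.1 \ Loc ω r x) (hK : ∀ y ∈ Loc ω r x, y ∉ K)
    (hD : ∀ y, Conn (ω.1 \ Loc ω r x) d y → y ∉ K) : Conn (ω.1 \ K) d x := by
  rcases hxd.symm.exit (fun y => y ∉ Loc ω r x) hd.2 with h | ⟨c, e, h1, h2, h3⟩
  · exact absurd (Conn.refl ⟨hx, mem_closedBall_self hr⟩ : x ∈ Loc ω r x) h.right.2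
  · push Not at h3
    have h4 : Conn (ω.1 \ K) d c := Conn.stay (S := ω.1 \ Loc ω r x) h1
      fun y hy => ⟨hy.right.1, hD y hy⟩
    exact (h4.tail ⟨h4.right, ⟨h2.2.1, hK e h3⟩, h2.2.2⟩).trans (Loc.conn h3 hK).symm

/-- At a trifurcation, there are two infinite components avoiding a given connected set. -/
lemma two_avoid {ω : Config X} {r : ℝ} {x : X} (h : Trif ω r x) {K : Set X}
    (hK : ∀ k ∈ K, ∀ k' ∈ K, Conn (ω.1 \ Loc ω r x) k k') :
    ∃ d₁ d₂, (Conn ω.1 x d₁ ∧ Conn ω.1 x d₂) ∧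
      (Inf (ω.1 \ Loc ω r x) d₁ ∧ Inf (ω.1 \ Loc ω r x) d₂) ∧
      ¬ Conn (ω.1 \ Loc ω r x) d₁ d₂ ∧
      (∀ k ∈ K, ¬ Conn (ω.1 \ Loc ω r x) d₁ k) ∧ (∀ k ∈ K, ¬ Conn (ω.1 \ Loc ω r x) d₂ k) := by
  obtain ⟨hx, b1, -, b2, -, b3, -, ⟨c1, c2, c3⟩, ⟨i1, i2, i3⟩, n1, n2, n3⟩ := h
  have key : ∀ {a b}, ¬ Conn (ω.1 \ Loc ω r x) a b → ∀ k ∈ K, Conn (ω.1 \ Loc ω r x) a k →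
      ∀ k' ∈ K, ¬ Conn (ω.1 \ Loc ω r x) b k' := fun hab k hk hak k' hk' hbk' =>
    hab ((hak.trans (hK k hk k' hk')).trans hbk'.symm)
  by_cases h1 : ∃ k ∈ K, Conn (ω.1 \ Loc ω r x) b1 k
  · obtain ⟨k, hk, hbk⟩ := h1
    exact ⟨b2, b3, ⟨c2, c3⟩, ⟨i2, i3⟩, n3, key n1 k hk hbk, key n2 k hk hbk⟩
  · by_cases h2 : ∃ k ∈ K, Conn (ω.1 \ Loc ω r x) b2 k
    · obtain ⟨k, hk, hbk⟩ := h2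
      exact ⟨b1, b3, ⟨c1, c3⟩, ⟨i1, i3⟩, n2, fun k hk hh => h1 ⟨k, hk, hh⟩, key n3 k hk hbk⟩
    · exact ⟨b1, b2, ⟨c1, c2⟩, ⟨i1, i2⟩, n1, fun k hk hh => h1 ⟨k, hk, hh⟩,
        fun k hk hh => h2 ⟨k, hk, hh⟩⟩

lemma exists_inf_comp {ω : Config X} {S L : Set X} (hS : S ⊆ ω.1) {a : X} (h : Inf S a)
    (hL : L.Finite) : ∃ b, Conn S a b ∧ Inf (S \ L) b := by
  by_contra hcon
  push Not at hcon
  set N : Set X := {c | Conn S a c ∧ (c = a ∨ ∃ d ∈ L, Tch c d)} with hN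
  have hNf : N.Finite := by
    refine ω.finite (fun c hc => hS hc.1.right) ?_
    obtain ⟨R, hR⟩ := hL.isBounded.subset_closedBall a
    refine isBounded_closedBall.subset (?_ : N ⊆ closedBall a (max 0 (R + 2)))
    rintro c ⟨-, rfl | ⟨d, hd, hcd⟩⟩
    · simp
    · have h1 : dist d a ≤ R := hR hd
      have := hcd.dist_le
      rw [mem_closedBall]
      exact le_max_of_le_right (by linarith [dist_triangle c d a])
  refine h ((hL.union (hNf.biUnion (t := fun c => {y | Conn (S \ L) c y}) fun c hc => ?_)).subset ?_)
  · exact not_infinite.1 (hcon c hc.1)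
  · intro y hy
    by_cases hyL : y ∈ L
    · exact Or.inl hyL
    · right
      simp only [mem_iUnion]
      rcases (Conn.symm hy).exit (fun z => z ∉ L) hyL with h1 | ⟨c, d, h1, h2, h3⟩
      · exact ⟨a, ⟨Conn.refl hy.1, Or.inl rfl⟩, Conn.symm (S := S \ L) h1⟩
      · push Not at h3
        have h4 : Conn S a c := Conn.trans hy (h1.mono fun z hz => hz.1)
        exact ⟨c, ⟨h4, Or.inr ⟨d, h3, h2.2.2⟩⟩, Conn.symm (S := S \ L) h1⟩

lemma W.ball {S : Set X} {n : ℕ} {a b : X} (h : W S n a b) :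
    W (S ∩ closedBall a (2 * n)) n a b := by
  induction n generalizing b with
  | zero => exact ⟨h.1, h.2, by simp⟩
  | succ n ih =>
    have hd := h.dist_le
    obtain ⟨c, h1, h2⟩ := h
    have h3 := (ih h1).mono (T := S ∩ closedBall a (2 * (n + 1 : ℕ)))
      (inter_subset_inter_right _ (closedBall_subset_closedBall (by push_cast; linarith)))
    refine ⟨c, h3, h3.right, ⟨h2.2.1, ?_⟩, h2.2.2⟩
    rw [mem_closedBall, dist_comm]; exact hd

lemma exists_loc (ω : Config X) {x : X} {F : Set X} (hF : F.Finite)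
    (h : ∀ y ∈ F, Conn ω.1 x y) : ∃ r : ℕ, F ⊆ Loc ω r x := by
  have h1 : ∀ y ∈ F, ∃ n, W ω.1 n x y := fun y hy => (h y hy).exists_w
  choose! f hf using h1
  obtain ⟨M, hM⟩ := (hF.image f).bddAbove
  refine ⟨2 * M, fun y hy => ?_⟩
  refine ((hf y hy).le (hM (mem_image_of_mem _ hy))).ball.conn.mono ?_
  push_cast; exact subset_rfl

lemma exists_far {ω : Config X} {T : Set X} (hT : T.Infinite) (hω : T ⊆ ω.1) (x : X) (R : ℝ) :
    ∃ y ∈ T, R < dist y x := by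
  by_contra hcon
  push Not at hcon
  exact hT (ω.finite hω (isBounded_closedBall.subset fun y hy => hcon y hy))

lemma loc_disjoint {ω : Config X} {r : ℝ} {x y : X} (h : 2 * r < dist y x) :
    ∀ l ∈ Loc ω r y, l ∉ Loc ω r x := by
  intro l h1 h2
  have a1 : dist l y ≤ r := (Loc.subset _ _ _ h1).2
  have a2 : dist l x ≤ r := (Loc.subset _ _ _ h2).2
  linarith [dist_triangle_left y x l]

lemma loc_conn_pair {ω : Config X} {r : ℝ} {x : X} {K : Set X}
    (hK : ∀ l ∈ Loc ω r x, l ∉ K) :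
    ∀ k ∈ Loc ω r x, ∀ k' ∈ Loc ω r x, Conn (ω.1 \ K) k k' :=
  fun _ hk _ hk' => (Loc.conn hk hK).symm.trans (Loc.conn hk' hK)

lemma claimC_det {ω ω' : Config X} (hsub : ω.1 ⊆ ω'.1) (hfin : (ω'.1 \ ω.1).Finite)
    (hA : ∀ r : ℕ, ∀ x b, Trif ω' r x → Conn ω'.1 x b → Inf (ω'.1 \ Loc ω' r x) b →
      {y | Conn (ω'.1 \ Loc ω' r x) b y ∧ Trif ω' r y}.Infinite)
    {c₁ c₂ c₃ : X} (i1 : Inf ω.1 c₁) (i2 : Inf ω.1 c₂) (i3 : Inf ω.1 c₃)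
    (n12 : ¬ Conn ω.1 c₁ c₂) (n13 : ¬ Conn ω.1 c₁ c₃) (n23 : ¬ Conn ω.1 c₂ c₃)
    (h12 : Conn ω'.1 c₁ c₂) (h13 : Conn ω'.1 c₁ c₃) :
    ∃ r : ℕ, ∃ y, Conn ω.1 c₁ y ∧ Trif ω r y := by
  obtain ⟨r, hr⟩ := exists_loc ω' (x := c₁) (F := {y | y ∈ ω'.1 \ ω.1 ∧ Conn ω'.1 c₁ y})
    (hfin.subset fun y hy => hy.1) (fun y hy => hy.2)
  have hr0 : (0 : ℝ) ≤ r := Nat.cast_nonneg r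
  set L := Loc ω' r c₁ with hL
  have hLf : L.Finite := Loc.finite _ _ _
  -- outside of `L`, the two configurations agree in the cluster
  have agree : ∀ {b}, Conn ω'.1 c₁ b → ∀ {y}, Conn (ω'.1 \ L) b y → Conn (ω.1 \ L) b y := by
    intro b hb y hy
    refine hy.stay fun z hz => ⟨?_, hz.right.2⟩
    by_contra hzω
    exact hz.right.2 (hr ⟨⟨hz.right.1, hzω⟩, hb.trans (hz.mono sdiff_subset)⟩)
  obtain ⟨b1, cb1, ib1⟩ := exists_inf_comp subset_rfl i1 hLf
  obtain ⟨b2, cb2, ib2⟩ := exists_inf_comp subset_rfl i2 hLf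
  obtain ⟨b3, cb3, ib3⟩ := exists_inf_comp subset_rfl i3 hLf
  have hss : ω.1 \ L ⊆ ω'.1 \ L := sdiff_subset_sdiff_left hsub
  have hc1b1 : Conn ω'.1 c₁ b1 := cb1.mono hsub
  have hc1b2 : Conn ω'.1 c₁ b2 := h12.trans (cb2.mono hsub)
  have hc1b3 : Conn ω'.1 c₁ b3 := h13.trans (cb3.mono hsub)
  have hT : Trif ω' r c₁ := by
    refine ⟨hsub i1.mem, b1, hc1b1.right, b2, hc1b2.right, b3, hc1b3.right,
      ⟨hc1b1, hc1b2, hc1b3⟩, ⟨ib1.mono hss, ib2.mono hss, ib3.mono hss⟩, ?_, ?_, ?_⟩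
    · intro h; exact n12 ((cb1.trans ((agree hc1b1 h).mono sdiff_subset)).trans cb2.symm)
    · intro h; exact n13 ((cb1.trans ((agree hc1b1 h).mono sdiff_subset)).trans cb3.symm)
    · intro h; exact n23 ((cb2.trans ((agree hc1b2 h).mono sdiff_subset)).trans cb3.symm)
  obtain ⟨x', ⟨hb1x', hTx'⟩, hfar'⟩ := exists_far (ω := ω') (hA r c₁ b1 hT hc1b1 (ib1.mono hss))
    (fun y hy => hy.2.1) c₁ (2 * r)
  set L' := Loc ω' r x' with hL'
  have hL'L : ∀ l ∈ L', l ∉ L := loc_disjoint hfar'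
  have hLL' : ∀ l ∈ L, l ∉ L' := fun l h1 h2 => hL'L l h2 h1
  obtain ⟨d1, d2, ⟨xd1, xd2⟩, ⟨id1, id2⟩, nd, av1, av2⟩ :=
    two_avoid hTx' (K := L) (loc_conn_pair hLL')
  have inB : ∀ {d}, Conn ω'.1 x' d → d ∈ ω'.1 \ L' → (∀ k ∈ L, ¬ Conn (ω'.1 \ L') d k) →
      ∀ {y}, Conn (ω'.1 \ L') d y → Conn (ω.1 \ L) b1 y := by
    intro d hxd hd hav y hy
    have hD : ∀ y, Conn (ω'.1 \ L') d y → y ∉ L := fun y hy hyL => hav y hyL hy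
    have h1 : Conn (ω'.1 \ L) d x' := adj_loc hTx'.1 hr0 hxd hd hL'L hD
    have h2 : Conn (ω'.1 \ L) d y := hy.stay fun z hz => ⟨hz.right.1, hD z hz⟩
    exact agree hc1b1 ((hb1x'.trans h1.symm).trans h2)
  obtain ⟨x'', ⟨hd1x'', hTx''⟩, hfar''⟩ := exists_far (ω := ω') (hA r x' d1 hTx' xd1 id1)
    (fun y hy => hy.2.1) x' (2 * r)
  set L'' := Loc ω' r x'' with hL''
  have hLppLp : ∀ l ∈ L'', l ∉ L' := loc_disjoint hfar''
  have hLpLpp : ∀ l ∈ L', l ∉ L'' := fun l h1 h2 => hLppLp l h2 h1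
  have hL''D : ∀ l ∈ L'', Conn (ω'.1 \ L') d1 l := fun l hl => hd1x''.trans (Loc.conn hl hLppLp)
  obtain ⟨e1, e2, ⟨xe1, xe2⟩, ⟨ie1, ie2⟩, ne, ave1, ave2⟩ :=
    two_avoid hTx'' (K := L') (loc_conn_pair hLpLpp)
  have inD : ∀ {e}, Conn ω'.1 x'' e → e ∈ ω'.1 \ L'' → (∀ k ∈ L', ¬ Conn (ω'.1 \ L'') e k) →
      ∀ {y}, Conn (ω'.1 \ L'') e y → Conn (ω'.1 \ L') d1 y := by
    intro e hxe he hav y hy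
    have hD : ∀ y, Conn (ω'.1 \ L'') e y → y ∉ L' := fun y hy hyL => hav y hyL hy
    have h1 : Conn (ω'.1 \ L') e x'' := adj_loc hTx''.1 hr0 hxe he hLppLp hD
    have h2 : Conn (ω'.1 \ L') e y := hy.stay fun z hz => ⟨hz.right.1, hD z hz⟩
    exact (hd1x''.trans h1.symm).trans h2
  have D1B : ∀ {y}, Conn (ω'.1 \ L') d1 y → Conn (ω.1 \ L) b1 y := inB xd1 id1.mem av1
  have D2B : ∀ {y}, Conn (ω'.1 \ L') d2 y → Conn (ω.1 \ L) b1 y := inB xd2 id2.mem av2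
  have locEq : Loc ω r x'' = L'' := by
    ext l
    constructor
    · intro hl
      exact Conn.mono (inter_subset_inter_left _ hsub) hl
    · intro hl
      refine Conn.stay hl fun z hz => ⟨?_, (Conn.right hz).2⟩
      exact (D1B (hL''D z hz)).right.1
  have c1 : ∀ {y}, Conn (ω.1 \ L) b1 y → Conn ω.1 c₁ y := fun h => cb1.trans (h.mono sdiff_subset)
  have tx : Conn ω.1 c₁ x'' := c1 (D1B hd1x'')
  have te1 : Conn ω.1 c₁ e1 := c1 (D1B (inD xe1 ie1.mem ave1 (Conn.refl ie1.mem)))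
  have te2 : Conn ω.1 c₁ e2 := c1 (D1B (inD xe2 ie2.mem ave2 (Conn.refl ie2.mem)))
  have td2 : Conn ω.1 c₁ d2 := c1 (D2B (Conn.refl id2.mem))
  have hss' : ω.1 \ L'' ⊆ ω'.1 \ L'' := sdiff_subset_sdiff_left hsub
  have d2L'' : ∀ y, Conn (ω'.1 \ L') d2 y → y ∉ L'' := fun y hy hyL =>
    nd ((hL''D y hyL).trans hy.symm)
  have d2x' : Conn (ω'.1 \ L'') d2 x' := adj_loc hTx'.1 hr0 xd2 id2.mem hLpLpp d2L''
  have xpLp : x' ∈ L' := Conn.refl ⟨hTx'.1, mem_closedBall_self hr0⟩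
  refine ⟨r, x'', tx, tx.right, e1, te1.right, e2, te2.right, d2, td2.right,
    ⟨tx.symm.trans te1, tx.symm.trans te2, tx.symm.trans td2⟩, ?_, ?_⟩
  · rw [locEq]
    refine ⟨ie1.stay fun y hy => ⟨?_, hy.right.2⟩, ie2.stay fun y hy => ⟨?_, hy.right.2⟩,
      id2.stay fun y hy => ⟨?_, d2L'' y hy⟩⟩
    · exact (D1B (inD xe1 ie1.mem ave1 hy)).right.1
    · exact (D1B (inD xe2 ie2.mem ave2 hy)).right.1
    · exact (D2B hy).right.1
  · rw [locEq]
    refine ⟨fun h => ne (h.mono hss'), fun h => ?_, fun h => ?_⟩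
    · exact ave1 x' xpLp ((h.mono hss').trans d2x')
    · exact ave2 x' xpLp ((h.mono hss').trans d2x')

def Links [TopologicalSpace.SeparableSpace X] [Nonempty X] (l : List ℕ) (a b : X) : Prop :=
  ∀ S : Set X, a ∈ S → (∀ q ∈ l, ∃ y ∈ S, dist y (TopologicalSpace.denseSeq X q) ≤ 1/4) →
    ∃ c, dist c b ≤ 1/2 ∧ Conn S a c

lemma exists_links [TopologicalSpace.SeparableSpace X] [Nonempty X] [PreconnectedSpace X]
    (a b : X) : ∃ l, Links l a b := by
  have step : ∀ b b', dist b b' < 1/8 → (∃ l, Links l a b) → ∃ l, Links l a b' := by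
    rintro b b' hbb' ⟨l, hl⟩
    obtain ⟨q, hq⟩ := (TopologicalSpace.denseRange_denseSeq X).exists_dist_lt b'
      (show (0 : ℝ) < 1/8 by norm_num)
    refine ⟨q :: l, fun S ha hS => ?_⟩
    obtain ⟨c, hc, hac⟩ := hl S ha fun q' hq' => hS q' (List.mem_cons_of_mem _ hq')
    obtain ⟨y, hy, hyq⟩ := hS q List.mem_cons_self
    have h1 : dist y b' ≤ 3/8 := by
      rw [dist_comm] at hq
      linarith [dist_triangle y (TopologicalSpace.denseSeq X q) b']
    refine ⟨y, by linarith, hac.tail ⟨hac.right, hy, Tch.of_dist ?_⟩⟩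
    rw [dist_comm] at h1
    linarith [dist_triangle c b y, dist_triangle b b' y]
  have : {b | ∃ l, Links l a b} = univ := by
    refine IsClopen.eq_univ ⟨⟨?_⟩, ?_⟩ ⟨a, [], fun S ha _ => ⟨a, by simp, Conn.refl ha⟩⟩
    · rw [Metric.isOpen_iff]
      intro b hb
      refine ⟨1/8, by norm_num, fun b' hb' h => hb (step b' b ?_ h)⟩
      exact mem_ball.1 hb'
    · rw [Metric.isOpen_iff]
      intro b hb
      refine ⟨1/8, by norm_num, fun b' hb' => step b b' ?_ hb⟩
      rw [dist_comm]; exact mem_ball.1 hb'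
  have h2 : b ∈ {b | ∃ l, Links l a b} := by rw [this]; exact mem_univ b
  exact h2

lemma Links.conn [TopologicalSpace.SeparableSpace X] [Nonempty X] {l : List ℕ} {a b : X}
    (h : Links l a b) {S : Set X} (ha : a ∈ S) (hb : b ∈ S)
    (hS : ∀ q ∈ l, ∃ y ∈ S, dist y (TopologicalSpace.denseSeq X q) ≤ 1/4) : Conn S a b := by
  obtain ⟨c, hc, hac⟩ := h S ha hS
  exact hac.tail ⟨hac.right, hb, Tch.of_dist (by linarith)⟩

variable [ProperSpace X] [MeasurableSpace X] [BorelSpace X]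

lemma insertion [Nonempty X] {μ : Measure X}
    (hμball : ∀ (x : X) (r : ℝ), 0 < r → 0 < μ (closedBall x r) ∧ μ (closedBall x r) < ⊤)
    {P : Measure (Config X)} [IsProbabilityMeasure P] (hPins : InsertionTolerant μ P)
    {Good : Config X → Prop} (hG : ∀ᵐ ω ∂P, Good ω) (l : List ℕ) :
    ∀ᵐ ω ∂P, ∃ ω' : Config X, Good ω' ∧ ω.1 ⊆ ω'.1 ∧ (ω'.1 \ ω.1).Finite ∧
      ∀ q ∈ l, ∃ y ∈ ω'.1, dist y (TopologicalSpace.denseSeq X q) ≤ 1/4 := by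
  induction l with
  | nil =>
    filter_upwards [hG] with ω hω
    exact ⟨ω, hω, subset_rfl, by simp, by simp⟩
  | cons q l ih =>
    set B := closedBall (TopologicalSpace.denseSeq X q) (1/4) with hB
    have hBm : MeasurableSet B := isClosed_closedBall.measurableSet
    obtain ⟨hB0, hB1⟩ := hμball (TopologicalSpace.denseSeq X q) (1/4) (by norm_num)
    have hpr : IsProbabilityMeasure ((μ B)⁻¹ • μ.restrict B) := by
      constructor
      simp only [Measure.smul_apply, Measure.restrict_apply_univ, smul_eq_mul]
      exact ENNReal.inv_mul_cancel hB0.ne' hB1.ne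
    have h1 := (hPins B hBm hB0 hB1).ae_le ih
    have h2 := ae_of_ae_map measurable_insertPt.aemeasurable h1
    have h3 := Measure.ae_ae_of_ae_prod h2
    have h4 : ∀ᵐ y ∂((μ B)⁻¹ • μ.restrict B), y ∈ B :=
      Measure.ae_smul_measure (ae_restrict_mem hBm) _
    filter_upwards [h3] with ω hω
    obtain ⟨y, ⟨ω', g1, g2, g3, g4⟩, hy⟩ := (hω.and h4).exists
    have hyω' : y ∈ ω'.1 := g2 (mem_insert _ _)
    refine ⟨ω', g1, fun z hz => g2 (mem_insert_of_mem _ hz), ?_, ?_⟩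
    · refine (g3.insert y).subset fun z hz => ?_
      by_cases hzy : z = y
      · exact Or.inl hzy
      · exact Or.inr ⟨hz.1, fun h => (mem_insert_iff.1 h).elim hzy hz.2⟩
    · intro q' hq'
      rcases List.mem_cons.1 hq' with rfl | h
      · exact ⟨y, hyω', hy⟩
      · exact g4 q' h

lemma claimC [PreconnectedSpace X] [Nonempty X] (hsym : PointSymmetric X) {o : X} {ν : Measure X}
    [SigmaFinite ν] (hν : RefMeasure o ν) {μ : Measure X}
    (hμball : ∀ (x : X) (r : ℝ), 0 < r → 0 < μ (closedBall x r) ∧ μ (closedBall x r) < ⊤)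
    {P : Measure (Config X)} [IsProbabilityMeasure P] (hPins : InsertionTolerant μ P)
    (hP : IsoInvariant P)
    (hN : ∀ᵐ ω ∂P,
      {C : Set X | (∃ x ∈ ω.1, C = graphComp (boolAdj ω) x) ∧ C.Infinite}.Infinite) :
    ∀ᵐ ω ∂P, ∀ x, Inf ω.1 x → ∃ r : ℕ, ∃ y, Conn ω.1 x y ∧ Trif ω r y := by
  have hA := ae_all_iff.2 fun r : ℕ => claimA hsym hν hP (r : ℝ)
  have hI := ae_all_iff.2 fun l : List ℕ => insertion hμball hPins hA l
  filter_upwards [hI, hN] with ω hω hinf c1 i1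
  -- find two other infinite clusters
  have find : ∀ F : Set (Set X), F.Finite → ∃ c, Inf ω.1 c ∧ {y | Conn ω.1 c y} ∉ F := by
    intro F hF
    obtain ⟨C, ⟨⟨x, hx, rfl⟩, hC⟩, hCF⟩ := hinf.exists_notMem_finite hF
    rw [graphComp_eq ω hx] at hC hCF
    exact ⟨x, hC, hCF⟩
  obtain ⟨c2, i2, h2⟩ := find {{y | Conn ω.1 c1 y}} (finite_singleton _)
  obtain ⟨c3, i3, h3⟩ := find {{y | Conn ω.1 c1 y}, {y | Conn ω.1 c2 y}} (by simp)
  have heq : ∀ {a b}, Conn ω.1 a b → {y | Conn ω.1 b y} = {y | Conn ω.1 a y} := by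
    intro a b h
    ext y
    exact ⟨fun hy => h.trans hy, fun hy => h.symm.trans hy⟩
  obtain ⟨l, hl⟩ := exists_links c1 c2
  obtain ⟨l', hl'⟩ := exists_links c1 c3
  obtain ⟨ω', g1, g2, g3, g4⟩ := hω (l ++ l')
  refine claimC_det g2 g3 g1 i1 i2 i3 (fun h => h2 (heq h))
    (fun h => h3 (Or.inl (heq h))) (fun h => h3 (Or.inr (heq h))) ?_ ?_
  · exact hl.conn (g2 i1.mem) (g2 i2.mem) fun q hq => g4 q (List.mem_append_left _ hq)
  · exact hl'.conn (g2 i1.mem) (g2 i3.mem) fun q hq => g4 q (List.mem_append_right _ hq)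

end ClaimC

section Heat

variable {X : Type*} [MetricSpace X]

lemma nb_finite (ω : Config X) (a : X) : {b | b ∈ ω.1 ∧ Tch a b}.Finite :=
  (ω.2 (closedBall a 2) isBounded_closedBall).subset fun b hb => ⟨hb.1, by
    rw [mem_closedBall, dist_comm]; exact hb.2.dist_le⟩

/-- The finite set of neighbours (including the point itself). -/
def NF (ω : Config X) (a : X) : Finset X := (nb_finite ω a).toFinset

lemma mem_NF {ω : Config X} {a b : X} : b ∈ NF ω a ↔ b ∈ ω.1 ∧ Tch a b :=
  (nb_finite ω a).mem_toFinset

lemma self_mem_NF {ω : Config X} {a : X} (h : a ∈ ω.1) : a ∈ NF ω a := mem_NF.2 ⟨h, Tch.refl a⟩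

lemma card_NF_pos {ω : Config X} {a : X} (h : a ∈ ω.1) : (0 : ℝ) < (NF ω a).card := by
  exact_mod_cast Finset.card_pos.2 ⟨a, self_mem_NF h⟩

open Classical in
/-- Truncated Green function of the lazy walk killed at nothing: `hk n` counts visits up to
time `n`, divided by the degree. -/
def hk (ω : Config X) : ℕ → X → X → ℝ
  | 0, _, _ => 0
  | n + 1, x, w => (∑ b ∈ NF ω w, hk ω n x b + if w = x then 1 else 0) / (NF ω w).card

variable {ω : Config X}

lemma hk_nonneg (n : ℕ) (x w : X) : 0 ≤ hk ω n x w := by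
  classical
  induction n generalizing w with
  | zero => exact le_rfl
  | succ n ih =>
    rw [hk]
    refine div_nonneg (add_nonneg (Finset.sum_nonneg fun b _ => ih b) ?_) (Nat.cast_nonneg _)
    split_ifs <;> norm_num

lemma hk_mono_succ (n : ℕ) (x w : X) : hk ω n x w ≤ hk ω (n + 1) x w := by
  classical
  induction n generalizing w with
  | zero => exact hk_nonneg _ _ _
  | succ n ih =>
    rw [hk, hk]
    gcongr with b hb
    exact ih b

lemma hk_mono (x w : X) : Monotone fun n => hk ω n x w :=
  monotone_nat_of_le_succ fun n => hk_mono_succ n x w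

lemma hk_rec (n : ℕ) (x : X) {w : X} (hw : w ∈ ω.1) [Decidable (w = x)] :
    (NF ω w).card * hk ω (n + 1) x w = ∑ b ∈ NF ω w, hk ω n x b + if w = x then 1 else 0 := by
  have h := card_NF_pos hw
  rw [hk, mul_div_cancel₀ _ h.ne']
  congr

lemma hk_le_diag (n : ℕ) (x : X) {w : X} (hw : w ∈ ω.1) : hk ω n x w ≤ hk ω n x x := by
  classical
  induction n generalizing w with
  | zero => exact le_rfl
  | succ n ih =>
    by_cases hwx : w = x
    · rw [hwx]
    · refine le_trans ?_ (hk_mono_succ n x x)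
      have h := card_NF_pos hw
      have h2 := hk_rec n x hw
      rw [if_neg hwx, add_zero] at h2
      have h3 : ∑ b ∈ NF ω w, hk ω n x b ≤ (NF ω w).card * hk ω n x x := by
        rw [← nsmul_eq_mul]
        exact Finset.sum_le_card_nsmul _ _ _ fun b hb => ih (mem_NF.1 hb).1
      rw [← h2] at h3
      exact le_of_mul_le_mul_left h3 h

lemma hk_supp (n : ℕ) (x w : X) (h : hk ω n x w ≠ 0) : dist x w ≤ 2 * n := by
  classical
  induction n generalizing w with
  | zero => exact absurd rfl h
  | succ n ih =>
    by_contra hd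
    push Not at hd
    push_cast at hd
    apply h
    rw [hk]
    have h1 : w ≠ x := by
      rintro rfl
      simp only [dist_self] at hd
      have : (0 : ℝ) ≤ n := Nat.cast_nonneg n
      linarith
    have h2 : ∑ b ∈ NF ω w, hk ω n x b = 0 := by
      refine Finset.sum_eq_zero fun b hb => ?_
      by_contra hne
      have h3 := ih b hne
      have h4 := (mem_NF.1 hb).2.symm.dist_le
      linarith [dist_triangle x b w]
    rw [h2, if_neg h1]; simp

open Classical in
/-- Energy of a function on a finite set of vertices. -/
def En (Λ : Finset X) (f : X → ℝ) : ℝ :=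
  ∑ a ∈ Λ, ∑ b ∈ Λ, if Tch a b then (f a - f b) ^ 2 else 0

lemma En_mono {Λ Λ' : Finset X} (h : Λ ⊆ Λ') (f : X → ℝ) : En Λ f ≤ En Λ' f := by
  classical
  have nn : ∀ a b, 0 ≤ (if Tch a b then (f a - f b) ^ 2 else 0) := by
    intro a b; split_ifs <;> positivity
  unfold En
  calc _ ≤ ∑ a ∈ Λ, ∑ b ∈ Λ', (if Tch a b then (f a - f b) ^ 2 else 0) :=
        Finset.sum_le_sum fun a _ => Finset.sum_le_sum_of_subset_of_nonneg h fun b _ _ => nn a b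
    _ ≤ _ := Finset.sum_le_sum_of_subset_of_nonneg h fun a _ _ =>
        Finset.sum_nonneg fun b _ => nn a b

lemma En_hk_le (n : ℕ) (x : X) {Λ : Finset X} (hΛ : ∀ a ∈ Λ, a ∈ ω.1) :
    En Λ (hk ω n x) ≤ 2 * hk ω n x x := by
  classical
  have hfin := ω.2 (closedBall x (2 * n + 2)) isBounded_closedBall
  set M : Finset X := Λ ∪ hfin.toFinset with hM
  have hMω : ∀ a ∈ M, a ∈ ω.1 := by
    intro a ha
    rcases Finset.mem_union.1 ha with h | h
    · exact hΛ a h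
    · exact (hfin.mem_toFinset.1 h).1
  refine (En_mono (Finset.subset_union_left : Λ ⊆ M) _).trans ?_
  set f := hk ω n x with hf
  have e1 : En M f = 2 * ∑ a ∈ M, f a * ∑ b ∈ M, if Tch a b then (f a - f b) else 0 := by
    have s1 : ∑ a ∈ M, f a * ∑ b ∈ M, (if Tch a b then (f a - f b) else 0) =
        ∑ a ∈ M, ∑ b ∈ M, if Tch a b then f a * (f a - f b) else 0 := by
      refine Finset.sum_congr rfl fun a _ => ?_
      rw [Finset.mul_sum]
      refine Finset.sum_congr rfl fun b _ => ?_
      split_ifs <;> simp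
    have s2 : ∑ a ∈ M, ∑ b ∈ M, (if Tch a b then f a * (f a - f b) else 0) =
        ∑ a ∈ M, ∑ b ∈ M, if Tch a b then f b * (f b - f a) else 0 := by
      rw [Finset.sum_comm]
      refine Finset.sum_congr rfl fun a _ => Finset.sum_congr rfl fun b _ => ?_
      have : Tch b a ↔ Tch a b := ⟨Tch.symm, Tch.symm⟩
      simp only [this]
    rw [two_mul, s1]
    nth_rewrite 2 [s2]
    rw [← Finset.sum_add_distrib]
    unfold En
    refine Finset.sum_congr rfl fun a _ => ?_
    rw [← Finset.sum_add_distrib]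
    refine Finset.sum_congr rfl fun b _ => ?_
    split_ifs <;> ring
  rw [e1]
  have e2 : ∀ a ∈ M, f a * ∑ b ∈ M, (if Tch a b then (f a - f b) else 0) ≤
      if a = x then f a else 0 := by
    intro a ha
    by_cases hfa : f a = 0
    · rw [hfa, zero_mul]; split_ifs <;> simp
    have hd := hk_supp n x a hfa
    have hN : M.filter (fun b => Tch a b) = NF ω a := by
      ext b
      rw [Finset.mem_filter, mem_NF]
      refine ⟨fun h => ⟨hMω b h.1, h.2⟩, fun h => ⟨Finset.mem_union_right _ ?_, h.2⟩⟩
      rw [hfin.mem_toFinset]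
      refine ⟨h.1, ?_⟩
      have := h.2.dist_le
      rw [mem_closedBall, dist_comm]
      linarith [dist_triangle x a b]
    rw [← Finset.sum_filter, hN, Finset.sum_sub_distrib, Finset.sum_const, nsmul_eq_mul]
    have h1 := hk_rec n x (hMω a ha)
    have h2 : (NF ω a).card * f a ≤ (NF ω a).card * hk ω (n + 1) x a :=
      mul_le_mul_of_nonneg_left (hk_mono_succ n x a) (Nat.cast_nonneg _)
    rw [h1] at h2
    have h3 : (NF ω a).card * f a - ∑ b ∈ NF ω a, f b ≤ if a = x then 1 else 0 := by linarith
    calc f a * ((NF ω a).card * f a - ∑ b ∈ NF ω a, f b) ≤ f a * (if a = x then 1 else 0) :=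
          mul_le_mul_of_nonneg_left h3 (hk_nonneg n x a)
      _ = _ := by split_ifs <;> simp
  have e3 : ∑ a ∈ M, (if a = x then f a else 0) ≤ f x := by
    rw [Finset.sum_ite_eq']
    split_ifs
    · exact le_rfl
    · exact hk_nonneg n x x
  linarith [Finset.sum_le_sum e2]

/-- Bounded Green function gives transience. -/
lemma transient_of_bdd {x : X} (hx : x ∈ ω.1) {C : ℝ} (hC : ∀ n, hk ω n x x ≤ C) :
    TransientFrom (boolAdj ω) x := by
  classical
  set v : X → ℝ := fun w => ⨆ n, hk ω n x w with hv
  have hlim : ∀ w ∈ ω.1, Filter.Tendsto (fun n => hk ω n x w) Filter.atTop (nhds (v w)) := by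
    intro w hw
    refine tendsto_atTop_ciSup (hk_mono x w) ⟨C, ?_⟩
    rintro _ ⟨n, rfl⟩
    exact (hk_le_diag n x hw).trans (hC n)
  have hrec : ∀ w ∈ ω.1, ∑ b ∈ NF ω w, (v w - v b) = if w = x then 1 else 0 := by
    intro w hw
    have l1 : Filter.Tendsto (fun n => (NF ω w).card * hk ω (n + 1) x w) Filter.atTop
        (nhds ((NF ω w).card * v w)) :=
      ((hlim w hw).comp (Filter.tendsto_add_atTop_nat 1)).const_mul _
    have l2 : Filter.Tendsto (fun n => ∑ b ∈ NF ω w, hk ω n x b + if w = x then (1:ℝ) else 0)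
        Filter.atTop (nhds (∑ b ∈ NF ω w, v b + if w = x then (1:ℝ) else 0)) :=
      (tendsto_finsetSum _ fun b hb => hlim b (mem_NF.1 hb).1).add_const _
    simp only [hk_rec _ x hw] at l1
    have := tendsto_nhds_unique l1 l2
    rw [Finset.sum_sub_distrib, Finset.sum_const, nsmul_eq_mul, this]
    ring
  have adj_symm : ∀ a b, boolAdj ω a b ↔ boolAdj ω b a := by
    have : ∀ a b, boolAdj ω a b → boolAdj ω b a := fun a b h =>
      ⟨h.2.1, h.1, h.2.2.1.symm, by rw [inter_comm]; exact h.2.2.2⟩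
    exact fun a b => ⟨this a b, this b a⟩
  set θ : X → X → ℝ := fun a b => if boolAdj ω a b then v a - v b else 0 with hθ
  have hθN : ∀ a ∈ ω.1, ∀ b ∈ NF ω a, θ a b = v a - v b := by
    intro a ha b hb
    simp only [hθ]
    by_cases hab : a = b
    · subst hab; simp
    · exact if_pos ⟨ha, (mem_NF.1 hb).1, hab, (mem_NF.1 hb).2⟩
  have hθ0 : ∀ a b, b ∉ NF ω a → θ a b = 0 := by
    intro a b hb
    exact if_neg fun h => hb (mem_NF.2 ⟨h.2.1, h.2.2.2⟩)
  have hsum : ∀ a ∈ ω.1, ∑' b, θ a b = if a = x then 1 else 0 := by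
    intro a ha
    rw [tsum_eq_sum (s := NF ω a) (hθ0 a), ← hrec a ha]
    exact Finset.sum_congr rfl (hθN a ha)
  refine ⟨θ, ?_, ?_, ?_, ?_, ?_, ?_⟩
  · intro a b
    simp only [hθ, adj_symm a b]
    split_ifs <;> ring
  · intro a b h
    exact if_neg h
  · intro a
    exact summable_of_ne_finset_zero (s := NF ω a) (hθ0 a)
  · intro a hax
    by_cases ha : a ∈ ω.1
    · rw [hsum a ha, if_neg hax]
    · have : θ a = 0 := by
        funext b
        exact if_neg fun h => ha h.1
      rw [this]; simp
  · rw [hsum x hx, if_pos rfl]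
  · refine summable_of_sum_le (c := 2 * C) (fun p => sq_nonneg _) ?_
    intro s
    set Λ : Finset X := (s.image Prod.fst ∪ s.image Prod.snd).filter (· ∈ ω.1) with hΛ
    have hΛω : ∀ a ∈ Λ, a ∈ ω.1 := fun a ha => (Finset.mem_filter.1 ha).2
    have hE : En Λ v ≤ 2 * C := by
      have l1 : Filter.Tendsto (fun n => En Λ (hk ω n x)) Filter.atTop (nhds (En Λ v)) := by
        unfold En
        refine tendsto_finsetSum _ fun a ha => tendsto_finsetSum _ fun b hb => ?_
        split_ifs
        · exact ((hlim a (hΛω a ha)).sub (hlim b (hΛω b hb))).pow 2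
        · exact tendsto_const_nhds
      refine le_of_tendsto' l1 fun n => (En_hk_le n x hΛω).trans ?_
      linarith [hC n]
    refine le_trans ?_ hE
    unfold En
    rw [← Finset.sum_product']
    have h1 : ∑ p ∈ s, θ p.1 p.2 ^ 2 = ∑ p ∈ s.filter (fun p => boolAdj ω p.1 p.2), θ p.1 p.2 ^ 2 := by
      rw [Finset.sum_filter]
      refine Finset.sum_congr rfl fun p _ => ?_
      by_cases hp : boolAdj ω p.1 p.2
      · rw [if_pos hp]
      · rw [if_neg hp]; simp only [hθ, if_neg hp]; norm_num
    rw [h1]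
    calc ∑ p ∈ s.filter (fun p => boolAdj ω p.1 p.2), θ p.1 p.2 ^ 2
        ≤ ∑ p ∈ s.filter (fun p => boolAdj ω p.1 p.2),
          (if Tch p.1 p.2 then (v p.1 - v p.2) ^ 2 else 0) := by
          refine Finset.sum_le_sum fun p hp => ?_
          have hp := (Finset.mem_filter.1 hp).2
          have ht : Tch p.1 p.2 := hp.2.2.2
          simp only [hθ, if_pos hp, if_pos ht]; exact le_rfl
      _ ≤ _ := by
          refine Finset.sum_le_sum_of_subset_of_nonneg ?_ ?_
          · intro p hp
            have hp' := Finset.mem_filter.1 hp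
            rw [Finset.mem_product]
            refine ⟨Finset.mem_filter.2 ⟨Finset.mem_union_left _ ?_, hp'.2.1⟩,
              Finset.mem_filter.2 ⟨Finset.mem_union_right _ ?_, hp'.2.2.1⟩⟩
            · exact Finset.mem_image_of_mem _ hp'.1
            · exact Finset.mem_image_of_mem _ hp'.1
          · intro p _ _
            split_ifs <;> positivity

lemma transient_adj {x y : X} (hxy : boolAdj ω x y) (h : TransientFrom (boolAdj ω) y) :
    TransientFrom (boolAdj ω) x := by
  classical
  obtain ⟨θ, h1, h2, h3, h4, h5, h6⟩ := h
  have hne : x ≠ y := hxy.2.2.1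
  have hyx : boolAdj ω y x := ⟨hxy.2.1, hxy.1, hne.symm, by rw [inter_comm]; exact hxy.2.2.2⟩
  set η : X → X → ℝ := fun a b => (if a = x ∧ b = y then 1 else 0) -
    (if a = y ∧ b = x then 1 else 0) with hη
  have hηs : ∀ a b, b ∉ ({x, y} : Finset X) → η a b = 0 := by
    intro a b hb
    simp only [Finset.mem_insert, Finset.mem_singleton, not_or] at hb
    simp [hη, hb.1, hb.2]
  have hηsum : ∀ a, Summable (η a) := fun a => summable_of_ne_finset_zero (hηs a)
  have hηt : ∀ a, ∑' b, η a b = (if a = x then 1 else 0) - (if a = y then 1 else 0) := by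
    intro a
    rw [tsum_eq_sum (hηs a), Finset.sum_pair hne]
    simp only [hη]
    by_cases hax : a = x
    · subst hax; simp [hne, hne.symm]
    · by_cases hay : a = y
      · subst hay; simp [hne, hne.symm]
      · simp [hax, hay]
  have hη2 : Summable fun p : X × X => η p.1 p.2 ^ 2 := by
    refine summable_of_ne_finset_zero (s := ({x, y} : Finset X) ×ˢ ({x, y} : Finset X)) ?_
    rintro ⟨a, b⟩ hp
    rw [Finset.mem_product] at hp
    by_cases hb : b ∈ ({x, y} : Finset X)
    · have ha : a ∉ ({x, y} : Finset X) := fun ha => hp ⟨ha, hb⟩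
      simp only [Finset.mem_insert, Finset.mem_singleton, not_or] at ha
      simp [hη, ha.1, ha.2]
    · simp [hηs a b hb]
  refine ⟨fun a b => θ a b + η a b, ?_, ?_, ?_, ?_, ?_, ?_⟩
  · intro a b
    show θ a b + η a b = -(θ b a + η b a)
    rw [h1 a b]
    simp only [hη, and_comm]
    ring
  · intro a b hab
    show θ a b + η a b = 0
    rw [h2 a b hab]
    have n1 : ¬ (a = x ∧ b = y) := by rintro ⟨rfl, rfl⟩; exact hab hxy
    have n2 : ¬ (a = y ∧ b = x) := by rintro ⟨rfl, rfl⟩; exact hab hyx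
    simp [hη, n1, n2]
  · intro a
    exact (h3 a).add (hηsum a)
  · intro a ha
    rw [(h3 a).tsum_add (hηsum a), hηt, if_neg ha]
    by_cases hay : a = y
    · subst hay; rw [h5]; simp
    · rw [h4 a hay]; simp [hay]
  · rw [(h3 x).tsum_add (hηsum x), hηt, h4 x hne]
    simp [hne]
  · refine Summable.of_nonneg_of_le (fun p => sq_nonneg _) (fun p => ?_)
      ((h6.mul_left 2).add (hη2.mul_left 2))
    nlinarith [sq_nonneg (θ p.1 p.2 - η p.1 p.2)]

lemma transient_conn {x y : X} (hxy : Conn ω.1 x y) (h : TransientFrom (boolAdj ω) y) :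
    TransientFrom (boolAdj ω) x := by
  obtain ⟨-, hxy⟩ := hxy
  induction hxy using Relation.ReflTransGen.head_induction_on with
  | refl => exact h
  | @head a c hac _ ih =>
    by_cases hac' : a = c
    · rw [hac']; exact ih
    · exact transient_adj ⟨hac.1, hac.2.1, hac', hac.2.2⟩ ih

lemma NF_mapIso (g : X ≃ᵢ X) (ω : Config X) (a : X) :
    NF (Config.mapIso g ω) (g a) = (NF ω a).map g.toEquiv.toEmbedding := by
  ext b
  obtain ⟨b, rfl⟩ := g.surjective b
  rw [mem_NF, mem_mapIso, Tch.iso]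
  simp [mem_NF]

lemma hk_mapIso (g : X ≃ᵢ X) (ω : Config X) (n : ℕ) (x w : X) :
    hk (Config.mapIso g ω) n (g x) (g w) = hk ω n x w := by
  classical
  induction n generalizing w with
  | zero => rfl
  | succ n ih =>
    rw [hk, hk, NF_mapIso, Finset.sum_map, Finset.card_map]
    have : ∀ b, hk (Config.mapIso g ω) n (g x) (g.toEquiv.toEmbedding b) = hk ω n x b := ih
    simp only [this, g.injective.eq_iff]

variable [ProperSpace X] [MeasurableSpace X] [BorelSpace X] {A : Type*} [MeasurableSpace A]

lemma meas_tsum_real {c : A → Config X} (hc : Measurable c) {f : A → X → ℝ}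
    (hf : Measurable fun p : A × X => f p.1 p.2) (h0 : ∀ a x, 0 ≤ f a x) :
    Measurable fun a => ∑' x : (c a).1, f a x := by
  have h := (meas_tsum hc (f := fun a x => ENNReal.ofReal (f a x)) hf.ennreal_ofReal).ennreal_toReal
  refine meas_congr h ?_
  funext a
  rw [ENNReal.tsum_toReal_eq fun _ => ENNReal.ofReal_ne_top]
  exact tsum_congr fun x => ENNReal.toReal_ofReal (h0 a x)

lemma sum_NF_eq (ω : Config X) (w : X) (f : X → ℝ) [∀ b, Decidable (Tch w b)] :
    ∑ b ∈ NF ω w, f b = ∑' b : ω.1, if Tch w b then f b else 0 := by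
  classical
  rw [tsum_subtype ω.1 (fun b => if Tch w b then f b else 0), tsum_eq_sum (s := NF ω w)]
  · refine Finset.sum_congr rfl fun b hb => ?_
    have hb := mem_NF.1 hb
    rw [indicator_of_mem hb.1, if_pos hb.2]
  · intro b hb
    by_cases hbω : b ∈ ω.1
    · rw [indicator_of_mem hbω, if_neg fun h => hb (mem_NF.2 ⟨hbω, h⟩)]
    · rw [indicator_of_notMem hbω]

lemma meas_sum_NF {c : A → Config X} (hc : Measurable c) {w : A → X} (hw : Measurable w)
    {f : A → X → ℝ} (hf : Measurable fun p : A × X => f p.1 p.2) (h0 : ∀ a x, 0 ≤ f a x) :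
    Measurable fun a => ∑ b ∈ NF (c a) (w a), f a b := by
  classical
  simp only [sum_NF_eq]
  refine meas_tsum_real hc (f := fun a b => if Tch (w a) b then f a b else 0) ?_ ?_
  · exact Measurable.ite (measurableSet_setOfPred.2
      (meas_tch (hw.comp measurable_fst) measurable_snd)) hf measurable_const
  · intro a x
    split_ifs
    · exact h0 a x
    · exact le_rfl

lemma meas_hk (n : ℕ) : Measurable fun p : Config X × X × X => hk p.1 n p.2.1 p.2.2 := by
  classical
  induction n with
  | zero => exact measurable_const
  | succ n ih =>
    simp only [hk]
    refine Measurable.div (Measurable.add ?_ ?_) ?_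
    · refine meas_sum_NF (c := fun p : Config X × X × X => p.1) measurable_fst
        (w := fun p => p.2.2) measurable_snd.snd (f := fun p b => hk p.1 n p.2.1 b) ?_ ?_
      · exact ih.comp (measurable_fst.fst.prodMk (measurable_fst.snd.fst.prodMk measurable_snd))
      · exact fun a b => hk_nonneg _ _ _
    · exact Measurable.ite (measurableSet_setOfPred.2
        (meas_eq measurable_snd.snd measurable_snd.fst)) measurable_const measurable_const
    · have := meas_sum_NF (c := fun p : Config X × X × X => p.1) measurable_fst
        (w := fun p => p.2.2) measurable_snd.snd (f := fun p b => 1) measurable_const (by simp)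
      simpa using this

end Heat

section BKComb

variable {X : Type*} [MetricSpace X] [ProperSpace X] [PreconnectedSpace X] [MeasurableSpace X] [BorelSpace X]

/-- The union of the local components. -/
def Locs (ω : Config X) (r : ℝ) (Q : Finset X) : Set X := {y | ∃ i ∈ Q, y ∈ Loc ω r i}

/-- Existence of a leaf among the trifurcation points. -/
lemma exists_leaf {ω : Config X} {r : ℝ} (hr : 0 ≤ r) {Q : Finset X} (hI : ∀ i ∈ Q, i ∈ ω.1)
    (hne : Q.Nonempty) (hsep : ∀ i ∈ Q, ∀ j ∈ Q, i ≠ j → 2 * r < dist i j) :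
    ∃ i ∈ Q, ∃ i₀, ∀ j ∈ Q, j ≠ i → ∀ l ∈ Loc ω r j, Conn ω.1 i l → Conn (ω.1 \ Loc ω r i) i₀ l := by
  classical
  obtain ⟨i0, hi0⟩ := hne
  have hself : ∀ i ∈ Q, i ∈ Loc ω r i := fun i hi => Conn.refl ⟨hI i hi, mem_closedBall_self hr⟩
  set Q' := Q.filter (fun j => Conn ω.1 i0 j) with hQ'
  have hex : ∀ j ∈ Q', ∃ n, ∃ l ∈ Loc ω r j, W ω.1 n i0 l := by
    intro j hj
    obtain ⟨hj1, hj2⟩ := Finset.mem_filter.1 hj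
    obtain ⟨n, hn⟩ := hj2.exists_w
    exact ⟨n, j, hself j hj1, hn⟩
  let D : X → ℕ := fun j => if h : ∃ n, ∃ l ∈ Loc ω r j, W ω.1 n i0 l then Nat.find h else 0
  have hD1 : ∀ j ∈ Q', ∃ l ∈ Loc ω r j, W ω.1 (D j) i0 l := by
    intro j hj
    have h := hex j hj
    simp only [D, dif_pos h]
    exact Nat.find_spec h
  have hD2 : ∀ j ∈ Q', ∀ n, (∃ l ∈ Loc ω r j, W ω.1 n i0 l) → D j ≤ n := by
    intro j hj n hn
    have h := hex j hj
    simp only [D, dif_pos h]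
    exact Nat.find_min' h hn
  have hi0' : i0 ∈ Q' := Finset.mem_filter.2 ⟨hi0, Conn.refl (hI i0 hi0)⟩
  obtain ⟨i, hi, hmax⟩ := Finset.exists_max_image Q' D ⟨i0, hi0'⟩
  obtain ⟨hi1, hi2⟩ := Finset.mem_filter.1 hi
  refine ⟨i, hi1, i0, fun j hj hji l hl hil => ?_⟩
  have hdis : ∀ l ∈ Loc ω r j, l ∉ Loc ω r i := loc_disjoint (hsep j hj i hi1 hji)
  have hjl : Conn ω.1 j l := Conn.mono inter_subset_left hl
  have hj' : j ∈ Q' := Finset.mem_filter.2 ⟨hj, (hi2.trans hil).trans hjl.symm⟩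
  obtain ⟨l', hl', hw⟩ := hD1 j hj'
  have key : Conn (ω.1 \ Loc ω r i) i0 l' := by
    rcases hw.split (L := Loc ω r i) with h | ⟨q, hq, k, m, hkm, h1, h2⟩
    · exact h.conn
    · exfalso
      have a1 := hD2 i hi k ⟨q, hq, h1⟩
      have a2 := hmax j hj'
      have : m = 0 := by omega
      subst this
      obtain ⟨rfl, -⟩ := h2
      exact hdis _ hl' hq
  exact key.trans (loc_conn_pair hdis _ hl' _ hl)

lemma bk_comb {ω : Config X} {r : ℝ} (hr : 0 ≤ r) (n : ℕ) : ∀ {Q : Finset X}, Q.card = n →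
    (∀ i ∈ Q, Trif ω r i) → (∀ i ∈ Q, ∀ j ∈ Q, i ≠ j → 2 * r < dist i j) →
    ∃ e : Finset X, Q.card ≤ e.card ∧
      (∀ d ∈ e, Inf (ω.1 \ Locs ω r Q) d ∧ ∃ i ∈ Q, Conn ω.1 i d) ∧
      ∀ d ∈ e, ∀ d' ∈ e, d ≠ d' → ¬ Conn (ω.1 \ Locs ω r Q) d d' := by
  classical
  induction n with
  | zero =>
    intro Q hI _ _
    exact ⟨∅, by simp [hI], by simp, by simp⟩
  | succ n ih =>
    intro Q hcard hT hsep
    have hne : Q.Nonempty := by rw [← Finset.card_pos]; omega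
    obtain ⟨i, hi, i0, hleaf⟩ := exists_leaf hr (fun i hi => (hT i hi).1) hne hsep
    set A := Locs ω r Q with hA
    set A' := Locs ω r (Q.erase i) with hA'
    set L := Loc ω r i with hL
    have hiL : i ∈ L := Conn.refl ⟨(hT i hi).1, mem_closedBall_self hr⟩
    have hLA' : ∀ l ∈ L, l ∉ A' := by
      rintro l hl ⟨j, hj, hlj⟩
      rw [Finset.mem_erase] at hj
      exact loc_disjoint (hsep j hj.2 i hi hj.1) l hlj hl
    have hAA' : A' ⊆ A := fun y ⟨j, hj, h⟩ => ⟨j, Finset.mem_of_mem_erase hj, h⟩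
    have hAsub : ∀ y ∈ A, y ∈ L ∨ y ∈ A' := by
      rintro y ⟨j, hj, h⟩
      by_cases hji : j = i
      · subst hji; exact Or.inl h
      · exact Or.inr ⟨j, Finset.mem_erase.2 ⟨hji, hj⟩, h⟩
    obtain ⟨e', he1, he2, he3⟩ := ih (Q := Q.erase i)
      (by rw [Finset.card_erase_of_mem hi]; omega)
      (fun j hj => hT j (Finset.mem_of_mem_erase hj))
      (fun j hj k hk => hsep j (Finset.mem_of_mem_erase hj) k (Finset.mem_of_mem_erase hk))
    rw [← hA'] at he2 he3
    obtain ⟨d1, d2, ⟨c1, c2⟩, ⟨i1, i2⟩, hn, k1, k2⟩ := two_avoid (hT i hi)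
      (K := {k | Conn (ω.1 \ L) i0 k}) (fun k hk k' hk' => (Conn.symm hk).trans hk')
    have hgen : ∀ d, Conn ω.1 i d → Inf (ω.1 \ L) d → (∀ k ∈ {k | Conn (ω.1 \ L) i0 k},
        ¬ Conn (ω.1 \ L) d k) → (∀ y, Conn (ω.1 \ L) d y → y ∉ A') := by
      rintro d hd - hk y hy ⟨j, hj, hyj⟩
      rw [Finset.mem_erase] at hj
      exact hk y (hleaf j hj.2 hj.1 y hyj (hd.trans (hy.mono sdiff_subset))) hy
    have g1 := hgen d1 c1 i1 k1
    have g2 := hgen d2 c2 i2 k2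
    have hinf : ∀ d, Inf (ω.1 \ L) d → (∀ y, Conn (ω.1 \ L) d y → y ∉ A') → Inf (ω.1 \ A) d := by
      intro d hd hg
      refine hd.stay fun y hy => ⟨hy.right.1, fun hyA => ?_⟩
      rcases hAsub y hyA with h | h
      · exact hy.right.2 h
      · exact hg y hy h
    have hadj : ∀ d, Conn ω.1 i d → Inf (ω.1 \ L) d → (∀ y, Conn (ω.1 \ L) d y → y ∉ A') →
        Conn (ω.1 \ A') d i := fun d hd hdi hg =>
      adj_loc (hT i hi).1 hr hd hdi.mem hLA' hg
    have hLsub : L ⊆ A := fun y hy => ⟨i, hi, hy⟩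
    set f := e'.filter (fun d => ¬ Conn (ω.1 \ A') d i) with hf
    have hfcard : e'.card ≤ f.card + 1 := by
      rw [← Finset.card_filter_add_card_filter_not (s := e') (fun d => Conn (ω.1 \ A') d i)]
      have : (e'.filter (fun d => Conn (ω.1 \ A') d i)).card ≤ 1 := by
        rw [Finset.card_le_one]
        intro a ha b hb
        rw [Finset.mem_filter] at ha hb
        by_contra hab
        exact he3 a ha.1 b hb.1 hab (ha.2.trans hb.2.symm)
      rw [add_comm]
      exact add_le_add (le_of_eq (by rw [hf])) this
    have hfA : ∀ d ∈ f, Inf (ω.1 \ A) d := by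
      intro d hd
      obtain ⟨hd1, hd2⟩ := Finset.mem_filter.1 hd
      refine (he2 d hd1).1.stay fun y hy => ⟨hy.right.1, fun hyA => ?_⟩
      rcases hAsub y hyA with h | h
      · exact hd2 (hy.trans (Loc.conn h hLA').symm)
      · exact hy.right.2 h
    have hmono : ω.1 \ A ⊆ ω.1 \ A' := sdiff_subset_sdiff_right hAA'
    have hmonoL : ω.1 \ A ⊆ ω.1 \ L := sdiff_subset_sdiff_right hLsub
    have hfd : ∀ d, Conn (ω.1 \ A') d i → ∀ a ∈ f, ¬ Conn (ω.1 \ A) a d := by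
      intro d hd a ha hh
      exact (Finset.mem_filter.1 ha).2 ((hh.mono hmono).trans hd)
    have a1 := hadj d1 c1 i1 g1
    have a2 := hadj d2 c2 i2 g2
    have j1 := hinf d1 i1 g1
    have j2 := hinf d2 i2 g2
    have hd12 : d1 ≠ d2 := by
      rintro rfl
      exact hn (Conn.refl i1.mem)
    have n1 : d1 ∉ f := fun h => hfd d1 a1 d1 h (Conn.refl j1.mem)
    have n2 : d2 ∉ f := fun h => hfd d2 a2 d2 h (Conn.refl j2.mem)
    refine ⟨insert d1 (insert d2 f), ?_, ?_, ?_⟩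
    · rw [Finset.card_insert_of_notMem (by simp [hd12, n1]), Finset.card_insert_of_notMem n2]
      rw [Finset.card_erase_of_mem hi] at he1
      omega
    · intro d hd
      rw [Finset.mem_insert, Finset.mem_insert] at hd
      rcases hd with rfl | rfl | hd
      · exact ⟨j1, i, hi, c1⟩
      · exact ⟨j2, i, hi, c2⟩
      · obtain ⟨j, hj, hjd⟩ := (he2 d (Finset.mem_filter.1 hd).1).2
        exact ⟨hfA d hd, j, Finset.mem_of_mem_erase hj, hjd⟩
    · have hff : ∀ d ∈ f, ∀ d' ∈ f, d ≠ d' → ¬ Conn (ω.1 \ A) d d' := fun d hd d' hd' hdd h =>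
        he3 d (Finset.mem_filter.1 hd).1 d' (Finset.mem_filter.1 hd').1 hdd (h.mono hmono)
      intro d hd d' hd' hdd h
      rw [Finset.mem_insert, Finset.mem_insert] at hd hd'
      rcases hd with rfl | rfl | hd <;> rcases hd' with rfl | rfl | hd'
      · exact hdd rfl
      · exact hn (h.mono hmonoL)
      · exact hfd _ a1 _ hd' h.symm
      · exact hn (h.mono hmonoL).symm
      · exact hdd rfl
      · exact hfd _ a2 _ hd' h.symm
      · exact hfd _ a1 _ hd h
      · exact hfd _ a2 _ hd h
      · exact hff d hd d' hd' hdd h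

lemma crossing {ω : Config X} {r : ℝ} (hr : 0 ≤ r) {Q : Finset X}
    (hT : ∀ i ∈ Q, i ∈ ω.1) {K : Set X} (hK : K.Finite) (hLK : ∀ i ∈ Q, Loc ω r i ⊆ K) {d : X}
    (hd : Inf (ω.1 \ Locs ω r Q) d) (hi : ∃ i ∈ Q, Conn ω.1 i d) :
    ∃ a b, a ∈ K ∧ b ∉ K ∧ Rel ω.1 a b ∧ Conn (ω.1 \ Locs ω r Q) d b := by
  obtain ⟨i, hi, hid⟩ := hi
  obtain ⟨y, hy, hyK⟩ := hd.exists_notMem_finite hK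
  have hy' : Conn (ω.1 \ Locs ω r Q) d y := hy
  have h1 : Conn ω.1 i y := hid.trans (hy'.mono sdiff_subset)
  rcases h1.exit (fun a => a ∈ K ∨ ¬ Conn (ω.1 \ Locs ω r Q) d a)
    (Or.inl (hLK i hi (Conn.refl ⟨hT i hi, mem_closedBall_self hr⟩))) with h | ⟨c, e, h1, h2, h3⟩
  · rcases h.right.2 with h | h
    · exact absurd h hyK
    · exact absurd hy' h
  · push Not at h3
    refine ⟨c, e, ?_, h3.1, h2, h3.2⟩
    rcases h1.right.2 with h | h
    · exact h
    · by_contra hcK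
      refine h (h3.2.tail ⟨h3.2.right, ⟨h1.right.1, ?_⟩, h2.2.2.symm⟩)
      rintro ⟨j, hj, hcj⟩
      exact hcK (hLK j hj hcj)

lemma crossing_bad {ω : Config X} {r : ℝ} {i : X} {K : Set X} (hi : i ∈ K)
    (hLK : ¬ Loc ω r i ⊆ K) : ∃ a b, a ∈ K ∧ b ∉ K ∧ Rel ω.1 a b ∧ dist a i ≤ r := by
  obtain ⟨l, hl, hlK⟩ := not_subset.1 hLK
  have hl' : Conn (ω.1 ∩ closedBall i r) i l := hl
  rcases hl'.exit (fun a => a ∈ K) hi with h | ⟨c, e, h1, h2, h3⟩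
  · exact absurd h.right.2 hlK
  · exact ⟨c, e, h1.right.2, h3, ⟨h2.1.1, h2.2.1.1, h2.2.2⟩, h1.right.1.2⟩

end BKComb

section BKMeas

variable {X : Type*} [MetricSpace X] [ProperSpace X] [PreconnectedSpace X]
  [MeasurableSpace X] [BorelSpace X]

/-- Coarse-grained adjacency of locations. -/
def J (ω : Config X) (z z' : X) : Prop :=
  ∃ x ∈ ω.1, ∃ x' ∈ ω.1, dist x z ≤ 1/2 ∧ dist x' z' ≤ 1/2 ∧ Tch x x'

lemma J.symm {ω : Config X} {z z' : X} (h : J ω z z') : J ω z' z := by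
  obtain ⟨x, hx, x', hx', h1, h2, h3⟩ := h
  exact ⟨x', hx', x, hx, h2, h1, h3.symm⟩

lemma J.dist_le {ω : Config X} {z z' : X} (h : J ω z z') : dist z z' ≤ 3 := by
  obtain ⟨x, hx, x', hx', h1, h2, h3⟩ := h
  have := h3.dist_le
  rw [dist_comm] at h1
  linarith [dist_triangle4 z x x' z']

lemma J_mapIso (g : X ≃ᵢ X) (ω : Config X) (z z' : X) :
    J (Config.mapIso g ω) (g z) (g z') ↔ J ω z z' := by
  unfold J
  rw [exists_mapIso]
  refine exists_congr fun x => and_congr_right fun _ => ?_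
  rw [exists_mapIso]
  refine exists_congr fun x => and_congr_right fun _ => ?_
  rw [g.isometry.dist_eq, g.isometry.dist_eq, Tch.iso]

lemma meas_J : Measurable fun p : Config X × X × X => J p.1 p.2.1 p.2.2 := by
  unfold J
  refine meas_exists (A := Config X × X × X) measurable_fst
    (p := fun a x => ∃ x' ∈ a.1.1, dist x a.2.1 ≤ 1/2 ∧ dist x' a.2.2 ≤ 1/2 ∧ Tch x x') ?_
  refine meas_exists (A := (Config X × X × X) × X) (c := fun q => q.1.1) measurable_fst.fst
    (p := fun a x' => dist a.2 a.1.2.1 ≤ 1/2 ∧ dist x' a.1.2.2 ≤ 1/2 ∧ Tch a.2 x') ?_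
  exact (meas_le_half measurable_fst.snd measurable_fst.fst.snd.fst _).and
    ((meas_le_half measurable_snd measurable_fst.fst.snd.snd _).and
      (meas_tch measurable_fst.snd measurable_snd))

/-- The crossing set of `K`. -/
def Cross (ω : Config X) (K : Set X) : Set (X × X) := {p | p.1 ∈ K ∧ p.2 ∉ K ∧ J ω p.1 p.2}

lemma measurableSet_cross (ω : Config X) {K : Set X} (hK : MeasurableSet K) :
    MeasurableSet (Cross ω K) := by
  refine measurableSet_setOfPred.2 ?_
  exact (measurableSet_setOfPred.1 (hK.preimage measurable_fst)).and
    ((measurableSet_setOfPred.1 (hK.preimage measurable_snd)).not.and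
      (meas_J.comp (measurable_const.prodMk measurable_id)))

/-- Points of the configuration mostly surrounded by `K`. -/
def Khat (ν : Measure X) (ω : Config X) (K : Set X) : Set X :=
  {x | x ∈ ω.1 ∧ ν (closedBall x (1/2)) / 2 < ν (K ∩ closedBall x (1/2))}

lemma Khat.finite (ν : Measure X) (ω : Config X) {K : Set X} (hK : IsBounded K) :
    (Khat ν ω K).Finite := by
  rcases isEmpty_or_nonempty X with h | ⟨⟨o⟩⟩
  · exact toFinite _
  obtain ⟨R, hR⟩ := hK.subset_closedBall o
  refine ω.finite (fun x hx => hx.1) (isBounded_closedBall.subset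
    (?_ : _ ⊆ closedBall o (R + 1)))
  rintro x ⟨-, hx⟩
  obtain ⟨z, hz1, hz2⟩ := nonempty_of_measure_ne_zero (zero_le.trans_lt hx).ne'
  have h1 : dist z o ≤ R := hR hz1
  rw [mem_closedBall, dist_comm] at hz2
  rw [mem_closedBall]
  linarith [dist_triangle x z o]

variable {o : X} {ν : Measure X}

lemma notMem_Khat (hν : RefMeasure o ν) {ω : Config X} {K : Set X} (hK : MeasurableSet K) {x : X}
    (hx : x ∈ ω.1) (hxK : x ∉ Khat ν ω K) :
    ν (closedBall x (1/2)) / 2 ≤ ν (Kᶜ ∩ closedBall x (1/2)) := by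
  have h1 : ν (K ∩ closedBall x (1/2)) ≤ ν (closedBall x (1/2)) / 2 := by
    by_contra h
    exact hxK ⟨hx, not_le.1 h⟩
  by_contra h
  have h2 := ENNReal.add_lt_add_of_le_of_lt
    ((h1.trans_lt (ENNReal.half_lt_self (hν.pos x _ (by norm_num)).ne' (hν.fin x _).ne)).trans
      (hν.fin x _)).ne h1 (not_le.1 h)
  rw [ENNReal.add_halves, inter_comm K, inter_comm Kᶜ] at h2
  have h3 := measure_inter_add_sdiff (μ := ν) (closedBall x (1/2)) hK
  rw [sdiff_eq] at h3
  exact h2.ne h3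

lemma box_count [SigmaFinite ν] {v : ℝ≥0∞} {E : Set (X × X)} (e : Finset X) (A B : X → Set X)
    (hA : ∀ d ∈ e, v ≤ ν (A d)) (hB : ∀ d ∈ e, v ≤ ν (B d))
    (hAm : ∀ d ∈ e, MeasurableSet (A d)) (hBm : ∀ d ∈ e, MeasurableSet (B d))
    (hE : ∀ d ∈ e, A d ×ˢ B d ⊆ E)
    (hdis : ∀ d ∈ e, ∀ d' ∈ e, d ≠ d' → Disjoint (A d) (A d') ∨ Disjoint (B d) (B d')) :
    e.card * v ^ 2 ≤ (ν.prod ν) E := by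
  calc e.card * v ^ 2 = ∑ d ∈ e, v ^ 2 := by simp
    _ ≤ ∑ d ∈ e, (ν.prod ν) (A d ×ˢ B d) := by
        refine Finset.sum_le_sum fun d hd => ?_
        rw [Measure.prod_prod, sq]
        exact mul_le_mul' (hA d hd) (hB d hd)
    _ = (ν.prod ν) (⋃ d ∈ e, A d ×ˢ B d) := by
        rw [measure_biUnion_finset]
        · intro d hd d' hd' hdd
          exact Set.disjoint_prod.2 (hdis d hd d' hd' hdd)
        · exact fun d hd => (hAm d hd).prod (hBm d hd)
    _ ≤ (ν.prod ν) E := measure_mono (iUnion₂_subset hE)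

lemma bk_finset [SigmaFinite ν] (hsym : PointSymmetric X) (hν : RefMeasure o ν) {ω : Config X}
    {r : ℝ} (hr : 0 ≤ r) {K : Set X} (hK : MeasurableSet K) (hKb : IsBounded K) {Q : Finset X}
    (hT : ∀ i ∈ Q, Trif ω r i) (hQK : ∀ i ∈ Q, i ∈ Khat ν ω K)
    (hsep : ∀ i ∈ Q, ∀ j ∈ Q, i ≠ j → 2 * r + 1 < dist i j) :
    Q.card * (ν (closedBall o (1/4)) / 2) ^ 2 ≤ 2 * (ν.prod ν) (Cross ω K) := by
  classical
  set v := ν (closedBall o (1/4)) / 2 with hv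
  set H := Khat ν ω K with hH
  have hHf : H.Finite := Khat.finite ν ω hKb
  have hin : ∀ a ∈ H, v ≤ ν (K ∩ closedBall a (1/2)) := fun a ha =>
    (ENNReal.div_le_div_right (hν.lower hsym a) 2).trans ha.2.le
  have hout : ∀ b ∈ ω.1, b ∉ H → v ≤ ν (Kᶜ ∩ closedBall b (1/2)) := fun b hb hbH =>
    (ENNReal.div_le_div_right (hν.lower hsym b) 2).trans (notMem_Khat hν hK hb hbH)
  have hmA : ∀ a : X, MeasurableSet (K ∩ closedBall a (1/2)) := fun a =>
    hK.inter isClosed_closedBall.measurableSet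
  have hmB : ∀ a : X, MeasurableSet (Kᶜ ∩ closedBall a (1/2)) := fun a =>
    hK.compl.inter isClosed_closedBall.measurableSet
  have hbox : ∀ a b, Rel ω.1 a b →
      (K ∩ closedBall a (1/2)) ×ˢ (Kᶜ ∩ closedBall b (1/2)) ⊆ Cross ω K := by
    rintro a b ⟨ha, hb, hab⟩ ⟨z, z'⟩ ⟨⟨h1, h2⟩, h3, h4⟩
    refine ⟨h1, h3, a, ha, b, hb, ?_, ?_, hab⟩
    · rw [dist_comm]; exact h2
    · rw [dist_comm]; exact h4
  set Q1 := Q.filter (fun i => Loc ω r i ⊆ H) with hQ1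
  set Q2 := Q.filter (fun i => ¬ Loc ω r i ⊆ H) with hQ2
  have hQc : Q.card = Q1.card + Q2.card :=
    (Finset.card_filter_add_card_filter_not (s := Q) (fun i => Loc ω r i ⊆ H)).symm
  have b1 : Q1.card * v ^ 2 ≤ (ν.prod ν) (Cross ω K) := by
    have hsub : ∀ i ∈ Q1, i ∈ Q := fun i hi => (Finset.mem_filter.1 hi).1
    obtain ⟨e, he1, he2, he3⟩ := bk_comb hr Q1.card (Q := Q1) rfl (fun i hi => hT i (hsub i hi))
      (fun i hi j hj hij => by linarith [hsep i (hsub i hi) j (hsub j hj) hij])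
    have hcr := fun d (hd : d ∈ e) => crossing hr (fun i hi => (hT i (hsub i hi)).1) hHf
      (fun i hi => (Finset.mem_filter.1 hi).2) (he2 d hd).1 (he2 d hd).2
    choose! a b h1 h2 h3 h4 using hcr
    refine le_trans (mul_le_mul_left (by exact_mod_cast he1) _) (box_count e
      (fun d => K ∩ closedBall (a d) (1/2)) (fun d => Kᶜ ∩ closedBall (b d) (1/2))
      (fun d hd => hin _ (h1 d hd)) (fun d hd => hout _ (h3 d hd).2.1 (h2 d hd))
      (fun d _ => hmA _) (fun d _ => hmB _) (fun d hd => hbox _ _ (h3 d hd)) ?_)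
    intro d hd d' hd' hdd
    right
    rw [Set.disjoint_left]
    rintro z ⟨-, hz1⟩ ⟨-, hz2⟩
    rw [mem_closedBall] at hz1 hz2
    have ht : Tch (b d) (b d') := Tch.of_dist (by linarith [dist_triangle_left (b d) (b d') z])
    exact he3 d hd d' hd' hdd (((h4 d hd).tail ⟨(h4 d hd).right, (h4 d' hd').right, ht⟩).trans
      (h4 d' hd').symm)
  have b2 : Q2.card * v ^ 2 ≤ (ν.prod ν) (Cross ω K) := by
    have hcr : ∀ i ∈ Q2, _ := fun i hi => crossing_bad (ω := ω) (r := r)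
      (hQK i (Finset.mem_filter.1 hi).1) (Finset.mem_filter.1 hi).2
    choose! a b h1 h2 h3 h4 using hcr
    refine box_count Q2
      (fun d => K ∩ closedBall (a d) (1/2)) (fun d => Kᶜ ∩ closedBall (b d) (1/2))
      (fun d hd => hin _ (h1 d hd)) (fun d hd => hout _ (h3 d hd).2.1 (h2 d hd))
      (fun d _ => hmA _) (fun d _ => hmB _) (fun d hd => hbox _ _ (h3 d hd)) ?_
    intro d hd d' hd' hdd
    left
    rw [Set.disjoint_left]
    rintro z ⟨-, hz1⟩ ⟨-, hz2⟩
    rw [mem_closedBall] at hz1 hz2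
    have s1 := hsep d (Finset.mem_filter.1 hd).1 d' (Finset.mem_filter.1 hd').1 hdd
    have s2 := h4 d hd
    have s3 := h4 d' hd'
    have s4 := dist_triangle_left d d' z
    have s5 := dist_triangle z (a d) d
    have s6 := dist_triangle z (a d') d'
    linarith
  rw [hQc, two_mul]
  push_cast
  rw [add_mul]
  exact add_le_add b1 b2

lemma exists_separated (F : Finset X) (s : ℝ) : ∃ Q ⊆ F,
    (∀ i ∈ Q, ∀ j ∈ Q, i ≠ j → s < dist i j) ∧ ∀ x ∈ F, ∃ i ∈ Q, dist x i ≤ max s 0 := by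
  classical
  obtain ⟨Q, hQ, hmax⟩ := Finset.exists_max_image
    (F.powerset.filter fun Q => ∀ i ∈ Q, ∀ j ∈ Q, i ≠ j → s < dist i j) Finset.card
    ⟨∅, by simp⟩
  rw [Finset.mem_filter, Finset.mem_powerset] at hQ
  refine ⟨Q, hQ.1, hQ.2, fun x hx => ?_⟩
  by_contra hcon
  push Not at hcon
  have hxQ : x ∉ Q := fun h => by
    have := hcon x h
    rw [dist_self] at this
    exact absurd this (not_lt.2 (le_max_right _ _))
  have hfar : ∀ i ∈ Q, s < dist x i := fun i hi => (le_max_left _ _).trans_lt (hcon i hi)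
  have := hmax (insert x Q) (by
    rw [Finset.mem_filter, Finset.mem_powerset]
    refine ⟨Finset.insert_subset hx hQ.1, fun i hi j hj hij => ?_⟩
    rw [Finset.mem_insert] at hi hj
    rcases hi with rfl | hi <;> rcases hj with rfl | hj
    · exact absurd rfl hij
    · exact hfar j hj
    · rw [dist_comm]; exact hfar i hi
    · exact hQ.2 i hi j hj hij)
  rw [Finset.card_insert_of_notMem hxQ] at this
  omega

/-- The Burton--Keane constant. -/
def CBK (ν : Measure X) (o : X) (r : ℝ) : ℝ≥0∞ :=
  2 * ((ν (closedBall o (1/4)) / 2) ^ 2)⁻¹ * ν (closedBall o (2 * r + 3)) +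
    (ν (closedBall o (1/4)) / 2)⁻¹

lemma CBK_ne_top (hν : RefMeasure o ν) (r : ℝ) : CBK ν o r ≠ ⊤ := by
  have h1 : ν (closedBall o (1/4)) / 2 ≠ 0 :=
    (ENNReal.half_pos (hν.pos o _ (by norm_num)).ne').ne'
  refine ENNReal.add_ne_top.2 ⟨ENNReal.mul_ne_top (ENNReal.mul_ne_top (by simp) ?_)
    (hν.fin _ _).ne, ENNReal.inv_ne_top.2 h1⟩
  exact ENNReal.inv_ne_top.2 (pow_ne_zero 2 h1)

lemma bk_set [SigmaFinite ν] (hsym : PointSymmetric X) (hν : RefMeasure o ν) {ω : Config X}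
    {r : ℝ} (hr : 0 ≤ r) {K : Set X} (hK : MeasurableSet K) (hKb : IsBounded K) {T : Set X}
    (hT : ∀ i ∈ T, Trif ω r i) :
    ν {z | z ∈ K ∧ ∃ x ∈ T, dist x z ≤ 1/2} ≤ CBK ν o r * (ν.prod ν) (Cross ω K) := by
  classical
  set v := ν (closedBall o (1/4)) / 2 with hv
  have hv0 : v ≠ 0 := (ENNReal.half_pos (hν.pos o _ (by norm_num)).ne').ne'
  have hvt : v ≠ ⊤ := (ENNReal.div_lt_top (hν.fin _ _).ne (by simp)).ne
  set H := Khat ν ω K with hH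
  have hHf : H.Finite := Khat.finite ν ω hKb
  have hF : (T ∩ H).Finite := hHf.subset inter_subset_right
  obtain ⟨Q, hQF, hsep, hcov⟩ := exists_separated hF.toFinset (2 * r + 1)
  have hQ : ∀ i ∈ Q, i ∈ T ∧ i ∈ H := fun i hi => hF.mem_toFinset.1 (hQF hi)
  have hcard := bk_finset hsym hν hr hK hKb (fun i hi => hT i (hQ i hi).1)
    (fun i hi => (hQ i hi).2) hsep
  have hsub : {z | z ∈ K ∧ ∃ x ∈ T, dist x z ≤ 1/2} ⊆
      (⋃ i ∈ Q, closedBall i (2 * r + 2)) ∪ {z | v ≤ ∫⁻ z', (Cross ω K).indicator 1 (z, z') ∂ν} := by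
    rintro z ⟨hzK, x, hxT, hxz⟩
    by_cases hxH : x ∈ H
    · left
      obtain ⟨i, hi, hxi⟩ := hcov x (hF.mem_toFinset.2 ⟨hxT, hxH⟩)
      rw [max_eq_left (by linarith)] at hxi
      simp only [mem_iUnion]
      refine ⟨i, hi, ?_⟩
      rw [mem_closedBall]
      linarith [dist_triangle_left z i x]
    · right
      have hx : x ∈ ω.1 := (hT x hxT).1
      change v ≤ _
      refine ((ENNReal.div_le_div_right (hν.lower hsym x) 2).trans
        (notMem_Khat hν hK hx hxH)).trans ?_
      rw [← lintegral_indicator_one (hK.compl.inter isClosed_closedBall.measurableSet)]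
      refine lintegral_mono fun z' => ?_
      by_cases hz' : z' ∈ Kᶜ ∩ closedBall x (1/2)
      · have hc : (z, z') ∈ Cross ω K :=
          ⟨hzK, hz'.1, x, hx, x, hx, hxz, by rw [dist_comm]; exact hz'.2, Tch.refl x⟩
        rw [indicator_of_mem hz', indicator_of_mem hc]
        rfl
      · rw [indicator_of_notMem hz']
        exact zero_le
  refine (measure_mono hsub).trans ((measure_union_le _ _).trans ?_)
  rw [CBK, add_mul]
  refine add_le_add ?_ ?_
  · calc ν (⋃ i ∈ Q, closedBall i (2 * r + 2)) ≤ ∑ i ∈ Q, ν (closedBall i (2 * r + 2)) :=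
          measure_biUnion_finset_le _ _
      _ ≤ ∑ i ∈ Q, ν (closedBall o (2 * r + 3)) := by
          refine Finset.sum_le_sum fun i _ => (hν.upper hsym i _).trans (le_of_eq ?_)
          congr 2; ring
      _ = Q.card * ν (closedBall o (2 * r + 3)) := by simp
      _ ≤ (2 * (ν.prod ν) (Cross ω K) * (v ^ 2)⁻¹) * ν (closedBall o (2 * r + 3)) := by
          refine mul_le_mul_left ?_ _
          rw [← div_eq_mul_inv, ENNReal.le_div_iff_mul_le (Or.inl (pow_ne_zero 2 hv0))
            (Or.inl (ENNReal.pow_ne_top hvt))]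
          exact hcard
      _ = _ := by ring
  · have hm : Measurable ((Cross ω K).indicator (1 : X × X → ℝ≥0∞)) :=
      measurable_one.indicator (measurableSet_cross ω hK)
    have h1 := mul_meas_ge_le_lintegral (μ := ν)
      (f := fun z => ∫⁻ z', (Cross ω K).indicator 1 (z, z') ∂ν) hm.lintegral_prod_right' v
    have h2 : ∫⁻ z, ∫⁻ z', (Cross ω K).indicator 1 (z, z') ∂ν ∂ν = (ν.prod ν) (Cross ω K) := by
      rw [← lintegral_indicator_one (measurableSet_cross ω hK), lintegral_prod _ hm.aemeasurable]
    rw [h2] at h1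
    rw [mul_comm, ← div_eq_mul_inv, ENNReal.le_div_iff_mul_le (Or.inl hv0) (Or.inl hvt), mul_comm]
    exact h1

/-- The Burton--Keane inequality for functions. -/
lemma bk_fun [SigmaFinite ν] (hsym : PointSymmetric X) (hν : RefMeasure o ν) {ω : Config X}
    {r : ℝ} (hr : 0 ≤ r) {T : Set X} (hT : ∀ i ∈ T, Trif ω r i) {g : X → ℝ} (hg : Measurable g)
    (hg0 : ∀ z, 0 ≤ g z) {R : ℝ} (hgR : ∀ z, g z ≠ 0 → z ∈ closedBall o R) :
    ∫⁻ z in {z | ∃ x ∈ T, dist x z ≤ 1/2}, ENNReal.ofReal (g z) ∂ν ≤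
      CBK ν o r * ∫⁻ z, ∫⁻ z', {p : X × X | J ω p.1 p.2}.indicator
        (fun p => ENNReal.ofReal (g p.1 - g p.2)) (z, z') ∂ν ∂ν := by
  have hJm : MeasurableSet {p : X × X | J ω p.1 p.2} :=
    measurableSet_setOfPred.2 (meas_J.comp (measurable_const.prodMk measurable_id))
  have hlt : ∀ t : ℝ, MeasurableSet {z | t < g z} := fun t => measurableSet_lt measurable_const hg
  have hE : MeasurableSet {q : ℝ × X × X | q.2 ∈ Cross ω {z | q.1 < g z}} := by
    refine measurableSet_setOfPred.2 ?_
    refine (measurableSet_setOfPred.1 (measurableSet_lt measurable_fst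
      (hg.comp measurable_snd.fst))).and ((measurableSet_setOfPred.1 (measurableSet_lt measurable_fst
      (hg.comp measurable_snd.snd))).not.and (measurableSet_setOfPred.1 (hJm.preimage measurable_snd)))
  rw [lintegral_eq_lintegral_meas_lt _ (Filter.Eventually.of_forall hg0) hg.aemeasurable]
  calc ∫⁻ t in Ioi (0:ℝ), (ν.restrict {z | ∃ x ∈ T, dist x z ≤ 1/2}) {a | t < g a}
      ≤ ∫⁻ t in Ioi (0:ℝ), CBK ν o r * (ν.prod ν) (Cross ω {z | t < g z}) := by
        refine setLIntegral_mono' measurableSet_Ioi fun t ht => ?_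
        rw [Measure.restrict_apply (hlt t)]
        refine bk_set hsym hν hr (hlt t) (isBounded_closedBall.subset
          (fun z hz => hgR z ?_)) hT
        have h1 : t < g z := hz
        have h2 : 0 < t := ht
        linarith
    _ = CBK ν o r * ∫⁻ t in Ioi (0:ℝ), (ν.prod ν) (Cross ω {z | t < g z}) :=
        lintegral_const_mul' _ _ (CBK_ne_top hν r)
    _ = CBK ν o r * ∫⁻ t in Ioi (0:ℝ), ∫⁻ p, {q : ℝ × X × X | q.2 ∈ Cross ω {z | q.1 < g z}}.indicator
          (1 : ℝ × X × X → ℝ≥0∞) (t, p) ∂(ν.prod ν) := by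
        congr 1
        refine lintegral_congr fun t => ?_
        rw [← lintegral_indicator_one (measurableSet_cross ω (hlt t))]
        rfl
    _ = CBK ν o r * ∫⁻ p, (∫⁻ t in Ioi (0:ℝ),
          {q : ℝ × X × X | q.2 ∈ Cross ω {z | q.1 < g z}}.indicator
          (1 : ℝ × X × X → ℝ≥0∞) (t, p)) ∂(ν.prod ν) := by
        congr 1
        exact lintegral_lintegral_swap (f := fun t p =>
          {q : ℝ × X × X | q.2 ∈ Cross ω {z | q.1 < g z}}.indicator
          (1 : ℝ × X × X → ℝ≥0∞) (t, p)) (measurable_one.indicator hE).aemeasurable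
    _ ≤ CBK ν o r * ∫⁻ p, {p : X × X | J ω p.1 p.2}.indicator
        (fun p => ENNReal.ofReal (g p.1 - g p.2)) p ∂(ν.prod ν) := by
        refine mul_le_mul_right (lintegral_mono fun p => ?_) _
        refine (setLIntegral_le_lintegral _ _).trans ?_
        by_cases hp : J ω p.1 p.2
        · rw [indicator_of_mem (show p ∈ {p : X × X | J ω p.1 p.2} from hp), ← Real.volume_Ico,
            ← lintegral_indicator_one measurableSet_Ico]
          refine lintegral_mono fun t => ?_
          by_cases ht : (t, p) ∈ {q : ℝ × X × X | q.2 ∈ Cross ω {z | q.1 < g z}}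
          · have h2 : ¬ t < g p.2 := ht.2.1
            have h1 : t < g p.1 := ht.1
            rw [indicator_of_mem ht, indicator_of_mem (show t ∈ Ico (g p.2) (g p.1) from
              ⟨not_lt.1 h2, h1⟩)]
            rfl
          · rw [indicator_of_notMem ht]; exact zero_le
        · have : ∀ t, {q : ℝ × X × X | q.2 ∈ Cross ω {z | q.1 < g z}}.indicator
              (1 : ℝ × X × X → ℝ≥0∞) (t, p) = 0 := fun t =>
            indicator_of_notMem (fun h => hp h.2.2) _
          simp [this]
    _ = _ := by
        rw [lintegral_prod]
        refine (Measurable.indicator ?_ hJm).aemeasurable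
        exact ((hg.comp measurable_fst).sub (hg.comp measurable_snd)).ennreal_ofReal

end BKMeas

section L1

lemma l1_lemma {ι : Type*} (m : ι → ℝ≥0∞) (a b : ι → ℝ) {A B κ η : ℝ} (hκ : 0 < κ) (hη : 0 < η)
    (hA0 : 0 ≤ A) (hB0 : 0 ≤ B) (hA : ∑' i, m i * ENNReal.ofReal (a i ^ 2) = ENNReal.ofReal A)
    (hB : ∑' i, m i * ENNReal.ofReal (b i ^ 2) = ENNReal.ofReal B) :
    ∑' i, m i * ENNReal.ofReal (a i ^ 2 / max A κ - b i ^ 2 / max B κ) ≤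
      ENNReal.ofReal (1 / (κ * η)) * ∑' i, m i * ENNReal.ofReal ((a i - b i) ^ 2)
        + ENNReal.ofReal (4 * η) := by
  set α := max A κ with hα
  set β := max B κ with hβ
  set γ := max α β with hγ
  have hακ : κ ≤ α := le_max_right _ _
  have hβκ : κ ≤ β := le_max_right _ _
  have hAα : A ≤ α := le_max_left _ _
  have hBβ : B ≤ β := le_max_left _ _
  have hαγ : α ≤ γ := le_max_left _ _
  have hβγ : β ≤ γ := le_max_right _ _
  have hα0 : 0 < α := hκ.trans_le hακ
  have hβ0 : 0 < β := hκ.trans_le hβκ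
  have hγ0 : 0 < γ := hα0.trans_le hαγ
  set D := ∑' i, m i * ENNReal.ofReal |a i ^ 2 - b i ^ 2| with hD
  set S := ∑' i, m i * ENNReal.ofReal ((a i - b i) ^ 2) with hS
  set e : ℝ := max (β - α) 0 / (α * β) with he
  have he0 : 0 ≤ e := by positivity
  -- `B - A ≤ D`
  have hBA : ENNReal.ofReal (B - A) ≤ D := by
    rw [ENNReal.ofReal_sub _ hA0, tsub_le_iff_left, ← hA, ← hB, hD, ← ENNReal.tsum_add]
    refine ENNReal.tsum_le_tsum fun i => ?_
    rw [← mul_add, ← ENNReal.ofReal_add (by positivity) (by positivity)]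
    refine mul_le_mul_right (ENNReal.ofReal_le_ofReal ?_) _
    linarith [neg_abs_le (a i ^ 2 - b i ^ 2)]
  have hpt : ∀ i, a i ^ 2 / α - b i ^ 2 / β ≤ (1/γ) * |a i ^ 2 - b i ^ 2| + e * a i ^ 2 := by
    intro i
    have hx := sq_nonneg (a i)
    have hy := sq_nonneg (b i)
    rcases le_or_gt β α with h | h
    · have hg : γ = α := max_eq_left h
      have h1 : b i ^ 2 / α ≤ b i ^ 2 / β := div_le_div_of_nonneg_left hy hβ0 h
      have h2 : (1/γ) * (a i ^ 2 - b i ^ 2) ≤ (1/γ) * |a i ^ 2 - b i ^ 2| :=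
        mul_le_mul_of_nonneg_left (le_abs_self _) (by positivity)
      have h3 : (1/γ) * (a i ^ 2 - b i ^ 2) = a i ^ 2 / α - b i ^ 2 / α := by rw [hg]; ring
      have h4 : 0 ≤ e * a i ^ 2 := by positivity
      linarith
    · have hg : γ = β := max_eq_right h.le
      have h2 : (1/γ) * (a i ^ 2 - b i ^ 2) ≤ (1/γ) * |a i ^ 2 - b i ^ 2| :=
        mul_le_mul_of_nonneg_left (le_abs_self _) (by positivity)
      have h3 : a i ^ 2 / α - b i ^ 2 / β = (1/γ) * (a i ^ 2 - b i ^ 2) + e * a i ^ 2 := by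
        rw [hg, he, max_eq_left (by linarith)]
        field_simp
        ring
      linarith
  have heA : ENNReal.ofReal e * ENNReal.ofReal A ≤ ENNReal.ofReal (1/γ) * D := by
    rw [← ENNReal.ofReal_mul he0]
    rcases le_or_gt β α with h | h
    · rw [he, max_eq_right (by linarith)]; simp
    · have hg : γ = β := max_eq_right h.le
      have hb : β = B := by
        rcases max_choice B κ with h1 | h1
        · rw [hβ, h1]
        · rw [← hβ] at h1; linarith
      refine le_trans ?_ (mul_le_mul_right hBA _)
      rw [← ENNReal.ofReal_mul (by positivity)]
      refine ENNReal.ofReal_le_ofReal ?_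
      rw [he, max_eq_left (by linarith), hg]
      have h5 : (β - α) / (α * β) * A ≤ (β - α) / (α * β) * α :=
        mul_le_mul_of_nonneg_left hAα (div_nonneg (by linarith) (by positivity))
      have h6 : (β - α) / (α * β) * α = 1 / β * (β - α) := by field_simp
      have h7 : 1 / β * (β - α) ≤ 1 / β * (B - A) :=
        mul_le_mul_of_nonneg_left (by linarith) (by positivity)
      linarith
  have hsum1 : ∑' i, m i * ENNReal.ofReal (a i ^ 2 / α - b i ^ 2 / β) ≤
      ENNReal.ofReal (1/γ) * D + ENNReal.ofReal e * ENNReal.ofReal A := by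
    rw [hD, ← hA, ← ENNReal.tsum_mul_left, ← ENNReal.tsum_mul_left, ← ENNReal.tsum_add]
    refine ENNReal.tsum_le_tsum fun i => ?_
    rw [mul_left_comm _ (m i), mul_left_comm _ (m i), ← mul_add,
      ← ENNReal.ofReal_mul (by positivity), ← ENNReal.ofReal_mul he0,
      ← ENNReal.ofReal_add (by positivity) (by positivity)]
    exact mul_le_mul_right (ENNReal.ofReal_le_ofReal (hpt i)) _
  have hDle : D ≤ ENNReal.ofReal (1 / (2 * η)) * S + ENNReal.ofReal (η * (A + B)) := by
    have : ENNReal.ofReal (η * (A + B)) = ENNReal.ofReal η * ∑' i, m i * ENNReal.ofReal (a i ^ 2)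
        + ENNReal.ofReal η * ∑' i, m i * ENNReal.ofReal (b i ^ 2) := by
      rw [hA, hB, mul_add, ENNReal.ofReal_add (by positivity) (by positivity),
        ENNReal.ofReal_mul hη.le, ENNReal.ofReal_mul hη.le]
    rw [this, hD, hS]
    simp only [← ENNReal.tsum_mul_left, ← ENNReal.tsum_add]
    refine ENNReal.tsum_le_tsum fun i => ?_
    rw [mul_left_comm _ (m i), mul_left_comm _ (m i), mul_left_comm _ (m i), ← mul_add, ← mul_add,
      ← ENNReal.ofReal_mul (by positivity), ← ENNReal.ofReal_mul hη.le, ← ENNReal.ofReal_mul hη.le,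
      ← ENNReal.ofReal_add (by positivity) (by positivity),
      ← ENNReal.ofReal_add (by positivity) (by positivity)]
    refine mul_le_mul_right (ENNReal.ofReal_le_ofReal ?_) _
    have key : ∀ s t : ℝ, s * t ≤ 1 / (2 * η) * s ^ 2 + η / 2 * t ^ 2 := by
      intro s t
      have : 1 / (2 * η) * s ^ 2 + η / 2 * t ^ 2 - s * t = 1 / (2 * η) * (s - η * t) ^ 2 := by
        field_simp; ring
      have h2 : 0 ≤ 1 / (2 * η) * (s - η * t) ^ 2 := by positivity
      linarith
    have hq : η / 2 * (a i + b i) ^ 2 ≤ η * a i ^ 2 + η * b i ^ 2 := by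
      nlinarith [sq_nonneg (a i - b i)]
    rw [abs_le]
    constructor
    · have := key (b i - a i) (a i + b i)
      have h3 : (b i - a i) ^ 2 = (a i - b i) ^ 2 := by ring
      rw [h3] at this
      linarith
    · have := key (a i - b i) (a i + b i)
      linarith
  calc _ ≤ ENNReal.ofReal (1/γ) * D + ENNReal.ofReal (1/γ) * D :=
        hsum1.trans (add_le_add_right heA _)
    _ = ENNReal.ofReal (2/γ) * D := by
        rw [← add_mul, ← ENNReal.ofReal_add (by positivity) (by positivity)]
        congr 2; ring
    _ ≤ ENNReal.ofReal (2/γ) * (ENNReal.ofReal (1 / (2 * η)) * S + ENNReal.ofReal (η * (A + B))) :=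
        mul_le_mul_right hDle _
    _ ≤ _ := by
        rw [mul_add, ← mul_assoc, ← ENNReal.ofReal_mul (by positivity),
          ← ENNReal.ofReal_mul (by positivity)]
        refine add_le_add (mul_le_mul_left (ENNReal.ofReal_le_ofReal ?_) _)
          (ENNReal.ofReal_le_ofReal ?_)
        · have : 2 / γ * (1 / (2 * η)) = 1 / (γ * η) := by field_simp
          rw [this]
          exact one_div_le_one_div_of_le (by positivity)
            (mul_le_mul_of_nonneg_right (hακ.trans hαγ) hη.le)
        · have h1 : η * (A + B) ≤ η * (2 * γ) := mul_le_mul_of_nonneg_left (by linarith) hη.le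
          have h2 : 2 / γ * (η * (A + B)) ≤ 2 / γ * (η * (2 * γ)) :=
            mul_le_mul_of_nonneg_left h1 (by positivity)
          have h3 : 2 / γ * (η * (2 * γ)) = 4 * η := by field_simp; ring
          linarith

end L1

section Weights

variable {X : Type*} [MetricSpace X] [ProperSpace X] [PreconnectedSpace X]
  [MeasurableSpace X] [BorelSpace X]

lemma tsum_mapIso (g : X ≃ᵢ X) (ω : Config X) (f : X → ℝ≥0∞) :
    ∑' y : (Config.mapIso g ω).1, f y = ∑' y : ω.1, f (g y) :=
  tsum_image (f := f) (s := ω.1) (g := g) g.injective.injOn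

lemma lintegral_iso {o : X} {ν : Measure X} (hν : RefMeasure o ν) (g : X ≃ᵢ X) {f : X → ℝ≥0∞}
    (hf : Measurable f) : ∫⁻ z, f z ∂ν = ∫⁻ z, f (g z) ∂ν := by
  conv_lhs => rw [← hν.inv g]
  rw [lintegral_map hf g.continuous.measurable]

/-- `y` is a good point (large return kernel) close to `t`. -/
def Gd (n : ℕ) (M : ℝ) (ω : Config X) (t y : X) : Prop := M ≤ hk ω n y y ∧ dist y t ≤ 1/2

lemma Gd_mapIso (n : ℕ) (M : ℝ) (g : X ≃ᵢ X) (ω : Config X) (t y : X) :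
    Gd n M (Config.mapIso g ω) (g t) (g y) ↔ Gd n M ω t y := by
  unfold Gd
  rw [hk_mapIso, g.isometry.dist_eq]

lemma meas_diag (n : ℕ) (M : ℝ) {A : Type*} [MeasurableSpace A] {c : A → Config X}
    (hc : Measurable c) {f : A → X} (hf : Measurable f) :
    Measurable fun a => M ≤ hk (c a) n (f a) (f a) := by
  have h : Measurable fun a => hk (c a) n (f a) (f a) :=
    (meas_hk n).comp (hc.prodMk (hf.prodMk hf))
  exact measurableSet_setOfPred.1 (measurableSet_le measurable_const h)

lemma meas_Gd (n : ℕ) (M : ℝ) :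
    Measurable fun p : Config X × X × X => Gd n M p.1 p.2.1 p.2.2 :=
  (meas_diag n M measurable_fst measurable_snd.snd).and
    (meas_le_half measurable_snd.snd measurable_snd.fst _)

open Classical in
/-- The number of good points close to `t`. -/
def cnt (n : ℕ) (M : ℝ) (ω : Config X) (t : X) : ℝ≥0∞ :=
  ∑' y : ω.1, if Gd n M ω t y then 1 else 0

open Classical in
/-- The uniform weight on the good points close to `t`. -/
def wt (n : ℕ) (M : ℝ) (ω : Config X) (t y : X) : ℝ≥0∞ :=
  if Gd n M ω t y then (cnt n M ω t)⁻¹ else 0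

lemma meas_cnt (n : ℕ) (M : ℝ) : Measurable fun p : Config X × X => cnt n M p.1 p.2 := by
  classical
  unfold cnt
  refine meas_tsum (A := Config X × X) (c := fun p => p.1) measurable_fst
    (f := fun p y => if Gd n M p.1 p.2 y then 1 else 0) ?_
  refine Measurable.ite (measurableSet_setOfPred.2 ?_) measurable_const measurable_const
  exact (meas_Gd n M).comp (measurable_fst.fst.prodMk (measurable_fst.snd.prodMk measurable_snd))

lemma meas_wt (n : ℕ) (M : ℝ) :
    Measurable fun p : Config X × X × X => wt n M p.1 p.2.1 p.2.2 := by
  classical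
  refine Measurable.ite (measurableSet_setOfPred.2 (meas_Gd n M)) ?_ measurable_const
  exact ((meas_cnt n M).comp (measurable_fst.prodMk measurable_snd.fst)).inv

lemma cnt_mapIso (n : ℕ) (M : ℝ) (g : X ≃ᵢ X) (ω : Config X) (t : X) :
    cnt n M (Config.mapIso g ω) (g t) = cnt n M ω t := by
  classical
  unfold cnt
  rw [tsum_mapIso g ω (fun y => if Gd n M (Config.mapIso g ω) (g t) y then 1 else 0)]
  refine tsum_congr fun y => ?_
  by_cases h : Gd n M ω t y
  · rw [if_pos h, if_pos ((Gd_mapIso n M g ω t y).2 h)]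
  · rw [if_neg h, if_neg (fun hh => h ((Gd_mapIso n M g ω t y).1 hh))]

lemma wt_mapIso (n : ℕ) (M : ℝ) (g : X ≃ᵢ X) (ω : Config X) (t y : X) :
    wt n M (Config.mapIso g ω) (g t) (g y) = wt n M ω t y := by
  classical
  unfold wt
  rw [cnt_mapIso]
  by_cases h : Gd n M ω t y
  · rw [if_pos h, if_pos ((Gd_mapIso n M g ω t y).2 h)]
  · rw [if_neg h, if_neg (fun hh => h ((Gd_mapIso n M g ω t y).1 hh))]

lemma tsum_wt (n : ℕ) (M : ℝ) (ω : Config X) (t : X) :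
    ∑' y : ω.1, wt n M ω t y = cnt n M ω t * (cnt n M ω t)⁻¹ := by
  classical
  conv_rhs => rw [cnt, ← ENNReal.tsum_mul_right]
  refine tsum_congr fun y => ?_
  unfold wt
  by_cases h : Gd n M ω t y
  · rw [if_pos h, if_pos h, one_mul]; rfl
  · rw [if_neg h, if_neg h, zero_mul]

lemma tsum_wt_le (n : ℕ) (M : ℝ) (ω : Config X) (t : X) : ∑' y : ω.1, wt n M ω t y ≤ 1 := by
  rw [tsum_wt]; exact ENNReal.mul_inv_le_one _

lemma cnt_ne_top (n : ℕ) (M : ℝ) (ω : Config X) (t : X) : cnt n M ω t ≠ ⊤ := by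
  classical
  have hf : {y : ω.1 | dist (y : X) t ≤ 1/2}.Finite := by
    have h := ω.2 (closedBall t (1/2)) isBounded_closedBall
    refine Finite.of_finite_image (f := Subtype.val) (h.subset ?_) Subtype.val_injective.injOn
    rintro _ ⟨y, hy, rfl⟩
    exact ⟨y.2, hy⟩
  unfold cnt
  rw [tsum_eq_sum (s := hf.toFinset)]
  · refine (ENNReal.sum_lt_top.2 fun y _ => ?_).ne
    split_ifs <;> simp
  · intro y hy
    rw [if_neg]
    intro h
    exact hy (hf.mem_toFinset.2 h.2)

lemma tsum_wt_eq (n : ℕ) (M : ℝ) (ω : Config X) (t : X) {x : X} (hx : x ∈ ω.1)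
    (h : Gd n M ω t x) : ∑' y : ω.1, wt n M ω t y = 1 := by
  classical
  rw [tsum_wt]
  refine ENNReal.mul_inv_cancel ?_ (cnt_ne_top n M ω t)
  unfold cnt
  intro h0
  have := ENNReal.tsum_eq_zero.1 h0 ⟨x, hx⟩
  rw [if_pos h] at this
  exact one_ne_zero this

lemma wt_eq_zero {n : ℕ} {M : ℝ} {ω : Config X} {t y : X} (h : ¬ Gd n M ω t y) :
    wt n M ω t y = 0 := by
  classical
  unfold wt; rw [if_neg h]

lemma wt_le_one {n : ℕ} {M : ℝ} {ω : Config X} {t y : X} (hy : y ∈ ω.1) : wt n M ω t y ≤ 1 :=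
  (ENNReal.le_tsum (f := fun y : ω.1 => wt n M ω t y) ⟨y, hy⟩).trans (tsum_wt_le n M ω t)

/-- Total mass received by `y`. -/
def ms (ν : Measure X) (n : ℕ) (M : ℝ) (ω : Config X) (y : X) : ℝ≥0∞ := ∫⁻ t, wt n M ω t y ∂ν

variable {o : X} {ν : Measure X}

lemma meas_ms (ν : Measure X) [SFinite ν] (n : ℕ) (M : ℝ) :
    Measurable fun p : Config X × X => ms ν n M p.1 p.2 := by
  have h : Measurable fun q : (Config X × X) × X => wt n M q.1.1 q.2 q.1.2 :=
    (meas_wt n M).comp (measurable_fst.fst.prodMk (measurable_snd.prodMk measurable_fst.snd))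
  exact h.lintegral_prod_right' (ν := ν)

lemma ms_mapIso (hν : RefMeasure o ν) (n : ℕ) (M : ℝ) (g : X ≃ᵢ X) (ω : Config X) (y : X) :
    ms ν n M (Config.mapIso g ω) (g y) = ms ν n M ω y := by
  unfold ms
  rw [lintegral_iso hν g]
  · exact lintegral_congr fun t => wt_mapIso n M g ω t y
  · exact (meas_wt n M).comp (measurable_const.prodMk (measurable_id.prodMk measurable_const))

lemma ms_eq_zero {n : ℕ} {M : ℝ} {ω : Config X} {y : X} (h : ¬ M ≤ hk ω n y y) :
    ms ν n M ω y = 0 := by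
  unfold ms
  rw [lintegral_congr fun t => wt_eq_zero (fun hh => h hh.1)]
  simp

lemma tsum_ms [SFinite ν] (n : ℕ) (M : ℝ) (ω : Config X) (f : X → ℝ≥0∞) :
    ∑' y : ω.1, ms ν n M ω y * f y = ∫⁻ t, ∑' y : ω.1, wt n M ω t y * f y ∂ν := by
  have hm : ∀ y : X, Measurable fun t => wt n M ω t y := fun y =>
    (meas_wt n M).comp (measurable_const.prodMk (measurable_id.prodMk measurable_const))
  rw [lintegral_tsum fun y : ω.1 => ((hm y).mul_const _).aemeasurable]
  refine tsum_congr fun y => ?_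
  rw [lintegral_mul_const _ (hm y)]
  rfl

/-- Mass transport for the weights. -/
lemma mtp1 [SFinite ν] (hν : RefMeasure o ν) {P : Measure (Config X)} [IsProbabilityMeasure P]
    (hP : IsoInvariant P) (n : ℕ) (M : ℝ) {k : Config X → X → X → ℝ≥0∞}
    (hk : Measurable fun p : Config X × X × X => k p.1 p.2.1 p.2.2)
    (hki : ∀ (g : X ≃ᵢ X) ω a b, k (Config.mapIso g ω) (g a) (g b) = k ω a b) :
    ∫⁻ ω, ∑' y : ω.1, wt n M ω o y * ∫⁻ z, k ω y z ∂ν ∂P =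
      ∫⁻ ω, ∑' y : ω.1, ms ν n M ω y * k ω y o ∂P := by
  have h := mtp hν hP (F := fun ω t z => ∑' y : ω.1, wt n M ω t y * k ω y z) ?_ ?_
  · rw [show (∫⁻ ω, ∑' y : ω.1, wt n M ω o y * ∫⁻ z, k ω y z ∂ν ∂P) =
      ∫⁻ ω, ∫⁻ z, ∑' y : ω.1, wt n M ω o y * k ω y z ∂ν ∂P from ?_, h]
    · exact lintegral_congr fun ω => (tsum_ms n M ω fun y => k ω y o).symm
    · refine lintegral_congr fun ω => ?_
      have hm : ∀ y : X, Measurable fun z => k ω y z := fun y =>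
        hk.comp (measurable_const.prodMk (measurable_const.prodMk measurable_id))
      rw [lintegral_tsum fun y : ω.1 => ((hm y).const_mul _).aemeasurable]
      exact tsum_congr fun y => (lintegral_const_mul _ (hm y)).symm
  · refine meas_tsum (A := Config X × X × X) (c := fun p => p.1) measurable_fst
      (f := fun p y => wt n M p.1 p.2.1 y * k p.1 y p.2.2) ?_
    exact ((meas_wt n M).comp
      (measurable_fst.fst.prodMk (measurable_fst.snd.fst.prodMk measurable_snd))).mul
      (hk.comp (measurable_fst.fst.prodMk (measurable_snd.prodMk measurable_fst.snd.snd)))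
  · intro g ω a b
    show ∑' y : (Config.mapIso g ω).1, wt n M (Config.mapIso g ω) (g a) y *
      k (Config.mapIso g ω) y (g b) = _
    rw [tsum_mapIso g ω (fun y => wt n M (Config.mapIso g ω) (g a) y *
      k (Config.mapIso g ω) y (g b))]
    refine tsum_congr fun y => ?_
    rw [wt_mapIso, hki]

end Weights

section Psi

variable {X : Type*} [MetricSpace X] [ProperSpace X] [PreconnectedSpace X]
  [MeasurableSpace X] [BorelSpace X]

/-- Normalized killed kernel. -/
def phi (n : ℕ) (ω : Config X) (y w : X) : ℝ := hk ω n y w / hk ω n y y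

lemma phi_nonneg (n : ℕ) (ω : Config X) (y w : X) : 0 ≤ phi n ω y w :=
  div_nonneg (hk_nonneg _ _ _) (hk_nonneg _ _ _)

lemma phi_le_one (n : ℕ) (ω : Config X) (y : X) {w : X} (hw : w ∈ ω.1) : phi n ω y w ≤ 1 :=
  div_le_one_of_le₀ (hk_le_diag n y hw) (hk_nonneg _ _ _)

lemma phi_mapIso (n : ℕ) (g : X ≃ᵢ X) (ω : Config X) (y w : X) :
    phi n (Config.mapIso g ω) (g y) (g w) = phi n ω y w := by
  unfold phi
  rw [hk_mapIso, hk_mapIso]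

lemma meas_phi (n : ℕ) : Measurable fun p : Config X × X × X => phi n p.1 p.2.1 p.2.2 :=
  (meas_hk n).div ((meas_hk n).comp
    (measurable_fst.prodMk (measurable_snd.fst.prodMk measurable_snd.fst)))

open Classical in
lemma phi_energy (n : ℕ) {M : ℝ} (hM : 0 < M) {ω : Config X} {y : X} (hy : M ≤ hk ω n y y) :
    ∑' a : ω.1, ∑' b : ω.1, (if Tch (a : X) b then
      ENNReal.ofReal ((phi n ω y a - phi n ω y b) ^ 2) else 0) ≤ ENNReal.ofReal (2 / M) := by
  have hh : 0 < hk ω n y y := hM.trans_le hy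
  have key : ∀ Λ : Finset X, (∀ a ∈ Λ, a ∈ ω.1) → En Λ (phi n ω y) ≤ 2 / M := by
    intro Λ hΛ
    have h1 : En Λ (phi n ω y) = En Λ (hk ω n y) / (hk ω n y y) ^ 2 := by
      unfold En
      rw [Finset.sum_div]
      refine Finset.sum_congr rfl fun a _ => ?_
      rw [Finset.sum_div]
      refine Finset.sum_congr rfl fun b _ => ?_
      split_ifs
      · unfold phi; field_simp
      · simp
    rw [h1]
    calc En Λ (hk ω n y) / (hk ω n y y) ^ 2 ≤ 2 * hk ω n y y / (hk ω n y y) ^ 2 :=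
          div_le_div_of_nonneg_right (En_hk_le n y hΛ) (by positivity)
      _ = 2 / hk ω n y y := by field_simp
      _ ≤ 2 / M := div_le_div_of_nonneg_left (by norm_num) hM hy
  rw [← ENNReal.tsum_prod (f := fun a b : ω.1 => if Tch (a : X) b then
      ENNReal.ofReal ((phi n ω y a - phi n ω y b) ^ 2) else 0), ENNReal.tsum_eq_iSup_sum]
  refine iSup_le fun s => ?_
  set Λ : Finset ω.1 := s.image Prod.fst ∪ s.image Prod.snd with hΛ
  have hs : s ⊆ Λ ×ˢ Λ := by
    intro p hp
    rw [Finset.mem_product]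
    exact ⟨Finset.mem_union_left _ (Finset.mem_image_of_mem _ hp),
      Finset.mem_union_right _ (Finset.mem_image_of_mem _ hp)⟩
  have hk := key (Λ.map (Embedding.subtype _)) (by
    intro a ha
    obtain ⟨b, -, rfl⟩ := Finset.mem_map.1 ha
    exact b.2)
  refine (Finset.sum_le_sum_of_subset hs).trans ?_
  refine le_trans (le_of_eq ?_) (ENNReal.ofReal_le_ofReal hk)
  unfold En
  rw [Finset.sum_product, Finset.sum_map, ENNReal.ofReal_sum_of_nonneg]
  · refine Finset.sum_congr rfl fun a _ => ?_
    rw [Finset.sum_map, ENNReal.ofReal_sum_of_nonneg]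
    · refine Finset.sum_congr rfl fun b _ => ?_
      simp only [Embedding.subtype_apply]
      by_cases hab : Tch (a : X) b
      · rw [if_pos hab]; exact (congrArg ENNReal.ofReal (if_pos hab)).symm
      · rw [if_neg hab]
        exact ENNReal.ofReal_zero.symm.trans (congrArg ENNReal.ofReal (if_neg hab)).symm
    · intro b _; split_ifs <;> positivity
  · intro a _
    refine Finset.sum_nonneg fun b _ => ?_
    split_ifs <;> positivity

lemma phi_edge (n : ℕ) {M : ℝ} (hM : 0 < M) {ω : Config X} {y : X} (hy : M ≤ hk ω n y y)
    {a b : X} (ha : a ∈ ω.1) (hb : b ∈ ω.1) (hab : Tch a b) :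
    (phi n ω y a - phi n ω y b) ^ 2 ≤ 2 / M := by
  classical
  have h := phi_energy n hM hy
  have h1 := (ENNReal.le_tsum (f := fun b : ω.1 => if Tch (a : X) b then
      ENNReal.ofReal ((phi n ω y a - phi n ω y b) ^ 2) else 0) ⟨b, hb⟩).trans
    ((ENNReal.le_tsum (f := fun a : ω.1 => ∑' b : ω.1, if Tch (a : X) b then
      ENNReal.ofReal ((phi n ω y a - phi n ω y b) ^ 2) else 0) ⟨a, ha⟩).trans h)
  simp only at h1
  rw [if_pos hab] at h1
  exact (ENNReal.ofReal_le_ofReal_iff (by positivity)).1 h1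

/-- Smeared kernel, extended valued. -/
def psE (n : ℕ) (ω : Config X) (y z : X) : ℝ≥0∞ :=
  ⨆ w : X, ⨆ _ : w ∈ ω.1 ∧ dist w z ≤ 1/2, ENNReal.ofReal (phi n ω y w)

/-- Smeared kernel. -/
def ps (n : ℕ) (ω : Config X) (y z : X) : ℝ := (psE n ω y z).toReal

lemma psE_le_one (n : ℕ) (ω : Config X) (y z : X) : psE n ω y z ≤ 1 :=
  iSup_le fun w => iSup_le fun hw => by
    rw [← ENNReal.ofReal_one]; exact ENNReal.ofReal_le_ofReal (phi_le_one n ω y hw.1)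

lemma ps_nonneg (n : ℕ) (ω : Config X) (y z : X) : 0 ≤ ps n ω y z := ENNReal.toReal_nonneg

lemma ps_le_one (n : ℕ) (ω : Config X) (y z : X) : ps n ω y z ≤ 1 := by
  have := ENNReal.toReal_mono ENNReal.one_ne_top (psE_le_one n ω y z)
  rwa [ENNReal.toReal_one] at this

lemma phi_le_ps (n : ℕ) (ω : Config X) (y : X) {z w : X} (hw : w ∈ ω.1) (h : dist w z ≤ 1/2) :
    phi n ω y w ≤ ps n ω y z := by
  have h1 : ENNReal.ofReal (phi n ω y w) ≤ psE n ω y z :=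
    le_iSup_of_le w (le_iSup_of_le ⟨hw, h⟩ le_rfl)
  have h2 := ENNReal.toReal_mono ((psE_le_one n ω y z).trans_lt ENNReal.one_lt_top).ne h1
  rwa [ENNReal.toReal_ofReal (phi_nonneg _ _ _ _)] at h2

lemma ps_eq_zero (n : ℕ) (ω : Config X) (y z : X) (h : ∀ w ∈ ω.1, ¬ dist w z ≤ 1/2) :
    ps n ω y z = 0 := by
  have : psE n ω y z = 0 := by
    refine le_antisymm (iSup_le fun w => iSup_le fun hw => absurd hw.2 (h w hw.1)) bot_le
  unfold ps; rw [this]; rfl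

lemma ps_attained (n : ℕ) (ω : Config X) (y : X) {z w : X} (hw : w ∈ ω.1)
    (h : dist w z ≤ 1/2) : ∃ x ∈ ω.1, dist x z ≤ 1/2 ∧ ps n ω y z = phi n ω y x := by
  have hf := ω.2 (closedBall z (1/2)) isBounded_closedBall
  obtain ⟨x, hx, hmax⟩ := Set.exists_max_image _ (phi n ω y) hf ⟨w, hw, h⟩
  refine ⟨x, hx.1, hx.2, le_antisymm ?_ (phi_le_ps n ω y hx.1 hx.2)⟩
  have : psE n ω y z ≤ ENNReal.ofReal (phi n ω y x) :=
    iSup_le fun w => iSup_le fun hw => ENNReal.ofReal_le_ofReal (hmax w ⟨hw.1, hw.2⟩)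
  have h2 := ENNReal.toReal_mono ENNReal.ofReal_ne_top this
  rwa [ENNReal.toReal_ofReal (phi_nonneg _ _ _ _)] at h2

lemma ps_supp (n : ℕ) (ω : Config X) (y z : X) (h : ps n ω y z ≠ 0) : dist y z ≤ 2 * n + 1 := by
  by_cases hw : ∃ w ∈ ω.1, dist w z ≤ 1/2
  · obtain ⟨w, hw, hd⟩ := hw
    obtain ⟨x, hx, hd, he⟩ := ps_attained n ω y hw hd
    rw [he] at h
    have h1 : hk ω n y x ≠ 0 := by
      intro h0; apply h; unfold phi; rw [h0, zero_div]
    have := hk_supp n y x h1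
    linarith [dist_triangle y x z]
  · push Not at hw
    exact absurd (ps_eq_zero n ω y z fun w hw' => not_le.2 (hw w hw')) h

lemma meas_ps (n : ℕ) : Measurable fun p : Config X × X × X => ps n p.1 p.2.1 p.2.2 := by
  refine Measurable.ennreal_toReal ?_
  refine measurable_of_Ioi fun s => ?_
  have : (fun p : Config X × X × X => psE n p.1 p.2.1 p.2.2) ⁻¹' Ioi s =
      {p | ∃ w ∈ p.1.1, dist w p.2.2 ≤ 1/2 ∧ s < ENNReal.ofReal (phi n p.1 p.2.1 w)} := by
    ext p
    show s < psE n p.1 p.2.1 p.2.2 ↔ ∃ w ∈ p.1.1, dist w p.2.2 ≤ 1/2 ∧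
      s < ENNReal.ofReal (phi n p.1 p.2.1 w)
    unfold psE
    simp only [lt_iSup_iff]
    constructor
    · rintro ⟨w, hw, h⟩; exact ⟨w, hw.1, hw.2, h⟩
    · rintro ⟨w, hw, hw2, h⟩; exact ⟨w, ⟨hw, hw2⟩, h⟩
  rw [this]
  refine measurableSet_setOfPred.2 ?_
  refine meas_exists (A := Config X × X × X) (c := fun p => p.1) measurable_fst
    (p := fun p w => dist w p.2.2 ≤ 1/2 ∧ s < ENNReal.ofReal (phi n p.1 p.2.1 w)) ?_
  refine (meas_le_half measurable_snd measurable_fst.snd.snd _).and ?_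
  have hm : Measurable fun q : (Config X × X × X) × X =>
      ENNReal.ofReal (phi n q.1.1 q.1.2.1 q.2) :=
    ((meas_phi n).comp
      (measurable_fst.fst.prodMk (measurable_fst.snd.fst.prodMk measurable_snd))).ennreal_ofReal
  exact measurableSet_setOfPred.1 (measurableSet_lt measurable_const hm)

lemma ps_mapIso (n : ℕ) (g : X ≃ᵢ X) (ω : Config X) (y z : X) :
    ps n (Config.mapIso g ω) (g y) (g z) = ps n ω y z := by
  unfold ps psE
  congr 1
  rw [← g.surjective.iSup_comp]
  refine iSup_congr fun w => ?_
  rw [phi_mapIso, mem_mapIso, g.isometry.dist_eq]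

/-- The local average of the squared smeared kernels. -/
def Av (ν : Measure X) (n : ℕ) (M : ℝ) (ω : Config X) (z : X) : ℝ≥0∞ :=
  ∑' y : ω.1, ms ν n M ω y * ENNReal.ofReal (ps n ω y z ^ 2)

variable {o : X} {ν : Measure X}

lemma meas_Av (ν : Measure X) [SFinite ν] (n : ℕ) (M : ℝ) :
    Measurable fun p : Config X × X => Av ν n M p.1 p.2 := by
  refine meas_tsum (A := Config X × X) (c := fun p => p.1) measurable_fst
    (f := fun p y => ms ν n M p.1 y * ENNReal.ofReal (ps n p.1 y p.2 ^ 2)) ?_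
  refine ((meas_ms ν n M).comp (measurable_fst.fst.prodMk measurable_snd)).mul ?_
  exact (((meas_ps n).comp (measurable_fst.fst.prodMk
    (measurable_snd.prodMk measurable_fst.snd))).pow_const 2).ennreal_ofReal

lemma Av_mapIso (hν : RefMeasure o ν) (n : ℕ) (M : ℝ) (g : X ≃ᵢ X) (ω : Config X) (z : X) :
    Av ν n M (Config.mapIso g ω) (g z) = Av ν n M ω z := by
  unfold Av
  rw [tsum_mapIso g ω (fun y => ms ν n M (Config.mapIso g ω) y *
    ENNReal.ofReal (ps n (Config.mapIso g ω) y (g z) ^ 2))]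
  refine tsum_congr fun y => ?_
  rw [ms_mapIso hν, ps_mapIso]

lemma Av_lt_top [SFinite ν] (hν : RefMeasure o ν) (n : ℕ) (M : ℝ) (ω : Config X) (z : X) :
    Av ν n M ω z < ⊤ := by
  unfold Av
  rw [tsum_ms n M ω (fun y => ENNReal.ofReal (ps n ω y z ^ 2))]
  refine lt_of_le_of_lt (lintegral_mono (g := (closedBall z (2 * n + 2)).indicator 1) ?_) ?_
  · intro t
    show ∑' y : ω.1, wt n M ω t y * ENNReal.ofReal (ps n ω y z ^ 2) ≤ _
    by_cases ht : t ∈ closedBall z (2 * n + 2)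
    · rw [indicator_of_mem ht]
      refine le_trans (ENNReal.tsum_le_tsum fun y => ?_) (tsum_wt_le n M ω t)
      refine mul_le_of_le_one_right' ?_
      rw [← ENNReal.ofReal_one]
      refine ENNReal.ofReal_le_ofReal ?_
      have h1 := ps_nonneg n ω y z
      have h2 := ps_le_one n ω y z
      nlinarith
    · rw [indicator_of_notMem ht]
      refine le_of_eq (ENNReal.tsum_eq_zero.2 fun y => ?_)
      by_cases hG : Gd n M ω t y
      · by_cases hp : ps n ω y z = 0
        · rw [hp]; simp
        · exfalso
          apply ht
          have h1 := ps_supp n ω y z hp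
          have h2 := hG.2
          rw [dist_comm] at h2
          rw [mem_closedBall]
          linarith [dist_triangle t (y : X) z]
      · rw [wt_eq_zero hG, zero_mul]
  · rw [lintegral_indicator_one isClosed_closedBall.measurableSet]
    exact hν.fin _ _

lemma Av_lower [SFinite ν] (hsym : PointSymmetric X) (hν : RefMeasure o ν) (n : ℕ) {M : ℝ}
    (hM : 8 ≤ M) (ω : Config X) {x z : X} (hx : x ∈ ω.1) (hxM : M ≤ hk ω n x x)
    (hxz : dist x z ≤ 1/2) :
    ν (closedBall o (1/4)) * ENNReal.ofReal (1/4) ≤ Av ν n M ω z := by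
  unfold Av
  rw [tsum_ms n M ω (fun y => ENNReal.ofReal (ps n ω y z ^ 2))]
  refine (mul_le_mul_left (hν.lower hsym x) _).trans ?_
  rw [mul_comm, ← setLIntegral_const]
  refine le_trans (setLIntegral_mono' isClosed_closedBall.measurableSet fun t ht => ?_)
    (setLIntegral_le_lintegral (closedBall x (1/2)) _)
  rw [mem_closedBall, dist_comm] at ht
  have h1 := tsum_wt_eq n M ω t hx ⟨hxM, ht⟩
  calc ENNReal.ofReal (1/4) = ∑' y : ω.1, wt n M ω t y * ENNReal.ofReal (1/4) := by
        rw [ENNReal.tsum_mul_right, h1, one_mul]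
    _ ≤ _ := ENNReal.tsum_le_tsum fun y => ?_
  by_cases hG : Gd n M ω t y
  swap
  · rw [wt_eq_zero hG, zero_mul, zero_mul]
  refine mul_le_mul_right (ENNReal.ofReal_le_ofReal ?_) _
  have hyx : Tch (y : X) x := by
    refine Tch.of_dist ?_
    have h2 := hG.2
    rw [dist_comm] at ht
    linarith [dist_triangle (y : X) t x]
  have h3 := phi_edge n (by linarith) hG.1 y.2 hx hyx
  have h4 : phi n ω y y = 1 := div_self (by linarith [hG.1])
  have h5 : 2 / M ≤ 1 / 4 := by rw [div_le_iff₀ (by linarith)]; linarith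
  have h6 := phi_le_ps n ω y hx hxz
  rw [h4] at h3
  have h7 : 1/2 ≤ phi n ω y x := by nlinarith
  nlinarith

end Psi

section PsEnergy

variable {X : Type*} [MetricSpace X] [ProperSpace X] [PreconnectedSpace X]
  [MeasurableSpace X] [BorelSpace X]

open Classical in
/-- Squared gradient along an edge. -/
def edg (n : ℕ) (ω : Config X) (y a b : X) : ℝ≥0∞ :=
  if Tch a b then ENNReal.ofReal ((phi n ω y a - phi n ω y b) ^ 2) else 0

/-- Squared gradient along a coarse edge. -/
def jdg (n : ℕ) (ω : Config X) (y z z' : X) : ℝ≥0∞ :=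
  {p : X × X | J ω p.1 p.2}.indicator
    (fun p => ENNReal.ofReal ((ps n ω y p.1 - ps n ω y p.2) ^ 2)) (z, z')

def Sloc (n : ℕ) (ω : Config X) (y z : X) : ℝ≥0∞ :=
  ∑' a : ω.1, ∑' b : ω.1, edg n ω y a b * (closedBall (a : X) 4).indicator (1 : X → ℝ≥0∞) z

lemma le_Sloc (n : ℕ) (ω : Config X) (y z : X) {a b : X} (ha : a ∈ ω.1) (hb : b ∈ ω.1)
    (hab : Tch a b) (hz : dist a z ≤ 4) :
    ENNReal.ofReal ((phi n ω y a - phi n ω y b) ^ 2) ≤ Sloc n ω y z := by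
  classical
  have h1 := (ENNReal.le_tsum (f := fun b : ω.1 => edg n ω y a b *
      (closedBall (a : X) 4).indicator (1 : X → ℝ≥0∞) z) ⟨b, hb⟩).trans
    (ENNReal.le_tsum (f := fun a : ω.1 => ∑' b : ω.1, edg n ω y a b *
      (closedBall (a : X) 4).indicator (1 : X → ℝ≥0∞) z) ⟨a, ha⟩)
  refine le_trans (le_of_eq ?_) h1
  show _ = edg n ω y a b * (closedBall (a : X) 4).indicator (1 : X → ℝ≥0∞) z
  rw [indicator_of_mem (by rw [mem_closedBall, dist_comm]; exact hz), edg, if_pos hab]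
  simp

lemma jdg_le (n : ℕ) (ω : Config X) (y z z' : X) :
    jdg n ω y z z' ≤ (closedBall z 3).indicator (1 : X → ℝ≥0∞) z' * (9 * Sloc n ω y z) := by
  unfold jdg
  by_cases hJ : J ω z z'
  swap
  · rw [indicator_of_notMem (show (z, z') ∉ {p : X × X | J ω p.1 p.2} from hJ)]
    exact zero_le
  rw [indicator_of_mem (show (z, z') ∈ {p : X × X | J ω p.1 p.2} from hJ),
    indicator_of_mem (show z' ∈ closedBall z 3 by
      rw [mem_closedBall, dist_comm]; exact hJ.dist_le)]
  simp only [Pi.one_apply, one_mul]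
  obtain ⟨x, hx, x', hx', h1, h2, h3⟩ := hJ
  obtain ⟨w, hw, hwz, hpw⟩ := ps_attained n ω y hx h1
  obtain ⟨w', hw', hwz', hpw'⟩ := ps_attained n ω y hx' h2
  rw [hpw, hpw']
  have hwx : Tch w x := Tch.of_dist (by
    rw [dist_comm] at h1; linarith [dist_triangle w z x])
  have hwx' : Tch x' w' := Tch.of_dist (by
    rw [dist_comm] at hwz'; linarith [dist_triangle x' z' w'])
  have hxx := h3.dist_le
  have e1 := le_Sloc n ω y z hw hx hwx (by linarith)
  have e2 := le_Sloc n ω y z hx hx' h3 (by linarith)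
  have e3 := le_Sloc n ω y z hx' hw' hwx' (by
    rw [dist_comm] at hxx; linarith [dist_triangle x' x z])
  calc ENNReal.ofReal ((phi n ω y w - phi n ω y w') ^ 2)
      ≤ ENNReal.ofReal (3 * ((phi n ω y w - phi n ω y x) ^ 2 +
          (phi n ω y x - phi n ω y x') ^ 2 + (phi n ω y x' - phi n ω y w') ^ 2)) := by
        refine ENNReal.ofReal_le_ofReal ?_
        set p := phi n ω y w - phi n ω y x
        set q := phi n ω y x - phi n ω y x'
        set r := phi n ω y x' - phi n ω y w'
        have : phi n ω y w - phi n ω y w' = p + q + r := by simp only [p, q, r]; ring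
        rw [this]
        nlinarith [sq_nonneg (p - q), sq_nonneg (q - r), sq_nonneg (p - r)]
    _ = 3 * (ENNReal.ofReal ((phi n ω y w - phi n ω y x) ^ 2) +
          ENNReal.ofReal ((phi n ω y x - phi n ω y x') ^ 2) +
          ENNReal.ofReal ((phi n ω y x' - phi n ω y w') ^ 2)) := by
        rw [ENNReal.ofReal_mul (by norm_num), ENNReal.ofReal_add (by positivity) (by positivity),
          ENNReal.ofReal_add (by positivity) (by positivity)]
        norm_num
    _ ≤ 3 * (Sloc n ω y z + Sloc n ω y z + Sloc n ω y z) := by gcongr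
    _ = 9 * Sloc n ω y z := by ring

variable {o : X} {ν : Measure X}

lemma ps_energy (hsym : PointSymmetric X) (hν : RefMeasure o ν) (n : ℕ) {M : ℝ} (hM : 0 < M)
    {ω : Config X} {y : X} (hy : M ≤ hk ω n y y) :
    ∫⁻ z, ∫⁻ z', jdg n ω y z z' ∂ν ∂ν ≤
      9 * ν (closedBall o (3+1)) * ν (closedBall o (4+1)) * ENNReal.ofReal (2 / M) := by
  classical
  have hmS : ∀ a b : X, Measurable fun z => edg n ω y a b *
      (closedBall (a : X) 4).indicator (1 : X → ℝ≥0∞) z := fun a b =>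
    (measurable_one.indicator isClosed_closedBall.measurableSet).const_mul _
  calc ∫⁻ z, ∫⁻ z', jdg n ω y z z' ∂ν ∂ν
      ≤ ∫⁻ z, ν (closedBall o (3+1)) * 9 * Sloc n ω y z ∂ν := by
        refine lintegral_mono fun z => ?_
        refine (lintegral_mono fun z' => jdg_le n ω y z z').trans ?_
        rw [lintegral_mul_const _ (measurable_one.indicator isClosed_closedBall.measurableSet),
          lintegral_indicator_one isClosed_closedBall.measurableSet, mul_assoc]
        exact mul_le_mul_left (hν.upper hsym z 3) _
    _ = ν (closedBall o (3+1)) * 9 * ∫⁻ z, Sloc n ω y z ∂ν := by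
        refine lintegral_const_mul _ ?_
        exact Measurable.tsum fun a => Measurable.tsum fun b => hmS a b
    _ = ν (closedBall o (3+1)) * 9 *
          ∑' a : ω.1, ∑' b : ω.1, edg n ω y a b * ν (closedBall (a : X) 4) := by
        congr 1
        unfold Sloc
        rw [lintegral_tsum fun a : ω.1 =>
          (Measurable.tsum fun b : ω.1 => hmS a b).aemeasurable]
        refine tsum_congr fun a => ?_
        rw [lintegral_tsum fun b : ω.1 => (hmS a b).aemeasurable]
        refine tsum_congr fun b => ?_
        rw [lintegral_const_mul _ (measurable_one.indicator isClosed_closedBall.measurableSet),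
          lintegral_indicator_one isClosed_closedBall.measurableSet]
    _ ≤ ν (closedBall o (3+1)) * 9 *
          ∑' a : ω.1, ∑' b : ω.1, edg n ω y a b * ν (closedBall o (4+1)) := by
        refine mul_le_mul_right (ENNReal.tsum_le_tsum fun a => ENNReal.tsum_le_tsum fun b =>
          mul_le_mul_right (hν.upper hsym _ 4) _) _
    _ = ν (closedBall o (3+1)) * 9 *
          ((∑' a : ω.1, ∑' b : ω.1, edg n ω y a b) * ν (closedBall o (4+1))) := by
        simp only [ENNReal.tsum_mul_right]
    _ ≤ ν (closedBall o (3+1)) * 9 * (ENNReal.ofReal (2 / M) * ν (closedBall o (4+1))) :=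
        mul_le_mul_right (mul_le_mul_left (phi_energy n hM hy) _) _
    _ = _ := by ring

lemma meas_jdg (n : ℕ) :
    Measurable fun p : (Config X × X × X) × X => jdg n p.1.1 p.1.2.1 p.1.2.2 p.2 := by
  classical
  have : (fun p : (Config X × X × X) × X => jdg n p.1.1 p.1.2.1 p.1.2.2 p.2) =
      fun p => if J p.1.1 p.1.2.2 p.2 then
        ENNReal.ofReal ((ps n p.1.1 p.1.2.1 p.1.2.2 - ps n p.1.1 p.1.2.1 p.2) ^ 2) else 0 := by
    funext p
    unfold jdg
    rw [indicator_apply]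
    rfl
  rw [this]
  refine Measurable.ite (measurableSet_setOfPred.2 (meas_J.comp
    (measurable_fst.fst.prodMk (measurable_fst.snd.snd.prodMk measurable_snd)))) ?_ measurable_const
  exact (((meas_ps n).comp measurable_fst).sub ((meas_ps n).comp
    (measurable_fst.fst.prodMk (measurable_fst.snd.fst.prodMk measurable_snd)))).pow_const 2
    |>.ennreal_ofReal

lemma jdg_mapIso (n : ℕ) (g : X ≃ᵢ X) (ω : Config X) (y z z' : X) :
    jdg n (Config.mapIso g ω) (g y) (g z) (g z') = jdg n ω y z z' := by
  unfold jdg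
  by_cases hJ : J ω z z'
  · rw [indicator_of_mem (show (z, z') ∈ {p : X × X | J ω p.1 p.2} from hJ),
      indicator_of_mem (show (g z, g z') ∈ {p : X × X | J (Config.mapIso g ω) p.1 p.2} from
        (J_mapIso g ω z z').2 hJ)]
    simp only [ps_mapIso]
  · rw [indicator_of_notMem (show (z, z') ∉ {p : X × X | J ω p.1 p.2} from hJ),
      indicator_of_notMem (show (g z, g z') ∉ {p : X × X | J (Config.mapIso g ω) p.1 p.2} from
        fun h => hJ ((J_mapIso g ω z z').1 h))]

end PsEnergy

section Chain

variable {X : Type*} [MetricSpace X] [ProperSpace X] [PreconnectedSpace X]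
  [MeasurableSpace X] [BorelSpace X]

/-- Normalized squared kernels. -/
def gf (ν : Measure X) (n : ℕ) (M κ : ℝ) (ω : Config X) (y z : X) : ℝ :=
  ps n ω y z ^ 2 / max (Av ν n M ω z).toReal κ

/-- Positive part of the gradient of `gf` along a coarse edge. -/
def jgg (ν : Measure X) (n : ℕ) (M κ : ℝ) (ω : Config X) (y z z' : X) : ℝ≥0∞ :=
  {p : X × X | J ω p.1 p.2}.indicator
    (fun p => ENNReal.ofReal (gf ν n M κ ω y p.1 - gf ν n M κ ω y p.2)) (z, z')

def Th (n : ℕ) (M r : ℝ) (ω : Config X) (z : X) : Prop :=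
  ∃ x ∈ ω.1, (Trif ω r x ∧ M ≤ hk ω n x x) ∧ dist x z ≤ 1/2

lemma meas_Th (n : ℕ) (M r : ℝ) : Measurable fun p : Config X × X => Th n M r p.1 p.2 := by
  refine meas_exists (A := Config X × X) (c := fun p => p.1) measurable_fst
    (p := fun p x => (Trif p.1 r x ∧ M ≤ hk p.1 n x x) ∧ dist x p.2 ≤ 1/2) ?_
  exact ((meas_trif measurable_fst.fst r measurable_snd).and
    (meas_diag n M measurable_fst.fst measurable_snd)).and
    (meas_le_half measurable_snd measurable_fst.snd _)

lemma Th_mapIso (n : ℕ) (M r : ℝ) (g : X ≃ᵢ X) (ω : Config X) (z : X) :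
    Th n M r (Config.mapIso g ω) (g z) ↔ Th n M r ω z := by
  unfold Th
  rw [exists_mapIso]
  refine exists_congr fun x => and_congr_right fun _ => ?_
  rw [trif_mapIso, hk_mapIso, g.isometry.dist_eq]

variable {o : X} {ν : Measure X}

lemma meas_gf (ν : Measure X) [SFinite ν] (n : ℕ) (M κ : ℝ) :
    Measurable fun p : Config X × X × X => gf ν n M κ p.1 p.2.1 p.2.2 :=
  ((meas_ps n).pow_const 2).div
    (((meas_Av ν n M).comp (measurable_fst.prodMk measurable_snd.snd)).ennreal_toReal.max
      measurable_const)

lemma gf_mapIso (hν : RefMeasure o ν) (n : ℕ) (M κ : ℝ) (g : X ≃ᵢ X) (ω : Config X) (y z : X) :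
    gf ν n M κ (Config.mapIso g ω) (g y) (g z) = gf ν n M κ ω y z := by
  unfold gf
  rw [ps_mapIso, Av_mapIso hν]

lemma gf_nonneg (ν : Measure X) (n : ℕ) (M : ℝ) {κ : ℝ} (hκ : 0 < κ) (ω : Config X) (y z : X) :
    0 ≤ gf ν n M κ ω y z :=
  div_nonneg (sq_nonneg _) (hκ.le.trans (le_max_right _ _))

lemma meas_jgg (ν : Measure X) [SFinite ν] (n : ℕ) (M κ : ℝ) :
    Measurable fun p : (Config X × X × X) × X => jgg ν n M κ p.1.1 p.1.2.1 p.1.2.2 p.2 := by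
  classical
  have : (fun p : (Config X × X × X) × X => jgg ν n M κ p.1.1 p.1.2.1 p.1.2.2 p.2) =
      fun p => if J p.1.1 p.1.2.2 p.2 then ENNReal.ofReal
        (gf ν n M κ p.1.1 p.1.2.1 p.1.2.2 - gf ν n M κ p.1.1 p.1.2.1 p.2) else 0 := by
    funext p
    unfold jgg
    rw [indicator_apply]
    rfl
  rw [this]
  refine Measurable.ite (measurableSet_setOfPred.2 (meas_J.comp
    (measurable_fst.fst.prodMk (measurable_fst.snd.snd.prodMk measurable_snd)))) ?_ measurable_const
  exact (((meas_gf ν n M κ).comp measurable_fst).sub ((meas_gf ν n M κ).comp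
    (measurable_fst.fst.prodMk (measurable_fst.snd.fst.prodMk measurable_snd)))).ennreal_ofReal

lemma jgg_mapIso (hν : RefMeasure o ν) (n : ℕ) (M κ : ℝ) (g : X ≃ᵢ X) (ω : Config X)
    (y z z' : X) :
    jgg ν n M κ (Config.mapIso g ω) (g y) (g z) (g z') = jgg ν n M κ ω y z z' := by
  unfold jgg
  by_cases hJ : J ω z z'
  · rw [indicator_of_mem (show (z, z') ∈ {p : X × X | J ω p.1 p.2} from hJ),
      indicator_of_mem (show (g z, g z') ∈ {p : X × X | J (Config.mapIso g ω) p.1 p.2} from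
        (J_mapIso g ω z z').2 hJ)]
    simp only [gf_mapIso hν]
  · rw [indicator_of_notMem (show (z, z') ∉ {p : X × X | J ω p.1 p.2} from hJ),
      indicator_of_notMem (show (g z, g z') ∉ {p : X × X | J (Config.mapIso g ω) p.1 p.2} from
        fun h => hJ ((J_mapIso g ω z z').1 h))]

def kap (ν : Measure X) (o : X) : ℝ := (ν (closedBall o (1/4)) * ENNReal.ofReal (1/4)).toReal

lemma kap_pos (hν : RefMeasure o ν) : 0 < kap ν o := by
  refine ENNReal.toReal_pos ?_ (ENNReal.mul_ne_top (hν.fin _ _).ne ENNReal.ofReal_ne_top)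
  refine mul_ne_zero (hν.pos _ _ (by norm_num)).ne' ?_
  simp

open Classical in
/-- `gf` restricted to the neighbourhood of bad trifurcations. -/
def gT (ν : Measure X) (n : ℕ) (M r κ : ℝ) (ω : Config X) (y z : X) : ℝ≥0∞ :=
  if Th n M r ω z then ENNReal.ofReal (gf ν n M κ ω y z) else 0

lemma meas_gT (ν : Measure X) [SFinite ν] (n : ℕ) (M r κ : ℝ) :
    Measurable fun p : Config X × X × X => gT ν n M r κ p.1 p.2.1 p.2.2 := by
  classical
  exact Measurable.ite (measurableSet_setOfPred.2 ((meas_Th n M r).comp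
    (measurable_fst.prodMk measurable_snd.snd))) (meas_gf ν n M κ).ennreal_ofReal measurable_const

lemma gT_mapIso (hν : RefMeasure o ν) (n : ℕ) (M r κ : ℝ) (g : X ≃ᵢ X) (ω : Config X) (y z : X) :
    gT ν n M r κ (Config.mapIso g ω) (g y) (g z) = gT ν n M r κ ω y z := by
  classical
  unfold gT
  rw [gf_mapIso hν]
  by_cases h : Th n M r ω z
  · rw [if_pos h, if_pos ((Th_mapIso n M r g ω z).2 h)]
  · rw [if_neg h, if_neg (fun hh => h ((Th_mapIso n M r g ω z).1 hh))]

lemma one_le_gT [SFinite ν] (hsym : PointSymmetric X) (hν : RefMeasure o ν) (n : ℕ) {M : ℝ}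
    (hM : 8 ≤ M) {r : ℝ} {ω : Config X} {z : X} (h : Th n M r ω z) :
    1 ≤ ∑' y : ω.1, ms ν n M ω y * gT ν n M r (kap ν o) ω y z := by
  classical
  have hlow : ν (closedBall o (1/4)) * ENNReal.ofReal (1/4) ≤ Av ν n M ω z := by
    obtain ⟨x, hx, hx2, hx3⟩ := h
    exact Av_lower hsym hν n hM ω hx hx2.2 hx3
  have htop := (Av_lt_top hν n M ω z).ne
  have hmax : max (Av ν n M ω z).toReal (kap ν o) = (Av ν n M ω z).toReal :=
    max_eq_left (ENNReal.toReal_mono htop hlow)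
  have hpos : 0 < (Av ν n M ω z).toReal := (kap_pos hν).trans_le (ENNReal.toReal_mono htop hlow)
  have h0 : Av ν n M ω z ≠ 0 := by
    intro h0; rw [h0] at hpos; simp at hpos
  have e : ∀ y : ω.1, ms ν n M ω y * gT ν n M r (kap ν o) ω y z =
      ms ν n M ω y * ENNReal.ofReal (ps n ω y z ^ 2) * (Av ν n M ω z)⁻¹ := by
    intro y
    unfold gT gf
    rw [if_pos h, hmax, ENNReal.ofReal_div_of_pos hpos, ENNReal.ofReal_toReal htop,
      ENNReal.div_eq_inv_mul]
    ring
  rw [tsum_congr e, ENNReal.tsum_mul_right]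
  exact (ENNReal.mul_inv_cancel h0 htop).ge

lemma gT_le [SigmaFinite ν] (hsym : PointSymmetric X) (hν : RefMeasure o ν) (n : ℕ) (M : ℝ)
    {r κ : ℝ} (hr : 0 ≤ r) (hκ : 0 < κ) (ω : Config X) (y : X) :
    ∫⁻ z, gT ν n M r κ ω y z ∂ν ≤ CBK ν o r * ∫⁻ z, ∫⁻ z', jgg ν n M κ ω y z z' ∂ν ∂ν := by
  classical
  have hmap : Measurable fun z : X => ((ω, y, z) : Config X × X × X) :=
    measurable_const.prodMk (measurable_const.prodMk measurable_id)
  have hg : Measurable fun z => gf ν n M κ ω y z := by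
    have h0 := (meas_gf ν n M κ).comp hmap
    exact h0
  have h := bk_fun hsym hν (ω := ω) hr (T := {x | Trif ω r x ∧ M ≤ hk ω n x x})
    (fun i hi => hi.1) hg (gf_nonneg ν n M hκ ω y) (R := dist y o + (2 * n + 1)) ?_
  · refine le_trans (le_of_eq ?_) h
    have hs : {z | ∃ x ∈ {x | Trif ω r x ∧ M ≤ hk ω n x x}, dist x z ≤ 1/2} =
        {z | Th n M r ω z} := by
      ext z
      constructor
      · rintro ⟨x, hx, hd⟩; exact ⟨x, hx.1.1, hx, hd⟩
      · rintro ⟨x, -, hx, hd⟩; exact ⟨x, hx, hd⟩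
    have hm : MeasurableSet {z | Th n M r ω z} :=
      measurableSet_setOfPred.2 ((meas_Th n M r).comp
        (measurable_const (a := ω).prodMk measurable_id))
    rw [hs]
    rw [← lintegral_indicator hm]
    refine lintegral_congr fun z => ?_
    unfold gT
    by_cases hT : Th n M r ω z
    · rw [if_pos hT, indicator_of_mem (show z ∈ {z | Th n M r ω z} from hT)]
    · rw [if_neg hT, indicator_of_notMem (show z ∉ {z | Th n M r ω z} from hT)]
  · intro z hz
    have : ps n ω y z ≠ 0 := by
      intro h0; apply hz; unfold gf; rw [h0]; simp
    have := ps_supp n ω y z this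
    rw [dist_comm] at this
    rw [mem_closedBall]
    linarith [dist_triangle z y o]

lemma sum_jgg_le [SFinite ν] (hν : RefMeasure o ν) (n : ℕ) (M : ℝ) {κ η : ℝ} (hκ : 0 < κ)
    (hη : 0 < η) (ω : Config X) (z z' : X) :
    ∑' y : ω.1, ms ν n M ω y * jgg ν n M κ ω y z z' ≤
      ENNReal.ofReal (1 / (κ * η)) * ∑' y : ω.1, ms ν n M ω y * jdg n ω y z z'
        + ENNReal.ofReal (4 * η) * (closedBall z 3).indicator (1 : X → ℝ≥0∞) z' := by
  by_cases hJ : J ω z z'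
  swap
  · refine le_trans (le_of_eq (ENNReal.tsum_eq_zero.2 fun y => ?_)) zero_le
    unfold jgg
    rw [indicator_of_notMem (show (z, z') ∉ {p : X × X | J ω p.1 p.2} from hJ), mul_zero]
  have hz : z' ∈ closedBall z 3 := by rw [mem_closedBall, dist_comm]; exact hJ.dist_le
  rw [indicator_of_mem hz]
  simp only [Pi.one_apply, mul_one]
  have h := l1_lemma (fun y : ω.1 => ms ν n M ω y) (fun y => ps n ω y z) (fun y => ps n ω y z')
    hκ hη (A := (Av ν n M ω z).toReal) (B := (Av ν n M ω z').toReal) ENNReal.toReal_nonneg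
    ENNReal.toReal_nonneg (by rw [ENNReal.ofReal_toReal (Av_lt_top hν n M ω z).ne]; rfl)
    (by rw [ENNReal.ofReal_toReal (Av_lt_top hν n M ω z').ne]; rfl)
  convert h using 6
  · unfold jgg
    rw [indicator_of_mem (show (z, z') ∈ {p : X × X | J ω p.1 p.2} from hJ)]
    rfl
  · unfold jdg
    rw [indicator_of_mem (show (z, z') ∈ {p : X × X | J ω p.1 p.2} from hJ)]

/-- The quantitative bound. -/
lemma chain [SigmaFinite ν] (hsym : PointSymmetric X) (hν : RefMeasure o ν)
    {P : Measure (Config X)} [IsProbabilityMeasure P] (hP : IsoInvariant P) (n : ℕ) {M r η : ℝ}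
    (hM : 8 ≤ M) (hr : 0 ≤ r) (hη : 0 < η) :
    P {ω | Th n M r ω o} ≤ CBK ν o r * (ENNReal.ofReal (1 / (kap ν o * η)) *
      (9 * ν (closedBall o (3+1)) * ν (closedBall o (4+1)) * ENNReal.ofReal (2 / M))
        + ENNReal.ofReal (4 * η) * ν (closedBall o 3)) := by
  classical
  set κ := kap ν o with hκd
  have hκ : 0 < κ := kap_pos hν
  set E := 9 * ν (closedBall o (3+1)) * ν (closedBall o (4+1)) * ENNReal.ofReal (2 / M) with hE
  have hmT : MeasurableSet {ω : Config X | Th n M r ω o} :=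
    measurableSet_setOfPred.2 ((meas_Th n M r).comp (measurable_id.prodMk measurable_const))
  have hk2 : Measurable fun p : Config X × X × X =>
      ∫⁻ z', jgg ν n M κ p.1 p.2.1 p.2.2 z' ∂ν :=
    (meas_jgg ν n M κ).lintegral_prod_right' (ν := ν)
  have hk3 : Measurable fun p : Config X × X × X => ∫⁻ z', jdg n p.1 p.2.1 p.2.2 z' ∂ν :=
    (meas_jdg n).lintegral_prod_right' (ν := ν)
  have hjg : ∀ ω (y z : X), Measurable fun z' => jgg ν n M κ ω y z z' := fun ω y z =>
    (meas_jgg ν n M κ).comp (measurable_const (a := (ω, y, z)).prodMk measurable_id)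
  have hjd : ∀ (ω : Config X) (y z : X), Measurable fun z' => jdg n ω y z z' := fun ω y z =>
    (meas_jdg n).comp (measurable_const (a := (ω, y, z)).prodMk measurable_id)
  have m1 := mtp1 hν hP n M (k := gT ν n M r κ) (meas_gT ν n M r κ) (gT_mapIso hν n M r κ)
  have m2 := mtp1 hν hP n M (k := fun ω y z => ∫⁻ z', jgg ν n M κ ω y z z' ∂ν) hk2 (by
    intro g ω a b
    show ∫⁻ z', jgg ν n M κ (Config.mapIso g ω) (g a) (g b) z' ∂ν = _
    rw [lintegral_iso hν g (hjg _ _ _)]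
    exact lintegral_congr fun z' => jgg_mapIso hν n M κ g ω a b z')
  have m3 := mtp1 hν hP n M (k := fun ω y z => ∫⁻ z', jdg n ω y z z' ∂ν) hk3 (by
    intro g ω a b
    show ∫⁻ z', jdg n (Config.mapIso g ω) (g a) (g b) z' ∂ν = _
    rw [lintegral_iso hν g (hjd _ _ _)]
    exact lintegral_congr fun z' => jdg_mapIso n g ω a b z')
  have e3 : ∫⁻ ω, ∑' y : ω.1, wt n M ω o y * ∫⁻ z, ∫⁻ z', jdg n ω y z z' ∂ν ∂ν ∂P ≤ E := by
    calc _ ≤ ∫⁻ ω, E ∂P := by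
          refine lintegral_mono fun ω => ?_
          calc ∑' y : ω.1, wt n M ω o y * ∫⁻ z, ∫⁻ z', jdg n ω y z z' ∂ν ∂ν
              ≤ ∑' y : ω.1, wt n M ω o y * E := by
                refine ENNReal.tsum_le_tsum fun y => ?_
                by_cases hG : Gd n M ω o y
                · exact mul_le_mul_right (ps_energy hsym hν n (by linarith) hG.1) _
                · rw [wt_eq_zero hG, zero_mul, zero_mul]
            _ = (∑' y : ω.1, wt n M ω o y) * E := ENNReal.tsum_mul_right
            _ ≤ E := mul_le_of_le_one_left' (tsum_wt_le n M ω o)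
      _ = E := by simp
  calc P {ω | Th n M r ω o} = ∫⁻ ω, {ω | Th n M r ω o}.indicator (1 : Config X → ℝ≥0∞) ω ∂P :=
        (lintegral_indicator_one hmT).symm
    _ ≤ ∫⁻ ω, ∑' y : ω.1, ms ν n M ω y * gT ν n M r κ ω y o ∂P := by
        refine lintegral_mono fun ω => ?_
        by_cases h : Th n M r ω o
        · rw [indicator_of_mem (show ω ∈ {ω | Th n M r ω o} from h)]
          exact one_le_gT hsym hν n hM h
        · rw [indicator_of_notMem (show ω ∉ {ω | Th n M r ω o} from h)]
          exact zero_le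
    _ = ∫⁻ ω, ∑' y : ω.1, wt n M ω o y * ∫⁻ z, gT ν n M r κ ω y z ∂ν ∂P := m1.symm
    _ ≤ ∫⁻ ω, CBK ν o r * ∑' y : ω.1, wt n M ω o y *
          ∫⁻ z, ∫⁻ z', jgg ν n M κ ω y z z' ∂ν ∂ν ∂P := by
        refine lintegral_mono fun ω => ?_
        simp only [← ENNReal.tsum_mul_left]
        refine ENNReal.tsum_le_tsum fun y => ?_
        rw [mul_left_comm]
        exact mul_le_mul_right (gT_le hsym hν n M hr hκ ω y) _
    _ = CBK ν o r * ∫⁻ ω, ∑' y : ω.1, ms ν n M ω y * ∫⁻ z', jgg ν n M κ ω y o z' ∂ν ∂P := by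
        rw [lintegral_const_mul' _ _ (CBK_ne_top hν r), m2]
    _ ≤ CBK ν o r * ∫⁻ ω, (ENNReal.ofReal (1 / (κ * η)) * ∑' y : ω.1, ms ν n M ω y *
          ∫⁻ z', jdg n ω y o z' ∂ν) + ENNReal.ofReal (4 * η) * ν (closedBall o 3) ∂P := by
        refine mul_le_mul_right (lintegral_mono fun ω => ?_) _
        have f1 : ∑' y : ω.1, ms ν n M ω y * ∫⁻ z', jgg ν n M κ ω y o z' ∂ν =
            ∫⁻ z', ∑' y : ω.1, ms ν n M ω y * jgg ν n M κ ω y o z' ∂ν := by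
          rw [lintegral_tsum fun y : ω.1 => ((hjg ω y o).const_mul _).aemeasurable]
          exact tsum_congr fun y => (lintegral_const_mul _ (hjg ω y o)).symm
        have f2 : ∑' y : ω.1, ms ν n M ω y * ∫⁻ z', jdg n ω y o z' ∂ν =
            ∫⁻ z', ∑' y : ω.1, ms ν n M ω y * jdg n ω y o z' ∂ν := by
          rw [lintegral_tsum fun y : ω.1 => ((hjd ω y o).const_mul _).aemeasurable]
          exact tsum_congr fun y => (lintegral_const_mul _ (hjd ω y o)).symm
        have hi : Measurable ((closedBall o 3).indicator (1 : X → ℝ≥0∞)) :=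
          measurable_one.indicator isClosed_closedBall.measurableSet
        show ∑' y : ω.1, ms ν n M ω y * ∫⁻ z', jgg ν n M κ ω y o z' ∂ν ≤ _
        rw [f1, f2]
        refine (lintegral_mono fun z' => sum_jgg_le hν n M hκ hη ω o z').trans ?_
        rw [lintegral_add_right _ (hi.const_mul _), lintegral_const_mul _ hi,
          lintegral_indicator_one isClosed_closedBall.measurableSet,
          lintegral_const_mul' _ _ ENNReal.ofReal_ne_top]
    _ = CBK ν o r * (ENNReal.ofReal (1 / (κ * η)) * ∫⁻ ω, ∑' y : ω.1, ms ν n M ω y *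
          ∫⁻ z', jdg n ω y o z' ∂ν ∂P + ENNReal.ofReal (4 * η) * ν (closedBall o 3)) := by
        rw [lintegral_add_right _ measurable_const,
          lintegral_const_mul' _ _ ENNReal.ofReal_ne_top]
        simp
    _ ≤ _ := by
        refine mul_le_mul_right (add_le_add_left (mul_le_mul_right ?_ _) _) _
        rw [← m3]
        exact e3

end Chain

section ClaimD

variable {X : Type*} [MetricSpace X] [ProperSpace X] [PreconnectedSpace X]
  [MeasurableSpace X] [BorelSpace X] {o : X} {ν : Measure X}

open Filter Topology in
lemma ennreal_squeeze {p K E V : ℝ≥0∞} {κ : ℝ} (hK : K ≠ ⊤) (hE : E ≠ ⊤) (hV : V ≠ ⊤)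
    (h : ∀ M η : ℝ, 8 ≤ M → 0 < η → p ≤ K * (ENNReal.ofReal (1 / (κ * η)) *
      (E * ENNReal.ofReal (2 / M)) + ENNReal.ofReal (4 * η) * V)) : p = 0 := by
  have h1 : ∀ η : ℝ, 0 < η → p ≤ K * (ENNReal.ofReal (4 * η) * V) := by
    intro η hη
    have t0 : Tendsto (fun k : ℕ => (2 : ℝ) / (k + 8 : ℕ)) atTop (𝓝 0) :=
      (tendsto_const_div_atTop_nhds_zero_nat 2).comp (tendsto_add_atTop_nat 8)
    have t1 := ENNReal.tendsto_ofReal t0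
    rw [ENNReal.ofReal_zero] at t1
    have t2 := ENNReal.Tendsto.const_mul (a := E) t1 (Or.inr hE)
    have t3 := ENNReal.Tendsto.const_mul (a := ENNReal.ofReal (1 / (κ * η))) t2
      (Or.inr ENNReal.ofReal_ne_top)
    have t4 := ENNReal.Tendsto.const_mul (a := K)
      (t3.add (tendsto_const_nhds (x := ENNReal.ofReal (4 * η) * V))) (Or.inr hK)
    simp only [mul_zero, zero_add] at t4
    refine ge_of_tendsto' t4 fun k => h _ η ?_ hη
    push_cast; linarith [(Nat.cast_nonneg k : (0:ℝ) ≤ k)]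
  have t0 : Tendsto (fun k : ℕ => 4 * ((1 : ℝ) / ((k : ℝ) + 1))) atTop (𝓝 (4 * 0)) :=
    tendsto_one_div_add_atTop_nhds_zero_nat.const_mul 4
  rw [mul_zero] at t0
  have t1 := ENNReal.tendsto_ofReal t0
  rw [ENNReal.ofReal_zero] at t1
  have t2 := ENNReal.Tendsto.const_mul (a := K)
    (ENNReal.Tendsto.mul_const (b := V) t1 (Or.inr hV)) (Or.inr hK)
  rw [zero_mul, mul_zero] at t2
  exact le_antisymm (ge_of_tendsto' t2 fun k => h1 _ (by positivity)) zero_le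

/-- Trifurcations have bounded kernels. -/
lemma claimD_aux [SigmaFinite ν] (hsym : PointSymmetric X) (hν : RefMeasure o ν)
    {P : Measure (Config X)} [IsProbabilityMeasure P] (hP : IsoInvariant P) (r : ℕ) :
    ∀ᵐ ω ∂P, ∀ x, Trif ω r x → (∀ C : ℝ, ∃ n, C < hk ω n x x) → 1/2 < dist x o := by
  set U : Set (Config X) := {ω | ¬ ∀ x, Trif ω r x → (∀ C : ℝ, ∃ n, C < hk ω n x x) →
    1/2 < dist x o} with hU
  show P U = 0
  refine ennreal_squeeze (p := P U) (K := CBK ν o r)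
    (E := 9 * ν (closedBall o (3+1)) * ν (closedBall o (4+1))) (V := ν (closedBall o 3))
    (κ := kap ν o) (CBK_ne_top hν r) (ENNReal.mul_ne_top (ENNReal.mul_ne_top (by norm_num)
      (hν.fin _ _).ne) (hν.fin _ _).ne) (hν.fin _ _).ne ?_
  intro M η hM hη
  have hmono : Monotone fun n : ℕ => {ω : Config X | Th n M r ω o} := by
    intro a b hab ω hω
    obtain ⟨x, hx, ⟨h1, h2⟩, h3⟩ := hω
    exact ⟨x, hx, ⟨h1, h2.trans (hk_mono x x hab)⟩, h3⟩
  have hsub : U ⊆ ⋃ n : ℕ, {ω : Config X | Th n M r ω o} := by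
    intro ω hω
    have hω' : ¬ ∀ x, Trif ω r x → (∀ C : ℝ, ∃ n, C < hk ω n x x) → 1/2 < dist x o := hω
    push Not at hω'
    obtain ⟨x, h1, h2, h3⟩ := hω'
    obtain ⟨n, hn⟩ := h2 M
    exact mem_iUnion.2 ⟨n, x, h1.1, ⟨h1, hn.le⟩, h3⟩
  refine (measure_mono hsub).trans ?_
  rw [hmono.measure_iUnion]
  exact iSup_le fun n => chain hsym hν hP n hM (Nat.cast_nonneg r) hη

lemma claimD [SigmaFinite ν] (hsym : PointSymmetric X) (hν : RefMeasure o ν)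
    {P : Measure (Config X)} [IsProbabilityMeasure P] (hP : IsoInvariant P) :
    ∀ᵐ ω ∂P, ∀ (r : ℕ) (x : X), Trif ω r x → ∃ C : ℝ, ∀ n, hk ω n x x ≤ C := by
  rw [ae_all_iff]
  intro r
  have h := ae_transfer hsym o hP (E := fun ω a => ∀ x, Trif ω r x →
    (∀ C : ℝ, ∃ n, C < hk ω n x x) → 1/2 < dist x a) ?_ (claimD_aux hsym hν hP r)
  · filter_upwards [h] with ω hω x hx
    by_contra hcon
    push Not at hcon
    obtain ⟨t, ht, h2⟩ := hω x (1/2) (by norm_num)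
    have := h2 x hx hcon
    rw [dist_comm] at this
    linarith
  · intro g ω a h x hx hC
    have := h (g x) ((trif_mapIso g).2 hx) (by simpa only [hk_mapIso] using hC)
    rw [← g.isometry.dist_eq, g.apply_symm_apply]
    exact this

end ClaimD

/-- **Transience of infinite clusters** (Theorem 6).
If the graph of an isometry invariant insertion-tolerant Boolean model has infinitely many
infinite connected components a.s., then a.s. all of its infinite components are
transient. -/
theorem transience_of_infinite_clusters
    {X : Type*} [MetricSpace X] [ProperSpace X] [CompleteSpace X] [SimplyConnectedSpace X]
    [NoncompactSpace X] [MeasurableSpace X] [BorelSpace X] [Nonempty X]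
    (hsym : PointSymmetric X)
    (μ : Measure X)
    (hμiso : ∀ γ : X ≃ᵢ X, Measure.map γ μ = μ)
    (hμball : ∀ (x : X) (r : ℝ), 0 < r → 0 < μ (closedBall x r) ∧ μ (closedBall x r) < ⊤)
    (P : Measure (Config X)) [IsProbabilityMeasure P]
    (hPiso : IsoInvariant P) (hPins : InsertionTolerant μ P)
    (hN : ∀ᵐ ω ∂P,
      {C : Set X | (∃ x ∈ ω.1, C = graphComp (boolAdj ω) x) ∧ C.Infinite}.Infinite) :
    ∀ᵐ ω ∂P, ∀ x ∈ ω.1, (graphComp (boolAdj ω) x).Infinite →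
      TransientFrom (boolAdj ω) x := by
  obtain ⟨o⟩ := ‹Nonempty X›
  have : Nonempty X := ⟨o⟩
  have : PathConnectedSpace X := inferInstance
  have : PreconnectedSpace X := inferInstance
  obtain ⟨ν, hν⟩ := exists_refMeasure hsym o
  have : SigmaFinite ν := hν.sigmaFinite
  filter_upwards [claimC hsym hν hμball hPins hPiso hN, claimD hsym hν hPiso] with ω hC hD x hx hinf
  have hI : Inf ω.1 x := by
    rw [graphComp_eq ω hx] at hinf
    exact hinf
  obtain ⟨r, y, hxy, hT⟩ := hC x hI
  obtain ⟨C, hb⟩ := hD r y hT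
  exact transient_conn hxy (transient_of_bdd hT.1 hb)

end BooleanModel
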